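/- Let d ≥ 2, 0 < γ < 1, and let D₀ ⊂ ℝ^d be a bounded C^{1+γ} domain. Then there exist a map X : ℝ^d × ℝ → ℝ^d and, for each t ∈ ℝ, a bounded C^{1+γ} domain D_t := X(D₀,t), such that: X(α,0) = α for all α ∈ ℝ^d; for each t ∈ ℝ the map X(·,t) is a homeomorphism of ℝ^d onto itself; and for every α ∈ ℝ^d the curve t ↦ X(α,t) is differentiable on ℝ with ∂_t X(α,t) = v(X(α,t),t), where v(x,t) = -∫_{D_t} ∇N(x-y) dy. In particular, ρ(x,t) = χ_{D_t}(x) solves the rescaled aggregation transport problem ∂_t ρ + ∇ρ·v = 0, v = -∇N * ρ, ρ(·,0) = χ_{D₀}, with a patch boundary ∂D_t of class C^{1+γ} for every t ∈ ℝ. -/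

import Mathlib

open MeasureTheory Metric Set
open scoped RealInnerProductSpace

noncomputable def sphereVol (d : ℕ) : ℝ :=
  d * (volume (Metric.ball (0 : EuclideanSpace ℝ (Fin d)) 1)).toReal

noncomputable def gradN (d : ℕ) (y : EuclideanSpace ℝ (Fin d)) : EuclideanSpace ℝ (Fin d) :=
  (sphereVol d * ‖y‖ ^ d)⁻¹ • y

noncomputable def hessN (d : ℕ) (z w : EuclideanSpace ℝ (Fin d)) : EuclideanSpace ℝ (Fin d) :=
  (sphereVol d)⁻¹ • ((‖z‖ ^ d)⁻¹ • w - ((d : ℝ) * (‖z‖ ^ (d + 2))⁻¹ * ⟪z, w⟫) • z)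

/-- `Φ` is a defining function of class `C^{1+γ}` for the set `D`. -/
def IsDefining (d : ℕ) (γ : ℝ) (D : Set (EuclideanSpace ℝ (Fin d)))
    (Φ : EuclideanSpace ℝ (Fin d) → ℝ) : Prop :=
  ContDiff ℝ 1 Φ ∧
  (∃ K : ℝ, ∀ x y, ‖gradient Φ x - gradient Φ y‖ ≤ K * ‖x - y‖ ^ γ) ∧
  D = {x | Φ x < 0} ∧
  frontier D = {x | Φ x = 0} ∧
  ∀ x ∈ frontier D, gradient Φ x ≠ 0

/-- `D` is a bounded domain of class `C^{1+γ}`. -/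
def IsC1Domain (d : ℕ) (γ : ℝ) (D : Set (EuclideanSpace ℝ (Fin d))) : Prop :=
  IsOpen D ∧ Bornology.IsBounded D ∧ ∃ Φ, IsDefining d γ D Φ


namespace AggPatch
open MeasureTheory Metric Set
open scoped RealInnerProductSpace

/-- ambient Euclidean space -/
abbrev Eu (d : ℕ) := EuclideanSpace ℝ (Fin d)

/-- reciprocal of the regularised distance -/
noncomputable def uu {d : ℕ} (δ : ℝ) (z : Eu d) : ℝ := (√(‖z‖ ^ 2 + δ ^ 2))⁻¹

/-- regularised kernel -/
noncomputable def kk (d : ℕ) (δ : ℝ) (z : Eu d) : Eu d := (uu δ z) ^ d • z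

/-- derivative of the regularised kernel -/
noncomputable def Dk (d : ℕ) (δ : ℝ) (z : Eu d) : Eu d →L[ℝ] Eu d :=
  (uu δ z) ^ d • ContinuousLinearMap.id ℝ (Eu d)
    - ((d : ℝ) * (uu δ z) ^ (d + 2)) • (innerSL ℝ z).smulRight z

/-- divergence of the regularised kernel -/
noncomputable def psi (d : ℕ) (δ : ℝ) (z : Eu d) : ℝ := (d : ℝ) * δ ^ 2 * (uu δ z) ^ (d + 2)

variable {d : ℕ}

lemma Dk_apply (δ : ℝ) (z w : Eu d) :
    Dk d δ z w = (uu δ z) ^ d • w - ((d : ℝ) * (uu δ z) ^ (d + 2) * ⟪z, w⟫) • z := by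
  simp [Dk, smul_smul]

lemma nu_pos {δ : ℝ} (hδ : 0 < δ) (z : Eu d) : 0 < √(‖z‖ ^ 2 + δ ^ 2) := by positivity

lemma uu_pos {δ : ℝ} (hδ : 0 < δ) (z : Eu d) : 0 < uu δ z := inv_pos.2 (nu_pos hδ z)

lemma uu_nonneg (δ : ℝ) (z : Eu d) : 0 ≤ uu δ z := by unfold uu; positivity

lemma uu_sq {δ : ℝ} (hδ : 0 < δ) (z : Eu d) : (uu δ z) ^ 2 * (‖z‖ ^ 2 + δ ^ 2) = 1 := by
  have h : 0 < ‖z‖ ^ 2 + δ ^ 2 := by positivity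
  rw [uu, inv_pow, Real.sq_sqrt h.le]; field_simp

lemma uu_mul_norm_le {δ : ℝ} (hδ : 0 < δ) (z : Eu d) : uu δ z * ‖z‖ ≤ 1 := by
  have h := uu_sq hδ z
  have h0 := uu_nonneg δ z
  have : (uu δ z * ‖z‖) ^ 2 ≤ 1 := by nlinarith [sq_nonneg (uu δ z * δ)]
  exact (sq_le_one_iff₀ (by positivity)).1 this

lemma uu_mul_le {δ : ℝ} (hδ : 0 < δ) (z : Eu d) : uu δ z * δ ≤ 1 := by
  have h := uu_sq hδ z
  have h0 := uu_nonneg δ z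
  have : (uu δ z * δ) ^ 2 ≤ 1 := by nlinarith [sq_nonneg (uu δ z * ‖z‖)]
  exact (sq_le_one_iff₀ (by positivity)).1 this

lemma uu_le_inv {δ : ℝ} (hδ : 0 < δ) (z : Eu d) : uu δ z ≤ δ⁻¹ := by
  have := uu_mul_le hδ z
  rw [← one_div, le_div_iff₀ hδ]; exact this

lemma uu_le_inv_norm {δ : ℝ} (hδ : 0 < δ) {z : Eu d} (hz : z ≠ 0) : uu δ z ≤ ‖z‖⁻¹ := by
  have := uu_mul_norm_le hδ z
  rw [← one_div, le_div_iff₀ (norm_pos_iff.2 hz)]; exact this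

lemma uu_antitone {δ η : ℝ} (hδ : 0 < δ) (h : δ ≤ η) (z : Eu d) : uu η z ≤ uu δ z := by
  unfold uu
  apply inv_anti₀ (nu_pos hδ z)
  apply Real.sqrt_le_sqrt; gcongr

lemma contDiff_uu {δ : ℝ} (hδ : 0 < δ) {n : WithTop ℕ∞} : ContDiff ℝ n (fun z : Eu d => uu δ z) := by
  unfold uu
  apply ContDiff.inv
  · apply ContDiff.sqrt
    · exact (contDiff_norm_sq ℝ).add contDiff_const
    · intro x; positivity
  · intro x; exact (nu_pos hδ x).ne'

lemma contDiff_kk {δ : ℝ} (hδ : 0 < δ) {n : WithTop ℕ∞} : ContDiff ℝ n (kk d δ) := by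
  unfold kk
  exact ((contDiff_uu hδ).pow d).smul contDiff_id

lemma continuous_kk {δ : ℝ} (hδ : 0 < δ) : Continuous (kk d δ) :=
  (contDiff_kk hδ (n := 0)).continuous

lemma contDiff_psi {δ : ℝ} (hδ : 0 < δ) {n : WithTop ℕ∞} : ContDiff ℝ n (psi d δ) := by
  unfold psi
  exact contDiff_const.mul ((contDiff_uu hδ).pow (d + 2))

lemma hasFDerivAt_uu {δ : ℝ} (hδ : 0 < δ) (z : Eu d) :
    HasFDerivAt (fun z : Eu d => uu δ z) (-((uu δ z) ^ 3) • innerSL ℝ z) z := by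
  have h1 : HasFDerivAt (fun z : Eu d => ‖z‖ ^ 2 + δ ^ 2) (2 • innerSL ℝ z) z := by
    have := (hasStrictFDerivAt_norm_sq z).hasFDerivAt
    exact this.add_const _
  have hp : ‖z‖ ^ 2 + δ ^ 2 ≠ 0 := by positivity
  have h2 := h1.sqrt hp
  have h3 := (hasDerivAt_inv (nu_pos hδ z).ne').comp_hasFDerivAt z h2
  refine h3.congr_fderiv ?_
  ext w
  simp [uu]
  have := (nu_pos hδ z).ne'
  field_simp

lemma hasFDerivAt_kk {δ : ℝ} (hδ : 0 < δ) (z : Eu d) :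
    HasFDerivAt (kk d δ) (Dk d δ z) z := by
  have h1 := (hasFDerivAt_uu hδ z).pow d
  have h2 := h1.smul (hasFDerivAt_id (𝕜 := ℝ) z)
  refine h2.congr_fderiv ?_
  ext1 w
  rw [Dk_apply]
  simp only [_root_.add_apply, _root_.smul_apply, id,
    ContinuousLinearMap.smulRight_apply, innerSL_apply_apply, ContinuousLinearMap.id_apply, smul_eq_mul]
  rw [sub_eq_add_neg, ← neg_smul]
  congr 2
  rcases Nat.eq_zero_or_pos d with h | h
  · subst h; simp
  · obtain ⟨k, rfl⟩ : ∃ k, d = k + 1 := ⟨d - 1, by omega⟩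
    simp
    ring

lemma Dk_symm (δ : ℝ) (z a b : Eu d) : ⟪Dk d δ z a, b⟫ = ⟪a, Dk d δ z b⟫ := by
  rw [Dk_apply, Dk_apply, inner_sub_left, inner_sub_right, inner_smul_left, inner_smul_left,
    inner_smul_right, inner_smul_right, real_inner_comm z a]
  simp; ring

lemma trace_Dk {δ : ℝ} (hδ : 0 < δ) (z : Eu d) {ι : Type*} [Fintype ι]
    (b : OrthonormalBasis ι ℝ (Eu d)) :
    ∑ i, ⟪b i, Dk d δ z (b i)⟫ = psi d δ z := by
  have h1 : ∀ i, ⟪b i, Dk d δ z (b i)⟫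
      = (uu δ z) ^ d - (d : ℝ) * (uu δ z) ^ (d + 2) * (⟪z, b i⟫ ^ 2) := by
    intro i
    rw [Dk_apply, inner_sub_right, inner_smul_right, inner_smul_right,
      real_inner_self_eq_norm_sq, b.orthonormal.1 i, real_inner_comm z (b i)]
    ring
  have h2 : ∑ i, ⟪z, b i⟫ ^ 2 = ‖z‖ ^ 2 := by
    rw [← b.sum_sq_norm_inner_left z]; simp
  have hc : (Fintype.card ι : ℝ) = d := by
    have := Module.finrank_eq_card_basis b.toBasis
    rw [finrank_euclideanSpace_fin] at this
    exact_mod_cast this.symm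
  simp_rw [h1]
  rw [Finset.sum_sub_distrib, ← Finset.mul_sum, h2, Finset.sum_const, Finset.card_univ, nsmul_eq_mul,
    hc, psi]
  have := uu_sq hδ z
  rw [pow_add]
  linear_combination (-(d : ℝ) * uu δ z ^ d) * this

lemma norm_kk_le {δ : ℝ} (hδ : 0 < δ) (hd : 1 ≤ d) (z : Eu d) : ‖kk d δ z‖ ≤ (uu δ z) ^ (d - 1) := by
  rw [kk, norm_smul, Real.norm_of_nonneg (pow_nonneg (uu_nonneg _ _) _)]
  obtain ⟨k, rfl⟩ : ∃ k, d = k + 1 := ⟨d - 1, by omega⟩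
  have := uu_mul_norm_le hδ z
  have h0 := uu_nonneg δ z
  rw [pow_succ, mul_assoc]
  simpa using mul_le_mul_of_nonneg_left this (pow_nonneg h0 k)

lemma norm_Dk_le {δ : ℝ} (hδ : 0 < δ) (z : Eu d) : ‖Dk d δ z‖ ≤ (1 + d) * (uu δ z) ^ d := by
  have h0 := uu_nonneg δ z
  apply ContinuousLinearMap.opNorm_le_bound _ (by positivity)
  intro w
  rw [Dk_apply]
  have h1 : |⟪z, w⟫| ≤ ‖z‖ * ‖w‖ := abs_real_inner_le_norm z w
  have h2 := uu_mul_norm_le hδ z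
  calc ‖uu δ z ^ d • w - ((d : ℝ) * uu δ z ^ (d + 2) * ⟪z, w⟫) • z‖
      ≤ ‖uu δ z ^ d • w‖ + ‖((d : ℝ) * uu δ z ^ (d + 2) * ⟪z, w⟫) • z‖ := norm_sub_le _ _
    _ = uu δ z ^ d * ‖w‖ + d * uu δ z ^ (d + 2) * |⟪z, w⟫| * ‖z‖ := by
        rw [norm_smul, norm_smul, Real.norm_of_nonneg (by positivity), norm_mul,
          Real.norm_of_nonneg (by positivity), Real.norm_eq_abs]
    _ ≤ uu δ z ^ d * ‖w‖ + d * uu δ z ^ (d + 2) * (‖z‖ * ‖w‖) * ‖z‖ := by gcongr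
    _ = uu δ z ^ d * ‖w‖ + d * uu δ z ^ d * ((uu δ z * ‖z‖) * (uu δ z * ‖z‖)) * ‖w‖ := by ring
    _ ≤ uu δ z ^ d * ‖w‖ + d * uu δ z ^ d * (1 * 1) * ‖w‖ := by gcongr
    _ = (1 + d) * uu δ z ^ d * ‖w‖ := by ring

lemma nu_sub_le (δ η : ℝ) (z w : Eu d) :
    |√(‖z‖ ^ 2 + δ ^ 2) - √(‖w‖ ^ 2 + η ^ 2)| ≤ ‖z - w‖ + |δ - η| := by
  have key : ∀ (a b a' b' : ℝ), √(a ^ 2 + b ^ 2) ≤ √(a' ^ 2 + b' ^ 2) + (|a - a'| + |b - b'|) := by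
    intro a b a' b'
    have h0 : 0 ≤ √(a' ^ 2 + b' ^ 2) := Real.sqrt_nonneg _
    apply Real.sqrt_le_iff.2 ⟨by positivity, ?_⟩
    have ha : |a'| ≤ √(a' ^ 2 + b' ^ 2) := Real.abs_le_sqrt (by nlinarith [sq_nonneg b'])
    have hb : |b'| ≤ √(a' ^ 2 + b' ^ 2) := Real.abs_le_sqrt (by nlinarith [sq_nonneg a'])
    have hs : √(a' ^ 2 + b' ^ 2) ^ 2 = a' ^ 2 + b' ^ 2 := Real.sq_sqrt (by positivity)
    have e1 : a' * (a - a') ≤ √(a' ^ 2 + b' ^ 2) * |a - a'| := by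
      calc a' * (a - a') ≤ |a' * (a - a')| := le_abs_self _
        _ = |a'| * |a - a'| := abs_mul _ _
        _ ≤ _ := by gcongr
    have e2 : b' * (b - b') ≤ √(a' ^ 2 + b' ^ 2) * |b - b'| := by
      calc b' * (b - b') ≤ |b' * (b - b')| := le_abs_self _
        _ = |b'| * |b - b'| := abs_mul _ _
        _ ≤ _ := by gcongr
    have e3 : 0 ≤ |a - a'| * |b - b'| := by positivity
    have e4 : |a - a'| ^ 2 = (a - a') ^ 2 := sq_abs _
    have e5 : |b - b'| ^ 2 = (b - b') ^ 2 := sq_abs _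
    nlinarith
  have h1 := key ‖z‖ δ ‖w‖ η
  have h2 := key ‖w‖ η ‖z‖ δ
  have h3 := abs_norm_sub_norm_le z w
  have h4 : |‖w‖ - ‖z‖| = |‖z‖ - ‖w‖| := abs_sub_comm _ _
  have h5 : |η - δ| = |δ - η| := abs_sub_comm _ _
  rw [abs_le]; constructor <;> linarith

lemma uu_sub_le {δ η : ℝ} (hδ : 0 < δ) (hη : 0 < η) (z w : Eu d) :
    |uu δ z - uu η w| ≤ uu δ z * uu η w * (‖z - w‖ + |δ - η|) := by
  have h1 := nu_pos hδ z
  have h2 := nu_pos hη w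
  have h := nu_sub_le δ η z w
  have : uu δ z - uu η w = uu δ z * uu η w * (√(‖w‖ ^ 2 + η ^ 2) - √(‖z‖ ^ 2 + δ ^ 2)) := by
    unfold uu; field_simp
  rw [this, abs_mul, abs_of_nonneg (mul_nonneg (uu_nonneg _ _) (uu_nonneg _ _)), abs_sub_comm]
  exact mul_le_mul_of_nonneg_left h (mul_nonneg (uu_nonneg _ _) (uu_nonneg _ _))

lemma pow_sub_pow_le (n : ℕ) {a b M : ℝ} (ha : 0 ≤ a) (hb : 0 ≤ b) (haM : a ≤ M) (hbM : b ≤ M) :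
    |a ^ n - b ^ n| ≤ n * M ^ (n - 1) * |a - b| := by
  induction n with
  | zero => simp
  | succ k ih =>
    have hM : 0 ≤ M := ha.trans haM
    rcases Nat.eq_zero_or_pos k with h | h
    · subst h; simp
    have e : a ^ (k + 1) - b ^ (k + 1) = a * (a ^ k - b ^ k) + (a - b) * b ^ k := by ring
    have e2 : M ^ k = M * M ^ (k - 1) := by
      rw [← pow_succ']; congr 1; omega
    calc |a ^ (k + 1) - b ^ (k + 1)| ≤ |a * (a ^ k - b ^ k)| + |(a - b) * b ^ k| := by
          rw [e]; exact abs_add_le _ _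
      _ = a * |a ^ k - b ^ k| + |a - b| * b ^ k := by
          rw [abs_mul, abs_mul, abs_of_nonneg ha, abs_of_nonneg (pow_nonneg hb k)]
      _ ≤ M * (k * M ^ (k - 1) * |a - b|) + |a - b| * M ^ k := by gcongr
      _ = _ := by
          push_cast
          rw [e2]; ring

/-- Lipschitz estimate of the derivative kernel, jointly in the point and the parameter. -/
lemma Dk_sub_le {δ η M : ℝ} (hδ : 0 < δ) (hη : 0 < η) (z w : Eu d)
    (hz : uu δ z ≤ M) (hw : uu η w ≤ M) :
    ‖Dk d δ z - Dk d η w‖ ≤ (d + d * (d + 4)) * M ^ (d + 1) * (‖z - w‖ + |δ - η|) := by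
  set Δ := ‖z - w‖ + |δ - η| with hΔ
  have hΔ0 : 0 ≤ Δ := by positivity
  have hu0 := uu_nonneg δ z
  have hv0 := uu_nonneg η w
  have hM : 0 ≤ M := hu0.trans hz
  set u := uu δ z with hu
  set v := uu η w with hv
  have huv : |u - v| ≤ M * M * Δ := (uu_sub_le hδ hη z w).trans (by gcongr)
  have hpow : |u ^ d - v ^ d| ≤ d * M ^ (d + 1) * Δ := by
    rcases Nat.eq_zero_or_pos d with h | h
    · subst h; simp
    calc |u ^ d - v ^ d| ≤ d * M ^ (d - 1) * |u - v| := pow_sub_pow_le d hu0 hv0 hz hw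
      _ ≤ d * M ^ (d - 1) * (M * M * Δ) := by gcongr
      _ = d * (M ^ (d - 1) * M ^ 2) * Δ := by ring
      _ = d * M ^ (d + 1) * Δ := by rw [← pow_add]; congr 3; omega
  -- unit vectors
  have hζ1 : ‖u • z‖ ≤ 1 := by
    rw [norm_smul, Real.norm_of_nonneg hu0]; exact uu_mul_norm_le hδ z
  have hζ2 : ‖v • w‖ ≤ 1 := by
    rw [norm_smul, Real.norm_of_nonneg hv0]; exact uu_mul_norm_le hη w
  have hζ : ‖u • z - v • w‖ ≤ 2 * M * Δ := by
    have e : u • z - v • w = u • (z - w) + (u - v) • w := by module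
    have h1 := uu_sub_le hδ hη z w
    have h2 := uu_mul_norm_le hη w
    calc ‖u • z - v • w‖ ≤ ‖u • (z - w)‖ + ‖(u - v) • w‖ := by rw [e]; exact norm_add_le _ _
      _ = u * ‖z - w‖ + |u - v| * ‖w‖ := by
          rw [norm_smul, norm_smul, Real.norm_of_nonneg hu0, Real.norm_eq_abs]
      _ ≤ u * Δ + (u * v * Δ) * ‖w‖ := by
          gcongr
          rw [hΔ]; linarith [abs_nonneg (δ - η)]
      _ = u * Δ + u * Δ * (v * ‖w‖) := by ring
      _ ≤ M * Δ + M * Δ * 1 := by gcongr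
      _ = 2 * M * Δ := by ring
  apply ContinuousLinearMap.opNorm_le_bound _ (by positivity)
  intro x
  have e : (Dk d δ z - Dk d η w) x = (u ^ d - v ^ d) • x
      - (d : ℝ) • ((u ^ d - v ^ d) • (⟪u • z, x⟫ • (u • z))
        + v ^ d • (⟪u • z - v • w, x⟫ • (u • z)) + v ^ d • (⟪v • w, x⟫ • (u • z - v • w))) := by
    rw [_root_.sub_apply, Dk_apply, Dk_apply, inner_sub_left]
    simp only [real_inner_smul_left, ← hu, ← hv]
    module
  rw [e]
  have n1 : |⟪u • z, x⟫| ≤ 1 * ‖x‖ := (abs_real_inner_le_norm _ _).trans (by gcongr)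
  have n2 : |⟪v • w, x⟫| ≤ 1 * ‖x‖ := (abs_real_inner_le_norm _ _).trans (by gcongr)
  have n3 : |⟪u • z - v • w, x⟫| ≤ (2 * M * Δ) * ‖x‖ := (abs_real_inner_le_norm _ _).trans (by gcongr)
  have hvd : v ^ d ≤ M ^ d := by gcongr
  have hvd0 : 0 ≤ v ^ d := by positivity
  have t0 : ‖(u ^ d - v ^ d) • x‖ ≤ d * M ^ (d + 1) * Δ * ‖x‖ := by
    rw [norm_smul, Real.norm_eq_abs]; gcongr
  have t1 : ‖(u ^ d - v ^ d) • (⟪u • z, x⟫ • (u • z))‖ ≤ (d * M ^ (d + 1) * Δ) * ((1 * ‖x‖) * 1) := by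
    rw [norm_smul, norm_smul, Real.norm_eq_abs, Real.norm_eq_abs]; gcongr
  have t2 : ‖v ^ d • (⟪u • z - v • w, x⟫ • (u • z))‖ ≤ M ^ d * ((2 * M * Δ) * ‖x‖ * 1) := by
    rw [norm_smul, norm_smul, Real.norm_eq_abs, Real.norm_eq_abs, abs_of_nonneg hvd0]; gcongr
  have t3 : ‖v ^ d • (⟪v • w, x⟫ • (u • z - v • w))‖ ≤ M ^ d * ((1 * ‖x‖) * (2 * M * Δ)) := by
    rw [norm_smul, norm_smul, Real.norm_eq_abs, Real.norm_eq_abs, abs_of_nonneg hvd0]; gcongr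
  refine (norm_sub_le _ _).trans ?_
  rw [norm_smul (d : ℝ), Real.norm_of_nonneg (Nat.cast_nonneg d)]
  calc _ ≤ d * M ^ (d + 1) * Δ * ‖x‖ + d * ((d * M ^ (d + 1) * Δ) * ((1 * ‖x‖) * 1)
        + M ^ d * ((2 * M * Δ) * ‖x‖ * 1) + M ^ d * ((1 * ‖x‖) * (2 * M * Δ))) := by
        gcongr
        exact (norm_add₃_le).trans (by gcongr)
    _ = _ := by rw [pow_succ]; ring

/-- Lipschitz estimate of the kernel. -/
lemma kk_sub_le {δ M : ℝ} (hδ : 0 < δ) (hd : 1 ≤ d) (z w : Eu d)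
    (hz : uu δ z ≤ M) (hw : uu δ w ≤ M) :
    ‖kk d δ z - kk d δ w‖ ≤ (d + 1) * M ^ d * ‖z - w‖ := by
  have hu0 := uu_nonneg δ z
  have hv0 := uu_nonneg δ w
  have hM : 0 ≤ M := hu0.trans hz
  set u := uu δ z with hu
  set v := uu δ w with hv
  have huv : |u - v| ≤ u * v * ‖z - w‖ := by
    have := uu_sub_le hδ hδ z w
    simpa using this
  have h2 := uu_mul_norm_le hδ w
  have e : kk d δ z - kk d δ w = u ^ d • (z - w) + (u ^ d - v ^ d) • w := by
    unfold kk; rw [← hu, ← hv]; module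
  have hp : |u ^ d - v ^ d| ≤ d * M ^ (d - 1) * |u - v| := pow_sub_pow_le d hu0 hv0 hz hw
  have hMd : M ^ (d - 1) * M = M ^ d := by rw [← pow_succ]; congr 1; omega
  rw [e]
  calc _ ≤ ‖u ^ d • (z - w)‖ + ‖(u ^ d - v ^ d) • w‖ := norm_add_le _ _
    _ = u ^ d * ‖z - w‖ + |u ^ d - v ^ d| * ‖w‖ := by
        rw [norm_smul, norm_smul, Real.norm_of_nonneg (by positivity), Real.norm_eq_abs]
    _ ≤ M ^ d * ‖z - w‖ + d * M ^ (d - 1) * (u * v * ‖z - w‖) * ‖w‖ := by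
        gcongr
        exact hp.trans (by gcongr)
    _ = M ^ d * ‖z - w‖ + d * M ^ (d - 1) * u * ‖z - w‖ * (v * ‖w‖) := by ring
    _ ≤ M ^ d * ‖z - w‖ + d * M ^ (d - 1) * M * ‖z - w‖ * 1 := by gcongr
    _ = (d + 1) * M ^ d * ‖z - w‖ := by rw [← hMd]; ring

lemma continuous_Dk {δ : ℝ} (hδ : 0 < δ) : Continuous (Dk d δ) := by
  have : Dk d δ = fderiv ℝ (kk d δ) := by
    ext1 z; exact (hasFDerivAt_kk hδ z).fderiv.symm
  rw [this]
  exact (contDiff_kk hδ (n := 1)).continuous_fderiv one_ne_zero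

lemma psi_nonneg (δ : ℝ) (z : Eu d) : 0 ≤ psi d δ z := by
  have := uu_nonneg δ z
  unfold psi; positivity

lemma psi_sub_le {δ η : ℝ} (hδ : 0 < δ) (hη : 0 < η) (z w : Eu d) :
    |psi d δ z - psi d η w| ≤ d * ‖Dk d δ z - Dk d η w‖ := by
  rw [← trace_Dk hδ z (EuclideanSpace.basisFun (Fin d) ℝ),
    ← trace_Dk hη w (EuclideanSpace.basisFun (Fin d) ℝ), ← Finset.sum_sub_distrib]
  refine (Finset.abs_sum_le_sum_abs _ _).trans ?_
  calc _ ≤ ∑ i : Fin d, ‖Dk d δ z - Dk d η w‖ := by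
        apply Finset.sum_le_sum
        intro i _
        rw [← inner_sub_right, ← _root_.sub_apply]
        refine (abs_real_inner_le_norm _ _).trans ?_
        have h1 : ‖(EuclideanSpace.basisFun (Fin d) ℝ) i‖ = 1 :=
          (EuclideanSpace.basisFun (Fin d) ℝ).orthonormal.1 i
        rw [h1, one_mul]
        refine (ContinuousLinearMap.le_opNorm _ _).trans ?_
        rw [h1, mul_one]
    _ = _ := by simp

lemma psi_le {δ : ℝ} (hδ : 0 < δ) (z : Eu d) : psi d δ z ≤ d * (δ * (uu δ z) ^ (d + 1)) := by
  have h0 := uu_nonneg δ z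
  have h1 := uu_mul_le hδ z
  unfold psi
  calc (d : ℝ) * δ ^ 2 * uu δ z ^ (d + 2) = d * (δ * uu δ z ^ (d + 1)) * (uu δ z * δ) := by ring
    _ ≤ d * (δ * uu δ z ^ (d + 1)) * 1 := by gcongr
    _ = _ := by ring

/-- scaling of psi -/
lemma psi_scale {δ : ℝ} (hδ : 0 < δ) (z : Eu d) :
    psi d δ (δ • z) = (δ ^ d)⁻¹ * psi d 1 z := by
  have : uu δ (δ • z) = δ⁻¹ * uu 1 z := by
    unfold uu
    rw [norm_smul, Real.norm_of_nonneg hδ.le, ← mul_inv]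
    congr 1
    rw [show (δ * ‖z‖) ^ 2 + δ ^ 2 = δ ^ 2 * (‖z‖ ^ 2 + 1 ^ 2) by ring, Real.sqrt_mul (by positivity),
      Real.sqrt_sq hδ.le]
  unfold psi
  rw [this, mul_pow, inv_pow]
  field_simp
  ring

end AggPatch

namespace AggPatch
open MeasureTheory Metric Set
open scoped RealInnerProductSpace
variable {d : ℕ}

/-- inner majorant -/
noncomputable def gB (d : ℕ) (s r : ℝ) (z : Eu d) : ℝ :=
  (Iio r).indicator (fun y : ℝ => y ^ (s - d)) ‖z‖

/-- outer majorant -/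
noncomputable def gO (d : ℕ) (s r : ℝ) (z : Eu d) : ℝ :=
  (Ioi r).indicator (fun y : ℝ => y ^ (-s - d)) ‖z‖

/-- combined majorant -/
noncomputable def gG (d : ℕ) (γ r : ℝ) (z : Eu d) : ℝ :=
  gB d γ (2 * r) z + r * gO d (1 - γ) r z

lemma gB_nonneg (s r : ℝ) (z : Eu d) : 0 ≤ gB d s r z := by
  unfold gB; apply indicator_apply_nonneg; intro _; positivity

lemma gO_nonneg (s r : ℝ) (z : Eu d) : 0 ≤ gO d s r z := by
  unfold gO; apply indicator_apply_nonneg; intro _; positivity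

lemma gB_of_lt {s r : ℝ} {z : Eu d} (h : ‖z‖ < r) : gB d s r z = ‖z‖ ^ (s - d) := by
  unfold gB; rw [indicator_of_mem]; exact h

lemma gO_of_lt {s r : ℝ} {z : Eu d} (h : r < ‖z‖) : gO d s r z = ‖z‖ ^ (-s - d) := by
  unfold gO; rw [indicator_of_mem]; exact h

lemma polar_B (hd : 1 ≤ d) {s r : ℝ} (y : ℝ) (hy : y ∈ Ioi (0:ℝ)) :
    y ^ (d - 1) • (Iio r).indicator (fun y : ℝ => y ^ (s - d)) y
      = (Iio r).indicator (fun y : ℝ => y ^ (s - 1)) y := by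
  have hy : (0:ℝ) < y := hy
  by_cases h : y ∈ Iio r
  · rw [indicator_of_mem h, indicator_of_mem h, smul_eq_mul, ← Real.rpow_natCast, ← Real.rpow_add hy]
    congr 1; push_cast [Nat.cast_sub hd]; ring
  · simp [indicator_of_notMem h]

lemma polar_O (hd : 1 ≤ d) {s r : ℝ} (y : ℝ) (hy : y ∈ Ioi (0:ℝ)) :
    y ^ (d - 1) • (Ioi r).indicator (fun y : ℝ => y ^ (-s - d)) y
      = (Ioi r).indicator (fun y : ℝ => y ^ (-s - 1)) y := by
  have hy : (0:ℝ) < y := hy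
  by_cases h : y ∈ Ioi r
  · rw [indicator_of_mem h, indicator_of_mem h, smul_eq_mul, ← Real.rpow_natCast, ← Real.rpow_add hy]
    congr 1; push_cast [Nat.cast_sub hd]; ring
  · simp [indicator_of_notMem h]

lemma gB_int (hd : 1 ≤ d) {s r : ℝ} (hs : 0 < s) (hr : 0 < r) :
    Integrable (gB d s r) ∧ ∫ z, gB d s r z = sphereVol d * (r ^ s / s) := by
  have : Nontrivial (Eu d) := by
    have : Nonempty (Fin d) := ⟨⟨0, hd⟩⟩
    infer_instance
  have hI : IntervalIntegrable (fun x : ℝ => x ^ (s - 1)) volume 0 r :=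
    intervalIntegral.intervalIntegrable_rpow' (by linarith)
  have hset : Ioi (0:ℝ) ∩ Iio r = Ioo 0 r := rfl
  constructor
  · unfold gB
    rw [integrable_fun_norm_addHaar volume
      (f := (Iio r).indicator (fun y : ℝ => y ^ (s - d)))]
    simp only [finrank_euclideanSpace, Fintype.card_fin]
    rw [integrableOn_congr_fun (fun y hy => polar_B hd y hy) measurableSet_Ioi]
    rw [IntegrableOn, integrable_indicator_iff measurableSet_Iio, IntegrableOn,
      Measure.restrict_restrict measurableSet_Iio, inter_comm, hset, ← IntegrableOn]
    exact (intervalIntegrable_iff_integrableOn_Ioo_of_le hr.le).1 hI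
  · unfold gB
    rw [integral_fun_norm_addHaar volume
      ((Iio r).indicator (fun y : ℝ => y ^ (s - d)))]
    simp only [finrank_euclideanSpace, Fintype.card_fin]
    rw [setIntegral_congr_fun measurableSet_Ioi (fun y hy => polar_B hd y hy),
      setIntegral_indicator measurableSet_Iio, hset, ← integral_Ioc_eq_integral_Ioo,
      ← intervalIntegral.integral_of_le hr.le, integral_rpow (Or.inl (by linarith))]
    rw [sub_add_cancel, Real.zero_rpow hs.ne']
    simp [sphereVol, Measure.real, mul_assoc]

lemma gO_int (hd : 1 ≤ d) {s r : ℝ} (hs : 0 < s) (hr : 0 < r) :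
    Integrable (gO d s r) ∧ ∫ z, gO d s r z = sphereVol d * (r ^ (-s) / s) := by
  have : Nontrivial (Eu d) := by
    have : Nonempty (Fin d) := ⟨⟨0, hd⟩⟩
    infer_instance
  have hset : Ioi (0:ℝ) ∩ Ioi r = Ioi r := by
    apply inter_eq_right.2; intro x hx; exact hr.trans hx
  constructor
  · unfold gO
    rw [integrable_fun_norm_addHaar volume
      (f := (Ioi r).indicator (fun y : ℝ => y ^ (-s - d)))]
    simp only [finrank_euclideanSpace, Fintype.card_fin]
    rw [integrableOn_congr_fun (fun y hy => polar_O hd y hy) measurableSet_Ioi]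
    rw [IntegrableOn, integrable_indicator_iff measurableSet_Ioi, IntegrableOn,
      Measure.restrict_restrict measurableSet_Ioi, inter_comm, hset, ← IntegrableOn]
    exact integrableOn_Ioi_rpow_of_lt (by linarith) hr
  · unfold gO
    rw [integral_fun_norm_addHaar volume
      ((Ioi r).indicator (fun y : ℝ => y ^ (-s - d)))]
    simp only [finrank_euclideanSpace, Fintype.card_fin]
    rw [setIntegral_congr_fun measurableSet_Ioi (fun y hy => polar_O hd y hy),
      setIntegral_indicator measurableSet_Ioi, hset, integral_Ioi_rpow_of_lt (by linarith) hr]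
    rw [sub_add_cancel]
    simp [sphereVol, Measure.real, mul_assoc, neg_div_neg_eq]

lemma sphereVol_nonneg (d : ℕ) : 0 ≤ sphereVol d := by unfold sphereVol; positivity

lemma gG_nonneg {γ r : ℝ} (hr : 0 < r) (z : Eu d) : 0 ≤ gG d γ r z := by
  unfold gG; have := gB_nonneg γ (2*r) z; have := gO_nonneg (1-γ) r z; positivity

/-- constant in the integral of `gG` -/
noncomputable def cG (d : ℕ) (γ : ℝ) : ℝ := sphereVol d * (2 ^ γ / γ + (1 - γ)⁻¹)

lemma gG_int (hd : 1 ≤ d) {γ r : ℝ} (h0 : 0 < γ) (h1 : γ < 1) (hr : 0 < r) :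
    Integrable (gG d γ r) ∧ ∫ z, gG d γ r z = cG d γ * r ^ γ := by
  obtain ⟨a, b⟩ := gB_int hd h0 (by positivity : 0 < 2 * r)
  obtain ⟨a', b'⟩ := gO_int hd (by linarith : 0 < 1 - γ) hr
  refine ⟨a.add (a'.const_mul r), ?_⟩
  unfold gG
  rw [integral_add a (a'.const_mul r), integral_const_mul, b, b', cG,
    Real.mul_rpow (by norm_num) hr.le]
  have : r * r ^ (-(1 - γ)) = r ^ γ := by
    rw [← Real.rpow_one_add' hr.le (by simp [h0.ne'])]; congr 1; ring
  calc _ = sphereVol d * (2 ^ γ * r ^ γ / γ) + sphereVol d * ((r * r ^ (-(1 - γ))) / (1 - γ)) := by ring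
    _ = _ := by rw [this]; ring

lemma cG_nonneg {γ : ℝ} (h0 : 0 < γ) (h1 : γ < 1) : 0 ≤ cG d γ := by
  have := sphereVol_nonneg d
  have : 0 < 1 - γ := by linarith
  unfold cG; positivity

lemma pow_inv_rpow {z : ℝ} (hz : 0 < z) (s : ℝ) (n : ℕ) : z ^ s * (z⁻¹) ^ n = z ^ (s - n) := by
  rw [Real.rpow_sub hz, Real.rpow_natCast, inv_pow]; rfl

lemma le_gG {γ r f : ℝ} (hr : 0 < r) {z : Eu d} (hz : z ≠ 0)
    (h1 : f ≤ ‖z‖ ^ γ * ‖z‖⁻¹ ^ d) (h2 : f ≤ r * (‖z‖ ^ γ * ‖z‖⁻¹ ^ (d + 1))) :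
    f ≤ gG d γ r z := by
  have hz' := norm_pos_iff.2 hz
  unfold gG
  rcases lt_or_ge r ‖z‖ with h | h
  · have := gB_nonneg γ (2*r) z
    rw [gO_of_lt h]
    rw [pow_inv_rpow hz'] at h2
    have e : γ - ((d+1 : ℕ):ℝ) = -(1 - γ) - d := by push_cast; ring
    rw [e] at h2; linarith
  · have := mul_nonneg hr.le (gO_nonneg (1-γ) r z)
    rw [gB_of_lt (by linarith)]
    rw [pow_inv_rpow hz'] at h1; linarith

lemma ae_ne (hd : 1 ≤ d) (x : Eu d) : ∀ᵐ y : Eu d, x - y ≠ 0 := by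
  have : Nontrivial (Eu d) := by
    have : Nonempty (Fin d) := ⟨⟨0, hd⟩⟩
    infer_instance
  have : ∀ᵐ y : Eu d, y ≠ x := by
    simp [ae_iff]
  filter_upwards [this] with y hy h
  exact hy (sub_eq_zero.1 h).symm

lemma norm_int_le (hd : 1 ≤ d) {F : Type*} [NormedAddCommGroup F] [NormedSpace ℝ F]
    {f : Eu d → F} {g : Eu d → ℝ} (x : Eu d) (hg : Integrable g)
    (h : ∀ y, x - y ≠ 0 → ‖f y‖ ≤ g (x - y)) : ‖∫ y, f y‖ ≤ ∫ z, g z := by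
  rw [← integral_sub_left_eq_self g volume x]
  apply norm_integral_le_of_norm_le (hg.comp_sub_left x)
  filter_upwards [ae_ne hd x] with y hy using h y hy

lemma integrable_le (hd : 1 ≤ d) {F : Type*} [NormedAddCommGroup F]
    {f : Eu d → F} {g : Eu d → ℝ} (x : Eu d) (hg : Integrable g)
    (hf : AEStronglyMeasurable f volume)
    (h : ∀ y, x - y ≠ 0 → ‖f y‖ ≤ g (x - y)) : Integrable f := by
  apply (hg.comp_sub_left x).mono' hf
  filter_upwards [ae_ne hd x] with y hy using h y hy


/-- volume of the unit ball -/
noncomputable def vB (d : ℕ) : ℝ := (volume : Measure (Eu d)).real (ball 0 1)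

/-- constant for integrals over a ball -/
noncomputable def cS (d : ℕ) (s R : ℝ) : ℝ := R ^ s * (sphereVol d / s + vB d)

lemma vB_nonneg (d : ℕ) : 0 ≤ vB d := by unfold vB; positivity

lemma cS_nonneg {s R : ℝ} (hs : 0 < s) (hR : 0 < R) : 0 ≤ cS d s R := by
  have := sphereVol_nonneg d
  have := vB_nonneg d
  unfold cS; positivity

/-- majorant for integrals over a ball -/
noncomputable def gM (d : ℕ) (s R : ℝ) (x y : Eu d) : ℝ :=
  gB d s R (x - y) + (closedBall (0 : Eu d) R).indicator (fun _ => R ^ (s - d)) y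

lemma gM_int (hd : 1 ≤ d) {s R : ℝ} (hs : 0 < s) (hR : 0 < R) (x : Eu d) :
    Integrable (gM d s R x) ∧ ∫ y, gM d s R x y = cS d s R := by
  obtain ⟨a, b⟩ := gB_int hd hs hR
  have hi : Integrable ((closedBall (0 : Eu d) R).indicator (fun _ => R ^ (s - d))) := by
    rw [integrable_indicator_iff measurableSet_closedBall]
    exact integrableOn_const (measure_closedBall_lt_top.ne)
  refine ⟨(a.comp_sub_left x).add hi, ?_⟩
  unfold gM
  rw [integral_add (a.comp_sub_left x) hi, integral_sub_left_eq_self (gB d s R) volume x, b,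
    integral_indicator measurableSet_closedBall, setIntegral_const, Measure.real,
    Measure.addHaar_closedBall _ _ hR.le]
  simp only [finrank_euclideanSpace, Fintype.card_fin, ENNReal.toReal_mul, smul_eq_mul]
  rw [ENNReal.toReal_ofReal (by positivity), ← Measure.real, ← vB, cS]
  have : R ^ d * R ^ (s - d) = R ^ s := by
    rw [← Real.rpow_natCast, ← Real.rpow_add hR]; congr 1; ring
  calc _ = sphereVol d * (R ^ s / s) + (R ^ d * R ^ (s - d)) * vB d := by ring
    _ = _ := by rw [this]; ring

lemma le_gM {s R : ℝ} (hR : 0 < R) (hs : s ≤ d) {x y : Eu d} (hy : y ∈ closedBall (0 : Eu d) R) :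
    ‖x - y‖ ^ (s - d) ≤ gM d s R x y := by
  unfold gM
  rw [indicator_of_mem hy]
  rcases lt_or_ge ‖x - y‖ R with h | h
  · rw [gB_of_lt h]; have : 0 ≤ R ^ (s - d) := by positivity
    linarith
  · have := gB_nonneg s R (x - y)
    have := Real.rpow_le_rpow_of_nonpos hR h (by linarith : s - d ≤ 0)
    linarith

lemma gM_nonneg {s R : ℝ} (hR : 0 < R) (x y : Eu d) : 0 ≤ gM d s R x y := by
  unfold gM
  have := gB_nonneg s R (x - y)
  have : 0 ≤ (closedBall (0 : Eu d) R).indicator (fun _ => R ^ (s - d)) y := by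
    apply indicator_apply_nonneg; intro _; positivity
  linarith

lemma norm_le_gM {F : Type*} [NormedAddCommGroup F] {f : Eu d → F} {A s R : ℝ} (hA : 0 ≤ A)
    (hR : 0 < R) (hsd : s ≤ d) (x : Eu d)
    (h : ∀ y ∈ closedBall (0 : Eu d) R, x - y ≠ 0 → ‖f y‖ ≤ A * ‖x - y‖ ^ (s - d))
    (h0 : ∀ y, y ∉ closedBall (0 : Eu d) R → f y = 0) (y : Eu d) (hy : x - y ≠ 0) :
    ‖f y‖ ≤ A * gM d s R x y := by
  by_cases hyR : y ∈ closedBall (0 : Eu d) R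
  · exact (h y hyR hy).trans (mul_le_mul_of_nonneg_left (le_gM hR hsd hyR) hA)
  · rw [h0 y hyR, norm_zero]; exact mul_nonneg hA (gM_nonneg hR x y)

lemma norm_int_supp (hd : 1 ≤ d) {F : Type*} [NormedAddCommGroup F] [NormedSpace ℝ F]
    {f : Eu d → F} {A s R : ℝ} (hA : 0 ≤ A) (hs : 0 < s) (hsd : s ≤ d) (hR : 0 < R) (x : Eu d)
    (h : ∀ y ∈ closedBall (0 : Eu d) R, x - y ≠ 0 → ‖f y‖ ≤ A * ‖x - y‖ ^ (s - d))
    (h0 : ∀ y, y ∉ closedBall (0 : Eu d) R → f y = 0) : ‖∫ y, f y‖ ≤ A * cS d s R := by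
  obtain ⟨a, b⟩ := gM_int hd hs hR x
  rw [← b, ← integral_const_mul]
  apply norm_integral_le_of_norm_le (a.const_mul A)
  filter_upwards [ae_ne hd x] with y hy using norm_le_gM hA hR hsd x h h0 y hy

lemma uu_pow_le {δ s : ℝ} (hδ : 0 < δ) (hs : 0 ≤ s) (hsd : s ≤ d) {z : Eu d} (hz : z ≠ 0) :
    (uu δ z) ^ d ≤ (δ⁻¹) ^ s * ‖z‖ ^ (s - d) := by
  have hp := uu_pos hδ z
  have hz' := norm_pos_iff.2 hz
  have e : (uu δ z) ^ d = (uu δ z) ^ s * (uu δ z) ^ ((d:ℝ) - s) := by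
    rw [← Real.rpow_add hp, ← Real.rpow_natCast]; congr 1; ring
  rw [e]
  have h1 := Real.rpow_le_rpow hp.le (uu_le_inv hδ z) hs
  have h2 := Real.rpow_le_rpow hp.le (uu_le_inv_norm hδ hz) (by linarith : 0 ≤ (d:ℝ) - s)
  rw [Real.inv_rpow hz'.le, ← Real.rpow_neg hz'.le, neg_sub] at h2
  exact mul_le_mul h1 h2 (by positivity) (by positivity)

/-- constant in the logarithmic estimate -/
noncomputable def cL (d : ℕ) (R : ℝ) : ℝ := Real.exp 1 * (R * (sphereVol d + vB d))

lemma cL_nonneg {R : ℝ} (hR : 0 < R) : 0 ≤ cL d R := by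
  have := sphereVol_nonneg d
  have := vB_nonneg d
  unfold cL; positivity

lemma norm_int_log (hd : 1 ≤ d) {F : Type*} [NormedAddCommGroup F] [NormedSpace ℝ F]
    {f : Eu d → F} {A η R : ℝ} (hA : 0 ≤ A) (hη : 0 < η) (hη1 : η ≤ 1) (hR : 1 ≤ R) (x : Eu d)
    (h : ∀ y ∈ closedBall (0 : Eu d) R, ‖f y‖ ≤ A * uu η (x - y) ^ d)
    (h0 : ∀ y, y ∉ closedBall (0 : Eu d) R → f y = 0) :
    ‖∫ y, f y‖ ≤ A * (cL d R * (1 - Real.log η)) := by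
  have hlog : Real.log η ≤ 0 := Real.log_nonpos hη.le hη1
  set ℓ := 1 - Real.log η with hℓ
  have hℓ1 : 1 ≤ ℓ := by linarith
  have hℓ0 : 0 < ℓ := by linarith
  set s := ℓ⁻¹ with hs
  have hs0 : 0 < s := by positivity
  have hs1 : s ≤ 1 := inv_le_one_of_one_le₀ hℓ1
  have hd' : (1:ℝ) ≤ d := by exact_mod_cast hd
  have hsd : s ≤ d := hs1.trans hd'
  have hR0 : 0 < R := by linarith
  have hE : (η⁻¹) ^ s ≤ Real.exp 1 := by
    rw [Real.rpow_def_of_pos (by positivity), Real.log_inv]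
    apply Real.exp_le_exp.2
    have : -Real.log η ≤ ℓ := by linarith
    calc -Real.log η * s ≤ ℓ * s := mul_le_mul_of_nonneg_right this hs0.le
      _ = 1 := by rw [hs]; field_simp
  have := norm_int_supp hd (f := f) (A := A * Real.exp 1) (by positivity) hs0 hsd hR0 x
    (fun y hy hxy => (h y hy).trans (by
      rw [mul_assoc]
      apply mul_le_mul_of_nonneg_left _ hA
      exact (uu_pow_le hη hs0.le hsd hxy).trans (mul_le_mul_of_nonneg_right hE (by positivity)))) h0
  refine this.trans ?_
  rw [mul_assoc]
  apply mul_le_mul_of_nonneg_left _ hA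
  unfold cL cS
  have hRs : R ^ s ≤ R := by
    calc R ^ s ≤ R ^ (1:ℝ) := Real.rpow_le_rpow_of_exponent_le hR hs1
      _ = R := Real.rpow_one R
  have hv := sphereVol_nonneg d
  have hb := vB_nonneg d
  have e : sphereVol d / s = sphereVol d * ℓ := by rw [hs]; field_simp
  rw [mul_assoc]
  apply mul_le_mul_of_nonneg_left _ (Real.exp_pos 1).le
  rw [e, mul_assoc]
  apply mul_le_mul hRs _ (by positivity) hR0.le
  nlinarith

/-- total mass of the divergence kernel -/
noncomputable def mass (d : ℕ) : ℝ := ∫ z : Eu d, psi d 1 z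

lemma integrable_psi_one (hd : 1 ≤ d) : Integrable (psi d 1) := by
  have hd0 : (0:ℝ) < d := by exact_mod_cast hd
  have h1 := gB_int (d := d) hd (s := d) (r := 2) hd0 (by norm_num)
  have h2 := gO_int (d := d) hd (s := 1) (r := 1) (by norm_num) (by norm_num)
  refine Integrable.mono' ((h1.1.add h2.1).const_mul d)
    (contDiff_psi (n := 0) one_pos).continuous.aestronglyMeasurable
    (Filter.Eventually.of_forall fun z => ?_)
  rw [Real.norm_of_nonneg (psi_nonneg 1 z)]
  refine (psi_le one_pos z).trans ?_
  apply mul_le_mul_of_nonneg_left _ hd0.le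
  rw [one_mul]
  simp only [Pi.add_apply]
  rcases lt_or_ge ‖z‖ 2 with h | h
  · have := gO_nonneg (d := d) 1 1 z
    rw [gB_of_lt h, sub_self, Real.rpow_zero]
    have : uu 1 z ^ (d+1) ≤ 1 := pow_le_one₀ (uu_nonneg 1 z) (by simpa using uu_le_inv one_pos z)
    linarith
  · have := gB_nonneg (d := d) d 2 z
    have hz : z ≠ 0 := by rintro rfl; simp at h; linarith
    rw [gO_of_lt (by linarith)]
    have := pow_le_pow_left₀ (uu_nonneg 1 z) (uu_le_inv_norm one_pos hz) (d+1)
    have e : ‖z‖⁻¹ ^ (d+1) = ‖z‖ ^ (-(1:ℝ) - d) := by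
      have := pow_inv_rpow (norm_pos_iff.2 hz) 0 (d+1)
      rw [Real.rpow_zero, one_mul] at this
      rw [this]; congr 1; push_cast; ring
    linarith

lemma psi_eq_scale {δ : ℝ} (hδ : 0 < δ) :
    psi d δ = fun z : Eu d => (δ ^ d)⁻¹ * psi d 1 (δ⁻¹ • z) := by
  funext z
  rw [← psi_scale hδ, smul_smul, mul_inv_cancel₀ hδ.ne', one_smul]

lemma integrable_psi (hd : 1 ≤ d) {δ : ℝ} (hδ : 0 < δ) : Integrable (psi d δ) := by
  rw [psi_eq_scale hδ]
  exact ((integrable_comp_smul_iff volume (psi d 1) (inv_ne_zero hδ.ne')).2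
    (integrable_psi_one hd)).const_mul _

lemma integral_psi {δ : ℝ} (hδ : 0 < δ) : ∫ z, psi d δ z = mass d := by
  rw [psi_eq_scale hδ, integral_const_mul, Measure.integral_comp_smul, mass]
  simp only [finrank_euclideanSpace, Fintype.card_fin, inv_pow, inv_inv, smul_eq_mul]
  rw [abs_of_pos (by positivity)]
  field_simp

lemma mass_nonneg (d : ℕ) : 0 ≤ mass d := integral_nonneg fun z => psi_nonneg 1 z

lemma psi_rpow_le (hd : 1 ≤ d) {δ γ : ℝ} (hδ : 0 < δ) {z : Eu d} (hz : z ≠ 0) :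
    psi d δ z * ‖z‖ ^ γ ≤ d * gG d γ δ z := by
  have hd0 : (0:ℝ) < d := by exact_mod_cast hd
  have hz' := norm_pos_iff.2 hz
  have h1 : uu δ z ^ (d+1) ≤ ‖z‖⁻¹ ^ (d+1) :=
    pow_le_pow_left₀ (uu_nonneg δ z) (uu_le_inv_norm hδ hz) (d+1)
  have h2 : δ * uu δ z ^ (d+1) ≤ ‖z‖⁻¹ ^ d := by
    have a := pow_le_pow_left₀ (uu_nonneg δ z) (uu_le_inv_norm hδ hz) d
    have b := uu_mul_le hδ z
    calc δ * uu δ z ^ (d+1) = (uu δ z * δ) * uu δ z ^ d := by ring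
      _ ≤ 1 * ‖z‖⁻¹ ^ d := mul_le_mul b a (pow_nonneg (uu_nonneg δ z) d) zero_le_one
      _ = _ := one_mul _
  have hp : 0 ≤ ‖z‖ ^ γ := by positivity
  have key : δ * uu δ z ^ (d+1) * ‖z‖ ^ γ ≤ gG d γ δ z := by
    apply le_gG hδ hz
    · rw [mul_comm]; exact mul_le_mul_of_nonneg_left h2 hp
    · calc δ * uu δ z ^ (d+1) * ‖z‖ ^ γ = δ * (‖z‖ ^ γ * uu δ z ^ (d+1)) := by ring
        _ ≤ _ := by gcongr
  calc _ ≤ d * (δ * uu δ z ^ (d+1)) * ‖z‖ ^ γ := mul_le_mul_of_nonneg_right (psi_le hδ z) hp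
    _ = d * (δ * uu δ z ^ (d+1) * ‖z‖ ^ γ) := by ring
    _ ≤ _ := mul_le_mul_of_nonneg_left key hd0.le

end AggPatch

namespace AggPatch
open MeasureTheory Metric Set
open scoped RealInnerProductSpace
variable {d : ℕ}

/-- admissible densities -/
structure Dens (R : ℝ) (ρ : Eu d → ℝ) : Prop where
  smooth : ContDiff ℝ 1 ρ
  nonneg : ∀ y, 0 ≤ ρ y
  le_one : ∀ y, ρ y ≤ 1
  supp : ∀ y, y ∉ closedBall (0 : Eu d) R → ρ y = 0

/-- velocity potential, derivative and divergence -/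
noncomputable def vel (δ : ℝ) (ρ : Eu d → ℝ) (x : Eu d) : Eu d := ∫ y, ρ y • kk d δ (x - y)
/-- derivative of velocity -/
noncomputable def Aop (δ : ℝ) (ρ : Eu d → ℝ) (x : Eu d) : Eu d →L[ℝ] Eu d :=
  ∫ y, ρ y • Dk d δ (x - y)
/-- divergence of velocity -/
noncomputable def bb (δ : ℝ) (ρ : Eu d → ℝ) (x : Eu d) : ℝ := ∫ y, ρ y • psi d δ (x - y)

/-- curl of a vector field -/
noncomputable def curl (Y : Eu d → Eu d) (y u w : Eu d) : ℝ :=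
  ⟪fderiv ℝ Y y u, w⟫ - ⟪fderiv ℝ Y y w, u⟫

lemma Dens.cont {R : ℝ} {ρ : Eu d → ℝ} (h : Dens R ρ) : Continuous ρ := h.smooth.continuous

lemma Dens.cs {R : ℝ} {ρ : Eu d → ℝ} (h : Dens R ρ) : HasCompactSupport ρ :=
  HasCompactSupport.intro (isCompact_closedBall 0 R) h.supp

lemma Dens.int {R : ℝ} {ρ : Eu d → ℝ} (h : Dens R ρ) {F : Type*} [NormedAddCommGroup F]
    [NormedSpace ℝ F] {f : Eu d → F} (hf : Continuous f) : Integrable (fun y => ρ y • f y) :=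
  (h.cont.smul hf).integrable_of_hasCompactSupport h.cs.smul_right

lemma Dens.norm_smul_le {R : ℝ} {ρ : Eu d → ℝ} (h : Dens R ρ) {F : Type*} [NormedAddCommGroup F]
    [NormedSpace ℝ F] (y : Eu d) (f : F) : ‖ρ y • f‖ ≤ ‖f‖ := by
  rw [norm_smul, Real.norm_of_nonneg (h.nonneg y)]
  exact mul_le_of_le_one_left (norm_nonneg _) (h.le_one y)

lemma contDk {δ : ℝ} (hδ : 0 < δ) (x : Eu d) : Continuous fun y => Dk d δ (x - y) :=
  (continuous_Dk hδ).comp (continuous_const.sub continuous_id)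

lemma contkk {δ : ℝ} (hδ : 0 < δ) (x : Eu d) : Continuous fun y => kk d δ (x - y) :=
  (continuous_kk hδ).comp (continuous_const.sub continuous_id)

lemma contpsi {δ : ℝ} (hδ : 0 < δ) (x : Eu d) : Continuous fun y => psi d δ (x - y) :=
  (contDiff_psi (n := 0) hδ).continuous.comp (continuous_const.sub continuous_id)

lemma Aop_apply {δ R : ℝ} (hδ : 0 < δ) {ρ : Eu d → ℝ} (h : Dens R ρ) (x w : Eu d) :
    Aop δ ρ x w = ∫ y, ρ y • Dk d δ (x - y) w := by
  unfold Aop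
  rw [ContinuousLinearMap.integral_apply (h.int (contDk hδ x))]
  rfl

lemma Aop_symm {δ R : ℝ} (hδ : 0 < δ) {ρ : Eu d → ℝ} (h : Dens R ρ) (x a b : Eu d) :
    ⟪Aop δ ρ x a, b⟫ = ⟪a, Aop δ ρ x b⟫ := by
  rw [Aop_apply hδ h, Aop_apply hδ h, real_inner_comm,
    ← integral_inner (h.int ((contDk hδ x).clm_apply continuous_const)),
    ← integral_inner (h.int ((contDk hδ x).clm_apply continuous_const))]
  congr 1; funext y
  rw [inner_smul_right, inner_smul_right, ← Dk_symm, real_inner_comm]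

lemma Aop_trace {δ R : ℝ} (hδ : 0 < δ) {ρ : Eu d → ℝ} (h : Dens R ρ) (x : Eu d)
    {ι : Type*} [Fintype ι] (b : OrthonormalBasis ι ℝ (Eu d)) :
    ∑ i, ⟪b i, Aop δ ρ x (b i)⟫ = bb δ ρ x := by
  unfold bb
  have : ∀ i, ⟪b i, Aop δ ρ x (b i)⟫ = ∫ y, ⟪b i, ρ y • Dk d δ (x - y) (b i)⟫ := fun i => by
    rw [Aop_apply hδ h, integral_inner (h.int ((contDk hδ x).clm_apply continuous_const))]
  simp_rw [this]
  rw [← integral_finsetSum]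
  · congr 1; funext y
    simp_rw [inner_smul_right, ← Finset.mul_sum, trace_Dk hδ, smul_eq_mul]
  · intro i _
    exact (h.int ((contDk hδ x).clm_apply continuous_const)).const_inner _

lemma bb_bound (hd : 1 ≤ d) {δ R : ℝ} (hδ : 0 < δ) {ρ : Eu d → ℝ} (h : Dens R ρ) (x : Eu d) :
    0 ≤ bb δ ρ x ∧ bb δ ρ x ≤ mass d := by
  constructor
  · exact integral_nonneg fun y => mul_nonneg (h.nonneg y) (psi_nonneg _ _)
  · rw [← integral_psi hδ, ← integral_sub_left_eq_self (psi d δ) volume x]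
    refine integral_mono (h.int (contpsi hδ x)) ((integrable_psi hd hδ).comp_sub_left x) fun y => ?_
    exact mul_le_of_le_one_left (psi_nonneg _ _) (h.le_one y)

lemma hasFDerivAt_kk_sub {δ : ℝ} (hδ : 0 < δ) (x y : Eu d) :
    HasFDerivAt (fun y => kk d δ (x - y)) (-(Dk d δ (x - y))) y := by
  have h1 : HasFDerivAt (fun y : Eu d => x - y) (-(ContinuousLinearMap.id ℝ (Eu d))) y :=
    (hasFDerivAt_id y).const_sub x
  have := (hasFDerivAt_kk hδ (x - y)).comp y h1
  refine HasFDerivAt.congr_fderiv this ?_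
  ext w; simp

/-- integration by parts -/
lemma ibp {δ : ℝ} (hδ : 0 < δ) {f : Eu d → ℝ} (hf : ContDiff ℝ 1 f) (hc : HasCompactSupport f)
    (x u : Eu d) :
    ∫ y, f y • Dk d δ (x - y) u = ∫ y, fderiv ℝ f y u • kk d δ (x - y) := by
  have hk := contkk (d := d) hδ x
  have hD : ∀ y, fderiv ℝ (fun y => kk d δ (x - y)) y u = -(Dk d δ (x - y) u) := fun y => by
    rw [(hasFDerivAt_kk_sub hδ x y).fderiv]; rfl
  have hf' : Continuous fun y => fderiv ℝ f y u :=
    (hf.continuous_fderiv one_ne_zero).clm_apply continuous_const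
  have hfc : HasCompactSupport fun y => fderiv ℝ f y u := hc.fderiv_apply ℝ u
  have hDc : Continuous fun y => Dk d δ (x - y) u := (contDk hδ x).clm_apply continuous_const
  have := integral_smul_fderiv_eq_neg_fderiv_smul_of_integrable (μ := volume)
    (f := f) (g := fun y => kk d δ (x - y)) (v := u)
    ((hf'.smul hk).integrable_of_hasCompactSupport hfc.smul_right)
    (by
      simp_rw [hD]
      exact (hf.continuous.smul hDc.neg).integrable_of_hasCompactSupport hc.smul_right)
    ((hf.continuous.smul hk).integrable_of_hasCompactSupport hc.smul_right)
    (fun y _ => (hf.differentiable one_ne_zero).differentiableAt)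
    (fun y _ => (hasFDerivAt_kk_sub hδ x y).differentiableAt)
  simp_rw [hD, smul_neg, integral_neg] at this
  exact neg_inj.1 this

/-- vector fields normal to the density -/
structure Fld (ρ : Eu d → ℝ) (Y : Eu d → Eu d) (N ω γ : ℝ) : Prop where
  smooth : ContDiff ℝ 1 Y
  par : ∀ y a b, fderiv ℝ ρ y a * ⟪Y y, b⟫ = fderiv ℝ ρ y b * ⟪Y y, a⟫
  curl : ∀ y a b, |curl Y y a b| ≤ ω * (‖a‖ * ‖b‖)
  hold : ∀ x y, ‖Y x - Y y‖ ≤ N * ‖x - y‖ ^ γ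

lemma continuous_curl {Y : Eu d → Eu d} (hY : ContDiff ℝ 1 Y) (a b : Eu d) :
    Continuous fun y => curl Y y a b := by
  unfold curl
  have h : ∀ c, Continuous fun y => fderiv ℝ Y y c := fun c =>
    (hY.continuous_fderiv one_ne_zero).clm_apply continuous_const
  exact ((h a).inner continuous_const).sub ((h b).inner continuous_const)

lemma ident {δ R N ω γ : ℝ} (hδ : 0 < δ) {ρ : Eu d → ℝ} {Y : Eu d → Eu d} (h : Dens R ρ)
    (hY : Fld ρ Y N ω γ) (x u w : Eu d) :
    ∫ y, ρ y • Dk d δ (x - y) (⟪Y y, w⟫ • u - ⟪Y y, u⟫ • w)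
      = ∫ y, ρ y • (curl Y y u w • kk d δ (x - y)) := by
  have hYd : Differentiable ℝ Y := hY.smooth.differentiable one_ne_zero
  have hρd : Differentiable ℝ ρ := h.smooth.differentiable one_ne_zero
  have hYc : Continuous Y := hY.smooth.continuous
  have hin : ∀ c : Eu d, ContDiff ℝ 1 fun y => ρ y * ⟪Y y, c⟫ := fun c =>
    h.smooth.mul (hY.smooth.inner ℝ contDiff_const)
  have hcs : ∀ c : Eu d, HasCompactSupport fun y => ρ y * ⟪Y y, c⟫ := fun c => h.cs.mul_right
  have hder : ∀ c a y, fderiv ℝ (fun y => ρ y * ⟪Y y, c⟫) y a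
      = fderiv ℝ ρ y a * ⟪Y y, c⟫ + ρ y * ⟪fderiv ℝ Y y a, c⟫ := by
    intro c a y
    rw [fderiv_fun_mul hρd.differentiableAt ((hYd y).inner ℝ (differentiableAt_const c))]
    simp only [_root_.add_apply, _root_.smul_apply, smul_eq_mul]
    rw [fderiv_inner_apply ℝ (hYd y) (differentiableAt_const c)]
    simp; ring
  have e1 := ibp hδ (hin w) (hcs w) x u
  have e2 := ibp hδ (hin u) (hcs u) x w
  have hI : ∀ a b : Eu d, Integrable fun y => (ρ y * ⟪Y y, a⟫) • Dk d δ (x - y) b := fun a b =>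
    ((hin a).continuous.smul ((contDk hδ x).clm_apply continuous_const)).integrable_of_hasCompactSupport
      (hcs a).smul_right
  have hI' : ∀ a b : Eu d, Integrable fun y =>
      fderiv ℝ (fun y => ρ y * ⟪Y y, a⟫) y b • kk d δ (x - y) := fun a b =>
    ((((hin a).continuous_fderiv one_ne_zero).clm_apply continuous_const).smul
      (contkk hδ x)).integrable_of_hasCompactSupport ((hcs a).fderiv_apply ℝ b).smul_right
  calc _ = ∫ y, ((ρ y * ⟪Y y, w⟫) • Dk d δ (x - y) u - (ρ y * ⟪Y y, u⟫) • Dk d δ (x - y) w) := by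
        congr 1; funext y; simp only [map_sub, map_smul, smul_sub, smul_smul]
    _ = ∫ y, (fderiv ℝ (fun y => ρ y * ⟪Y y, w⟫) y u • kk d δ (x - y)
          - fderiv ℝ (fun y => ρ y * ⟪Y y, u⟫) y w • kk d δ (x - y)) := by
        rw [integral_sub (hI _ _) (hI _ _), e1, e2, integral_sub (hI' _ _) (hI' _ _)]
    _ = _ := by
        congr 1; funext y
        rw [← sub_smul, smul_smul, hder, hder, hY.par y u w, curl]; congr 1; ring

end AggPatch

namespace AggPatch
open MeasureTheory Metric Set
open scoped RealInnerProductSpace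
variable {d : ℕ}

lemma le_gG' {γ r f c : ℝ} (hc : 0 < c) (hr : 0 < r) {z : Eu d} (hz : z ≠ 0)
    (h1 : f ≤ c * (‖z‖ ^ γ * ‖z‖⁻¹ ^ d)) (h2 : f ≤ c * (r * (‖z‖ ^ γ * ‖z‖⁻¹ ^ (d + 1)))) :
    f ≤ c * gG d γ r z := by
  rw [← div_le_iff₀' hc] at *
  exact le_gG hr hz h1 h2

/-- kernel constant -/
noncomputable def c1 (d : ℕ) : ℝ := d + d * (d + 4) + 2 * (1 + d)

lemma c1_pos (d : ℕ) : 0 < c1 d := by unfold c1; positivity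

lemma Dk_diff_le1 {δ η : ℝ} (hδ : 0 < δ) (hη : 0 < η) {z : Eu d} (hz : z ≠ 0) :
    ‖Dk d δ z - Dk d η z‖ ≤ c1 d * ‖z‖⁻¹ ^ d := by
  have a := norm_Dk_le hδ z
  have b := norm_Dk_le hη z
  have a' := pow_le_pow_left₀ (uu_nonneg δ z) (uu_le_inv_norm hδ hz) d
  have b' := pow_le_pow_left₀ (uu_nonneg η z) (uu_le_inv_norm hη hz) d
  have hq : 0 ≤ ‖z‖⁻¹ ^ d := by positivity
  have hd0 : (0:ℝ) ≤ d := by positivity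
  calc _ ≤ ‖Dk d δ z‖ + ‖Dk d η z‖ := norm_sub_le _ _
    _ ≤ (1 + d) * ‖z‖⁻¹ ^ d + (1 + d) * ‖z‖⁻¹ ^ d := by
        refine add_le_add (a.trans ?_) (b.trans ?_) <;> gcongr
    _ ≤ _ := by unfold c1; nlinarith [mul_nonneg hd0 hq, mul_nonneg (mul_nonneg hd0 hd0) hq]

lemma Dk_diff_le2 {δ η : ℝ} (hδ : 0 < δ) (hη : δ ≤ η) {z : Eu d} (hz : z ≠ 0) :
    ‖Dk d δ z - Dk d η z‖ ≤ c1 d * (η * ‖z‖⁻¹ ^ (d + 1)) := by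
  have hη0 : 0 < η := hδ.trans_le hη
  have a := Dk_sub_le hδ hη0 z z (uu_le_inv_norm hδ hz) (uu_le_inv_norm hη0 hz)
  have hq : 0 ≤ ‖z‖⁻¹ ^ (d + 1) := by positivity
  rw [sub_self, norm_zero, zero_add, abs_sub_comm, abs_of_nonneg (by linarith)] at a
  refine a.trans ?_
  have : η - δ ≤ η := by linarith
  calc _ ≤ (d + d * (d + 4)) * ‖z‖⁻¹ ^ (d + 1) * η := by gcongr
    _ ≤ c1 d * ‖z‖⁻¹ ^ (d + 1) * η := by
        have : (d:ℝ) + d * (d + 4) ≤ c1 d := by unfold c1; linarith [show (0:ℝ) ≤ d by positivity]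
        gcongr
    _ = _ := by ring

lemma Dk_diff_gG {δ η γ : ℝ} (hδ : 0 < δ) (hη : δ ≤ η) {z : Eu d} (hz : z ≠ 0) :
    ‖Dk d δ z - Dk d η z‖ * ‖z‖ ^ γ ≤ c1 d * gG d γ η z := by
  have hη0 : 0 < η := hδ.trans_le hη
  have hp : 0 ≤ ‖z‖ ^ γ := by positivity
  apply le_gG' (c1_pos d) hη0 hz
  · calc _ ≤ c1 d * ‖z‖⁻¹ ^ d * ‖z‖ ^ γ := by gcongr; exact Dk_diff_le1 hδ hη0 hz
      _ = _ := by ring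
  · calc _ ≤ c1 d * (η * ‖z‖⁻¹ ^ (d + 1)) * ‖z‖ ^ γ := by gcongr; exact Dk_diff_le2 hδ hη hz
      _ = _ := by ring

lemma kk_le_rpow (hd : 1 ≤ d) {δ : ℝ} (hδ : 0 < δ) {z : Eu d} (hz : z ≠ 0) :
    ‖kk d δ z‖ ≤ ‖z‖ ^ ((1:ℝ) - d) := by
  have hz' := norm_pos_iff.2 hz
  refine (norm_kk_le hδ hd z).trans ((pow_le_pow_left₀ (uu_nonneg δ z) (uu_le_inv_norm hδ hz) _).trans ?_)
  have := pow_inv_rpow hz' 0 (d - 1)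
  rw [Real.rpow_zero, one_mul] at this
  rw [this]; push_cast [Nat.cast_sub hd]; apply le_of_eq; congr 1; ring

lemma lin_alg (B : Eu d →L[ℝ] Eu d) (hB : ∀ a b, ⟪B a, b⟫ = ⟪a, B b⟫) {S τ : ℝ} {p : Eu d}
    (hp : p ≠ 0) (hτ : |∑ i : Fin d, ⟪EuclideanSpace.basisFun (Fin d) ℝ i,
      B (EuclideanSpace.basisFun (Fin d) ℝ i)⟫| ≤ τ)
    (hS : ∀ u w, ‖B (⟪p, w⟫ • u - ⟪p, u⟫ • w)‖ ≤ S * (‖u‖ * ‖w‖)) :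
    ‖B‖ ≤ τ + (d + 2) * (S / ‖p‖) := by
  set bs := EuclideanSpace.basisFun (Fin d) ℝ
  have hpn := norm_pos_iff.2 hp
  set s := S / ‖p‖ with hs
  set e : Eu d := ‖p‖⁻¹ • p with he
  have hpe : p = ‖p‖ • e := by rw [he, smul_smul, mul_inv_cancel₀ hpn.ne', one_smul]
  have hen : ‖e‖ = 1 := by rw [he, norm_smul, norm_inv, norm_norm, inv_mul_cancel₀ hpn.ne']
  have hee : ⟪e, e⟫ = 1 := by rw [real_inner_self_eq_norm_sq, hen, one_pow]
  have hP : ∀ u, ‖B (u - ⟪e, u⟫ • e)‖ ≤ s * ‖u‖ := by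
    intro u
    have h := hS u e
    have e1 : ⟪p, e⟫ • u - ⟪p, u⟫ • e = ‖p‖ • (u - ⟪e, u⟫ • e) := by
      have q : ∀ c, ⟪p, c⟫ = ‖p‖ * ⟪e, c⟫ := fun c => by
        rw [he, real_inner_smul_left, ← mul_assoc, mul_inv_cancel₀ hpn.ne', one_mul]
      rw [q, q, hee, mul_one, smul_sub, mul_smul]
    rw [e1, map_smul, norm_smul, norm_norm, hen, mul_one] at h
    rw [hs, div_mul_eq_mul_div, le_div_iff₀ hpn, mul_comm]; exact h
  have hs0 : 0 ≤ s := by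
    have := hP e; rw [hen, mul_one] at this; exact (norm_nonneg _).trans this
  -- trace
  have hee' : |⟪e, B e⟫| ≤ τ + d * s := by
    have h1 : ∀ i, ⟪bs i, B (bs i)⟫ = ⟪bs i, B (bs i - ⟪e, bs i⟫ • e)⟫ + ⟪e, bs i⟫ * ⟪bs i, B e⟫ := by
      intro i; rw [map_sub, map_smul, inner_sub_right, inner_smul_right]; ring
    have h2 : ∑ i, ⟪bs i, B (bs i)⟫ = ∑ i, ⟪bs i, B (bs i - ⟪e, bs i⟫ • e)⟫ + ⟪e, B e⟫ := by
      rw [← bs.sum_inner_mul_inner e (B e), ← Finset.sum_add_distrib]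
      exact Finset.sum_congr rfl fun i _ => h1 i
    have h3 : |∑ i, ⟪bs i, B (bs i - ⟪e, bs i⟫ • e)⟫| ≤ d * s := by
      refine (Finset.abs_sum_le_sum_abs _ _).trans ?_
      calc _ ≤ ∑ i : Fin d, s := by
            apply Finset.sum_le_sum
            intro i _
            have hb : ‖bs i‖ = 1 := bs.orthonormal.1 i
            have := abs_real_inner_le_norm (bs i) (B (bs i - ⟪e, bs i⟫ • e))
            have h4 := hP (bs i)
            rw [hb] at this h4
            linarith
        _ = d * s := by simp
    have : ⟪e, B e⟫ = ∑ i, ⟪bs i, B (bs i)⟫ - ∑ i, ⟪bs i, B (bs i - ⟪e, bs i⟫ • e)⟫ := by linarith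
    rw [this]
    exact (abs_sub _ _).trans (add_le_add hτ h3)
  set v := B e - ⟪e, B e⟫ • e with hv
  have hve : ⟪e, v⟫ = 0 := by
    rw [hv, inner_sub_right, inner_smul_right, hee]; ring
  have hvn : ‖v‖ ≤ s := by
    have h1 : ‖v‖ ^ 2 = ⟪B v, e⟫ := by
      rw [hB, ← real_inner_self_eq_norm_sq]
      conv_lhs => rw [hv, inner_sub_right, inner_smul_right, ← hv, real_inner_comm, real_inner_comm e v, hve]
      rw [real_inner_comm]; ring
    have h2 : ‖B v‖ ≤ s * ‖v‖ := by
      have := hP v; rwa [hve, zero_smul, sub_zero] at this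
    have h3 := real_inner_le_norm (B v) e
    rw [hen, mul_one] at h3
    by_contra hcon
    push Not at hcon
    have : 0 < ‖v‖ := hs0.trans_lt hcon
    nlinarith
  have hBe : ‖B e‖ ≤ τ + d * s + s := by
    have : B e = v + ⟪e, B e⟫ • e := by rw [hv]; abel
    rw [this]
    refine (norm_add_le _ _).trans ?_
    rw [norm_smul, hen, mul_one, Real.norm_eq_abs]; linarith
  have hτ0 : 0 ≤ τ := (abs_nonneg _).trans hτ
  refine B.opNorm_le_bound (by positivity) fun u => ?_
  have : B u = B (u - ⟪e, u⟫ • e) + ⟪e, u⟫ • B e := by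
    rw [map_sub, map_smul]; abel
  rw [this]
  have h5 : |⟪e, u⟫| ≤ ‖u‖ := by simpa [hen] using abs_real_inner_le_norm e u
  calc _ ≤ ‖B (u - ⟪e, u⟫ • e)‖ + ‖⟪e, u⟫ • B e‖ := norm_add_le _ _
    _ ≤ s * ‖u‖ + ‖u‖ * (τ + d * s + s) := by
        rw [norm_smul, Real.norm_eq_abs]
        exact add_le_add (hP u) (mul_le_mul h5 hBe (norm_nonneg _) (norm_nonneg _))
    _ = _ := by ring

lemma Aop_triv (hd : 1 ≤ d) {δ η R : ℝ} (hη : 0 < η) (hη1 : η ≤ 1) (hηδ : η ≤ δ) (hR : 1 ≤ R)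
    {ρ : Eu d → ℝ} (h : Dens R ρ) (x : Eu d) :
    ‖Aop δ ρ x‖ ≤ (1 + d) * (cL d R * (1 - Real.log η)) := by
  apply norm_int_log hd (by positivity) hη hη1 hR x
  · intro y _
    refine (h.norm_smul_le y _).trans ((norm_Dk_le (hη.trans_le hηδ) _).trans ?_)
    have := pow_le_pow_left₀ (uu_nonneg δ (x - y)) (uu_antitone hη hηδ (x - y)) d
    gcongr
  · intro y hy; rw [h.supp y hy]; exact zero_smul ℝ (Dk d δ (x - y))

lemma inner_pair_le (p u w : Eu d) : ‖⟪p, w⟫ • u - ⟪p, u⟫ • w‖ ≤ 2 * ‖p‖ * (‖u‖ * ‖w‖) := by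
  refine (norm_sub_le _ _).trans ?_
  rw [norm_smul, norm_smul, Real.norm_eq_abs, Real.norm_eq_abs]
  have a := mul_le_mul_of_nonneg_right (abs_real_inner_le_norm p w) (norm_nonneg u)
  have b := mul_le_mul_of_nonneg_right (abs_real_inner_le_norm p u) (norm_nonneg w)
  linarith

lemma near_diff (hd : 1 ≤ d) {δ η R N ω γ : ℝ} (hδ : 0 < δ) (hη : δ ≤ η) (hR : 0 < R)
    (h0 : 0 < γ) (h1 : γ < 1) (hω : 0 ≤ ω) (hN : 0 ≤ N)
    {ρ : Eu d → ℝ} {Y : Eu d → Eu d} (h : Dens R ρ) (hY : Fld ρ Y N ω γ) (x u w : Eu d) :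
    ‖(Aop δ ρ x - Aop η ρ x) (⟪Y x, w⟫ • u - ⟪Y x, u⟫ • w)‖
      ≤ (2 * N * c1 d * (cG d γ * η ^ γ) + 2 * ω * cS d 1 R) * (‖u‖ * ‖w‖) := by
  have hη0 : 0 < η := hδ.trans_le hη
  have hYc : Continuous Y := hY.smooth.continuous
  set p : Eu d → Eu d := fun y => ⟪Y y, w⟫ • u - ⟪Y y, u⟫ • w with hp
  have hpc : Continuous p := by
    rw [hp]; fun_prop
  have hk : ∀ {δ : ℝ}, 0 < δ → ∀ q : Eu d → Eu d, Continuous q →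
      Integrable fun y => ρ y • Dk d δ (x - y) (q y) := fun hδ q hq =>
    h.int ((contDk hδ x).clm_apply hq)
  have e1 : (Aop δ ρ x - Aop η ρ x) (p x)
      = (∫ y, ρ y • (Dk d δ (x - y) - Dk d η (x - y)) (p x - p y))
        + ∫ y, ρ y • (curl Y y u w • (kk d δ (x - y) - kk d η (x - y))) := by
    have i1 : ∫ y, ρ y • (Dk d δ (x - y) - Dk d η (x - y)) (p x - p y)
        = ((∫ y, ρ y • Dk d δ (x - y) (p x)) - ∫ y, ρ y • Dk d η (x - y) (p x))
          - ((∫ y, ρ y • Dk d δ (x - y) (p y)) - ∫ y, ρ y • Dk d η (x - y) (p y)) := by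
      rw [← integral_sub (hk hδ _ continuous_const) (hk hη0 _ continuous_const),
        ← integral_sub (hk hδ _ hpc) (hk hη0 _ hpc),
        ]
      have q := integral_sub ((hk hδ _ (continuous_const (y := p x))).sub (hk hη0 _ (continuous_const (y := p x))))
          ((hk hδ _ hpc).sub (hk hη0 _ hpc))
      simp only [Pi.sub_apply] at q
      rw [← q]
      congr 1; funext y
      simp only [_root_.sub_apply, map_sub, smul_sub]
    have hcc := continuous_curl hY.smooth u w
    have i2 : ∫ y, ρ y • (curl Y y u w • (kk d δ (x - y) - kk d η (x - y)))
        = (∫ y, ρ y • Dk d δ (x - y) (p y)) - ∫ y, ρ y • Dk d η (x - y) (p y) := by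
      have q := integral_sub (h.int (hcc.smul (contkk hδ x))) (h.int (hcc.smul (contkk hη0 x)))
      simp only [Pi.smul_apply'] at q
      rw [hp, ident hδ h hY, ident hη0 h hY, ← q]
      simp only [smul_sub]
    rw [i1, i2, _root_.sub_apply, Aop_apply hδ h, Aop_apply hη0 h]; abel
  change ‖(Aop δ ρ x - Aop η ρ x) (p x)‖ ≤ _
  rw [e1, add_mul]
  have huw : 0 ≤ ‖u‖ * ‖w‖ := by positivity
  refine (norm_add_le _ _).trans (add_le_add ?_ ?_)
  · have hi := gG_int (d := d) hd h0 h1 hη0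
    have := norm_int_le hd (f := fun y => ρ y • (Dk d δ (x - y) - Dk d η (x - y)) (p x - p y))
      (g := fun z => 2 * N * c1 d * (‖u‖ * ‖w‖) * gG d γ η z) x (hi.1.const_mul _) (by
        intro y hy
        refine (h.norm_smul_le y _).trans ((ContinuousLinearMap.le_opNorm _ _).trans ?_)
        have hpp : p x - p y = ⟪Y x - Y y, w⟫ • u - ⟪Y x - Y y, u⟫ • w := by
          simp only [hp, inner_sub_left, sub_smul]; abel
        have h3 : ‖p x - p y‖ ≤ 2 * (N * ‖x - y‖ ^ γ) * (‖u‖ * ‖w‖) := by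
          rw [hpp]
          refine (inner_pair_le _ _ _).trans ?_
          have := hY.hold x y
          gcongr
        have h4 := Dk_diff_gG (γ := γ) hδ hη hy
        calc _ ≤ ‖Dk d δ (x - y) - Dk d η (x - y)‖ * (2 * (N * ‖x - y‖ ^ γ) * (‖u‖ * ‖w‖)) := by gcongr
          _ = (2 * N * (‖u‖ * ‖w‖)) * (‖Dk d δ (x - y) - Dk d η (x - y)‖ * ‖x - y‖ ^ γ) := by ring
          _ ≤ (2 * N * (‖u‖ * ‖w‖)) * (c1 d * gG d γ η (x - y)) := by gcongr
          _ = _ := by ring)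
    rw [integral_const_mul, hi.2] at this
    refine this.trans (le_of_eq (by ring))
  · have := norm_int_supp hd (f := fun y => ρ y • (curl Y y u w • (kk d δ (x - y) - kk d η (x - y))))
      (A := 2 * ω * (‖u‖ * ‖w‖)) (s := 1) (R := R) (by positivity) one_pos (by exact_mod_cast hd) hR x
      (by
        intro y _ hy
        refine (h.norm_smul_le y _).trans ?_
        rw [norm_smul, Real.norm_eq_abs]
        have a := kk_le_rpow hd hδ hy
        have b := kk_le_rpow hd hη0 hy
        have c := norm_sub_le (kk d δ (x - y)) (kk d η (x - y))
        calc _ ≤ (ω * (‖u‖ * ‖w‖)) * (2 * ‖x - y‖ ^ ((1:ℝ) - d)) :=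
              mul_le_mul (hY.curl y u w) (by linarith) (norm_nonneg _) (by positivity)
          _ = _ := by ring)
      (by intro y hy; simp [h.supp y hy])
    refine this.trans (le_of_eq (by ring))

lemma near (hd : 1 ≤ d) {δ η R N ω γ : ℝ} (hδ : 0 < δ) (hη : 0 < η) (hη1 : η ≤ 1) (hR : 1 ≤ R)
    (h0 : 0 < γ) (h1 : γ < 1) (hω : 0 ≤ ω) (hN : 0 ≤ N)
    {ρ : Eu d → ℝ} {Y : Eu d → Eu d} (h : Dens R ρ) (hY : Fld ρ Y N ω γ) (x : Eu d) (hx : Y x ≠ 0) :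
    ‖Aop δ ρ x‖ ≤ (1 + d) * (cL d R * (1 - Real.log η)) + mass d
      + (d + 2) * ((2 * N * c1 d * (cG d γ * η ^ γ) + 2 * ω * cS d 1 R) / ‖Y x‖) := by
  have hR0 : 0 < R := by linarith
  have hm := mass_nonneg d
  have hG := cG_nonneg (d := d) h0 h1
  have hS := cS_nonneg (d := d) one_pos hR0
  have hc := c1_pos d
  have hrest : 0 ≤ (d + 2) * ((2 * N * c1 d * (cG d γ * η ^ γ) + 2 * ω * cS d 1 R) / ‖Y x‖) := by
    positivity
  rcases le_or_gt η δ with hc | hc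
  · have := Aop_triv hd hη hη1 hc hR h x
    linarith
  · have a := Aop_triv hd hη hη1 le_rfl hR h x
    have b := lin_alg (Aop δ ρ x - Aop η ρ x) (τ := mass d) (by
      intro a b
      simp only [_root_.sub_apply, inner_sub_left, inner_sub_right,
        Aop_symm hδ h, Aop_symm hη h]) hx (by
      simp only [_root_.sub_apply, inner_sub_right, Finset.sum_sub_distrib,
        Aop_trace hδ h, Aop_trace hη h]
      have := bb_bound hd hδ h x
      have := bb_bound hd hη h x
      rw [abs_le]; constructor <;> linarith) (near_diff hd hδ hc.le hR0 h0 h1 hω hN h hY x)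
    have : Aop δ ρ x = Aop η ρ x + (Aop δ ρ x - Aop η ρ x) := by abel
    rw [this]
    refine (norm_add_le _ _).trans ?_
    linarith

end AggPatch

namespace AggPatch
open MeasureTheory Metric Set
open scoped RealInnerProductSpace
variable {d : ℕ}

lemma exists_bump (d : ℕ) : ∃ (θ : Eu d → ℝ) (K : ℝ), 0 ≤ K ∧ ContDiff ℝ 1 θ ∧ (∀ y, 0 ≤ θ y) ∧
    (∀ y, θ y ≤ 1) ∧ (∀ y, ‖y‖ ≤ 1 → θ y = 1) ∧ (∀ y, 2 ≤ ‖y‖ → θ y = 0) ∧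
    ∀ y, ‖fderiv ℝ θ y‖ ≤ K := by
  let f : ContDiffBump (0 : Eu d) := ⟨1, 2, one_pos, one_lt_two⟩
  have hc : ContDiff ℝ 1 f := f.contDiff
  obtain ⟨K, hK⟩ := ((f.hasCompactSupport).fderiv (𝕜 := ℝ)).exists_bound_of_continuous
    (hc.continuous_fderiv one_ne_zero)
  refine ⟨f, K, (norm_nonneg _).trans (hK 0), hc, fun y => f.nonneg, fun y => f.le_one, ?_, ?_, hK⟩
  · intro y hy; apply f.one_of_mem_closedBall; simpa using hy
  · intro y hy; apply f.zero_of_le_dist; simpa using hy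

lemma far (hd : 1 ≤ d) {R : ℝ} (hR : 1 ≤ R) : ∃ C : ℝ, 0 ≤ C ∧ ∀ (δ r c : ℝ) (ρ : Eu d → ℝ) (x : Eu d),
    0 < δ → 0 < r → r ≤ 1 → 0 ≤ c → c ≤ 1 → Dens R ρ → (∀ y, ‖x - y‖ < r → ρ y = c) →
    ‖Aop δ ρ x‖ ≤ C * (1 - Real.log r) := by
  obtain ⟨θ, K, hK0, hθ, hθ0, hθ1, hθi, hθo, hK⟩ := exists_bump d
  have hR0 : 0 < R := by linarith
  have hL := cL_nonneg (d := d) hR0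
  have hc1 := c1_pos d
  have hv := sphereVol_nonneg d
  refine ⟨(1 + d) * cL d R + 2 * c1 d * sphereVol d + 2 * (K * (sphereVol d * 3)), by positivity, ?_⟩
  intro δ r c ρ x hδ hr hr1 hc0 hcl h hconst
  have hlog : Real.log r ≤ 0 := Real.log_nonpos hr.le hr1
  have hP : 0 ≤ 2 * c1 d * sphereVol d + 2 * (K * (sphereVol d * 3)) := by positivity
  rcases le_or_gt r δ with hrd | hrd
  · have := Aop_triv hd hr hr1 hrd hR h x
    nlinarith
  set θx : Eu d → ℝ := fun y => c * θ (y - x) with hθx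
  have hD : Dens (‖x‖ + 2) θx := by
    refine ⟨by rw [hθx]; fun_prop, fun y => mul_nonneg hc0 (hθ0 _),
      fun y => mul_le_one₀ hcl (hθ0 _) (hθ1 _), fun y hy => ?_⟩
    have : 2 ≤ ‖y - x‖ := by
      have h1 : ‖x‖ + 2 < ‖y‖ := by simpa using hy
      have := norm_sub_norm_le y x
      linarith
    simp [hθx, hθo _ this]
  have hB : ∀ δ : ℝ, 0 < δ → ‖Aop δ θx x‖ ≤ K * (sphereVol d * 3) := by
    intro δ hδ
    refine ContinuousLinearMap.opNorm_le_bound _ (by positivity) fun u => ?_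
    rw [Aop_apply hδ hD, ibp hδ hD.smooth hD.cs]
    have hi := gB_int (d := d) hd (s := 1) (r := 3) one_pos (by norm_num)
    have := norm_int_le hd (f := fun y => fderiv ℝ θx y u • kk d δ (x - y))
      (g := fun z => K * ‖u‖ * gB d 1 3 z) x (hi.1.const_mul _) (by
        intro y hy
        have hfd : fderiv ℝ θx y = c • fderiv ℝ θ (y - x) := by
          rw [hθx, fderiv_const_mul, fderiv_comp_sub]
          exact ((hθ.differentiable one_ne_zero).comp (differentiable_id.sub_const x)).differentiableAt
        rw [norm_smul]
        rcases lt_or_ge ‖x - y‖ 3 with h3 | h3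
        · rw [gB_of_lt h3, hfd]
          have h4 : ‖(c • fderiv ℝ θ (y - x)) u‖ ≤ K * ‖u‖ := by
            refine (ContinuousLinearMap.le_opNorm _ _).trans ?_
            gcongr
            rw [norm_smul, Real.norm_of_nonneg hc0]
            exact (mul_le_of_le_one_left (norm_nonneg _) hcl).trans (hK _)
          exact mul_le_mul h4 (kk_le_rpow hd hδ hy) (norm_nonneg _) (by positivity)
        · have : fderiv ℝ θ (y - x) = 0 := by
            have : θ =ᶠ[nhds (y - x)] fun _ => 0 := by
              have ho : {z : Eu d | 2 < ‖z‖} ∈ nhds (y - x) :=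
                (isOpen_lt continuous_const continuous_norm).mem_nhds (by
                  show 2 < ‖y - x‖
                  rw [norm_sub_rev]; linarith)
              filter_upwards [ho] with z hz using hθo z (le_of_lt hz)
            rw [this.fderiv_eq]; simp
          rw [hfd, this]
          simp only [smul_zero, _root_.zero_apply, norm_zero, zero_mul]
          have := gB_nonneg (d := d) 1 3 (x - y); positivity)
    rw [integral_const_mul, hi.2] at this
    refine this.trans (le_of_eq ?_)
    simp; ring
  have hkk : ∀ δ : ℝ, 0 < δ → ∀ (R' : ℝ) (f : Eu d → ℝ), Dens R' f →
      Integrable fun y => f y • Dk d δ (x - y) := fun δ hδ R' f hf => hf.int (contDk hδ x)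
  have e : Aop δ ρ x = Aop r ρ x + (Aop δ θx x - Aop r θx x)
      + ∫ y, (ρ y - θx y) • (Dk d δ (x - y) - Dk d r (x - y)) := by
    have q1 := integral_sub (hkk δ hδ _ _ h) (hkk r hr _ _ h)
    have q2 := integral_sub (hkk δ hδ _ _ hD) (hkk r hr _ _ hD)
    have q3 := integral_sub ((hkk δ hδ _ _ h).sub (hkk r hr _ _ h)) ((hkk δ hδ _ _ hD).sub (hkk r hr _ _ hD))
    simp only [Pi.sub_apply] at q3
    have q4 : ∫ y, (ρ y - θx y) • (Dk d δ (x - y) - Dk d r (x - y))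
      = (Aop δ ρ x - Aop r ρ x) - (Aop δ θx x - Aop r θx x) := by
      unfold Aop
      rw [← q1, ← q2, ← q3]
      congr 1; funext y
      refine ContinuousLinearMap.ext fun u => ?_
      simp only [_root_.sub_apply, _root_.smul_apply]
      module
    rw [q4]; abel
  have hi := gO_int (d := d) hd (s := 1) (r := r / 2) one_pos (by positivity)
  have hlast : ‖∫ y, (ρ y - θx y) • (Dk d δ (x - y) - Dk d r (x - y))‖ ≤ 2 * c1 d * sphereVol d := by
    have := norm_int_le hd (f := fun y => (ρ y - θx y) • (Dk d δ (x - y) - Dk d r (x - y)))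
      (g := fun z => c1 d * r * gO d 1 (r / 2) z) x (hi.1.const_mul _) (by
        intro y hy
        rw [norm_smul]
        rcases lt_or_ge ‖x - y‖ r with h3 | h3
        · have : ρ y - θx y = 0 := by
            rw [hconst y h3, hθx]
            simp only
            rw [hθi, mul_one, sub_self]
            rw [norm_sub_rev]; linarith
          rw [this, norm_zero, zero_mul]
          have := gO_nonneg (d := d) 1 (r / 2) (x - y); positivity
        · rw [gO_of_lt (by linarith)]
          have h4 := Dk_diff_le2 hδ hrd.le hy
          have h5 : ‖ρ y - θx y‖ ≤ 1 := by
            rw [Real.norm_eq_abs, abs_le]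
            have := h.nonneg y; have := h.le_one y; have := hD.nonneg y; have := hD.le_one y
            constructor <;> linarith
          have h6 := pow_inv_rpow (norm_pos_iff.2 hy) 0 (d + 1)
          rw [Real.rpow_zero, one_mul] at h6
          rw [h6] at h4
          calc _ ≤ 1 * (c1 d * (r * ‖x - y‖ ^ (0 - ((d + 1 : ℕ) : ℝ)))) :=
                mul_le_mul h5 h4 (norm_nonneg _) zero_le_one
            _ = c1 d * r * ‖x - y‖ ^ (0 - ((d + 1 : ℕ) : ℝ)) := by ring
            _ = _ := by congr 2; push_cast; ring)
    rw [integral_const_mul, hi.2] at this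
    refine this.trans (le_of_eq ?_)
    rw [Real.rpow_neg_one]; field_simp
  have t := Aop_triv hd hr hr1 le_rfl hR h x
  have t1 := hB δ hδ
  have t2 := hB r hr
  have : ‖Aop δ ρ x‖ ≤ (1 + d) * (cL d R * (1 - Real.log r)) + 2 * (K * (sphereVol d * 3))
      + 2 * c1 d * sphereVol d := by
    rw [e]
    refine (norm_add_le _ _).trans (add_le_add ((norm_add_le _ _).trans (add_le_add t ?_)) hlast)
    refine (norm_sub_le _ _).trans ?_
    linarith
  nlinarith

/-- reduced kernel -/
noncomputable def Lk (d : ℕ) (δ : ℝ) (z : Eu d) : Eu d →L[ℝ] Eu d :=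
  Dk d δ z - psi d δ z • ContinuousLinearMap.id ℝ (Eu d)

lemma norm_psi_id (a : ℝ) : ‖a • ContinuousLinearMap.id ℝ (Eu d)‖ ≤ |a| := by
  rw [norm_smul, Real.norm_eq_abs]
  exact mul_le_of_le_one_right (abs_nonneg _) ContinuousLinearMap.norm_id_le

lemma Lk_sub_le {δ η : ℝ} (hδ : 0 < δ) (hη : 0 < η) (z w : Eu d) :
    ‖Lk d δ z - Lk d η w‖ ≤ (1 + d) * ‖Dk d δ z - Dk d η w‖ := by
  have : Lk d δ z - Lk d η w = (Dk d δ z - Dk d η w)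
      - (psi d δ z - psi d η w) • ContinuousLinearMap.id ℝ (Eu d) := by
    refine ContinuousLinearMap.ext fun u => ?_
    simp only [Lk, _root_.sub_apply, _root_.smul_apply]
    module
  rw [this]
  have a := psi_sub_le hδ hη z w
  have b := norm_psi_id (d := d) (psi d δ z - psi d η w)
  have := norm_sub_le (Dk d δ z - Dk d η w) ((psi d δ z - psi d η w) • ContinuousLinearMap.id ℝ (Eu d))
  linarith

lemma continuous_Lk {δ : ℝ} (hδ : 0 < δ) : Continuous (Lk d δ) := by
  unfold Lk
  have := (contDiff_psi (d := d) (n := 0) hδ).continuous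
  exact (continuous_Dk hδ).sub (this.smul continuous_const)

lemma contLk {δ : ℝ} (hδ : 0 < δ) (x : Eu d) : Continuous fun y => Lk d δ (x - y) :=
  (continuous_Lk hδ).comp (continuous_const.sub continuous_id)

/-- commutator -/
noncomputable def comm (δ : ℝ) (ρ : Eu d → ℝ) (Y : Eu d → Eu d) (x : Eu d) : Eu d :=
  ∫ y, ρ y • Lk d δ (x - y) (Y x - Y y)

/-- remainder -/
noncomputable def rem (δ : ℝ) (ρ : Eu d → ℝ) (Y : Eu d → Eu d) (x : Eu d) : Eu d :=
  ∫ y, ρ y • Lk d δ (x - y) (Y y)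

lemma Lint_apply {δ R : ℝ} (hδ : 0 < δ) {ρ : Eu d → ℝ} (h : Dens R ρ) (x w : Eu d) :
    ∫ y, ρ y • Lk d δ (x - y) w = Aop δ ρ x w - bb δ ρ x • w := by
  rw [Aop_apply hδ h, bb]
  have q := integral_sub (h.int ((contDk hδ x).clm_apply (continuous_const (y := w))))
    ((h.int (contpsi hδ x)).smul_const w)
  rw [← integral_smul_const, ← q]
  congr 1; funext y
  simp [Lk, smul_sub, smul_smul]

lemma comm_add_rem {δ R : ℝ} (hδ : 0 < δ) {ρ : Eu d → ℝ} (h : Dens R ρ) {Y : Eu d → Eu d}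
    (hY : Continuous Y) (x : Eu d) :
    comm δ ρ Y x + rem δ ρ Y x = Aop δ ρ x (Y x) - bb δ ρ x • Y x := by
  rw [← Lint_apply hδ h, comm, rem, ← integral_add]
  · congr 1; funext y; rw [map_sub, smul_sub]; abel
  · exact h.int ((contLk hδ x).clm_apply (continuous_const.sub hY))
  · exact h.int ((contLk hδ x).clm_apply hY)

end AggPatch

namespace AggPatch
open MeasureTheory Metric Set
open scoped RealInnerProductSpace
variable {d : ℕ}

/-- constant in the commutator estimate -/
noncomputable def c2 (d : ℕ) (γ : ℝ) : ℝ :=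
  2 * ((1 + d) * c1 d * cG d γ) + mass d + (1 + d) * (c1 d * 2 ^ (d + 1)) * cG d γ

lemma c2_nonneg {γ : ℝ} (h0 : 0 < γ) (h1 : γ < 1) : 0 ≤ c2 d γ := by
  have hG := cG_nonneg (d := d) h0 h1
  have hc := c1_pos d
  have hm := mass_nonneg d
  unfold c2; positivity

lemma uu_two {η : ℝ} (hη : 0 < η) (z z' : Eu d) (h : ‖z - z'‖ ≤ η) : uu η z ≤ 2 * uu η z' := by
  have h1 := nu_pos hη z
  have h2 := nu_pos hη z'
  have a := nu_sub_le η η z' z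
  rw [sub_self, abs_zero, add_zero, norm_sub_rev] at a
  have b := (abs_le.1 a).2
  have c : η ≤ √(‖z‖ ^ 2 + η ^ 2) := Real.le_sqrt_of_sq_le (by nlinarith [sq_nonneg ‖z‖])
  unfold uu
  rw [← div_eq_mul_inv, le_div_iff₀ h2, inv_mul_le_iff₀ h1]
  linarith

lemma Lk_shift {η r γ : ℝ} (hr : 0 < r) (hrη : r ≤ η) {z z' : Eu d} (hz' : z' ≠ 0) (h : ‖z - z'‖ = r) :
    ‖Lk d η z - Lk d η z'‖ * ‖z'‖ ^ γ ≤ (1 + d) * (c1 d * 2 ^ (d + 1)) * gG d γ r z' := by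
  have hη : 0 < η := hr.trans_le hrη
  have hc := c1_pos d
  have hp : 0 ≤ ‖z'‖ ^ γ := by positivity
  have hu0 := uu_nonneg η z'
  have a := Dk_sub_le hη hη z z' (uu_two hη z z' (h.le.trans hrη)) (by linarith : uu η z' ≤ 2 * uu η z')
  rw [sub_self, abs_zero, add_zero, h] at a
  have hc1 : (d:ℝ) + d * (d + 4) ≤ c1 d := by unfold c1; linarith [show (0:ℝ) ≤ d by positivity]
  have key : ‖Lk d η z - Lk d η z'‖ ≤ (1 + d) * (c1 d * 2 ^ (d + 1)) * (r * uu η z' ^ (d + 1)) := by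
    refine (Lk_sub_le hη hη z z').trans ?_
    rw [mul_assoc]
    gcongr
    refine a.trans ?_
    rw [mul_pow]
    calc _ ≤ c1 d * (2 ^ (d + 1) * uu η z' ^ (d + 1)) * r := by gcongr
      _ = _ := by ring
  have hul := uu_le_inv_norm hη hz'
  apply le_gG' (by positivity) hr hz'
  · have : r * uu η z' ^ (d + 1) ≤ ‖z'‖⁻¹ ^ d := by
      have b := uu_mul_le hη z'
      have b' : uu η z' * r ≤ 1 := (mul_le_mul_of_nonneg_left hrη hu0).trans b
      calc r * uu η z' ^ (d + 1) = (uu η z' * r) * uu η z' ^ d := by ring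
        _ ≤ 1 * ‖z'‖⁻¹ ^ d := by gcongr
        _ = _ := one_mul _
    calc _ ≤ (1 + d) * (c1 d * 2 ^ (d + 1)) * (‖z'‖⁻¹ ^ d) * ‖z'‖ ^ γ := by
          gcongr; exact key.trans (by gcongr)
      _ = _ := by ring
  · calc _ ≤ (1 + d) * (c1 d * 2 ^ (d + 1)) * (r * ‖z'‖⁻¹ ^ (d + 1)) * ‖z'‖ ^ γ := by
          gcongr; exact key.trans (by gcongr)
      _ = _ := by ring

lemma comm_diff (hd : 1 ≤ d) {δ η N R γ : ℝ} (hδ : 0 < δ) (hη : δ ≤ η)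
    (h0 : 0 < γ) (h1 : γ < 1) (hN : 0 ≤ N)
    {ρ : Eu d → ℝ} {Y : Eu d → Eu d} (h : Dens R ρ) (hY : Continuous Y)
    (hh : ∀ x y, ‖Y x - Y y‖ ≤ N * ‖x - y‖ ^ γ) (x : Eu d) :
    ‖comm δ ρ Y x - comm η ρ Y x‖ ≤ N * ((1 + d) * c1 d * cG d γ) * η ^ γ := by
  have hη0 : 0 < η := hδ.trans_le hη
  have hi := gG_int (d := d) hd h0 h1 hη0
  unfold comm
  have hYc : Continuous fun y => Y x - Y y := by fun_prop
  rw [← integral_sub (h.int ((contLk hδ x).clm_apply hYc)) (h.int ((contLk hη0 x).clm_apply hYc))]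
  have := norm_int_le hd (f := fun y => ρ y • Lk d δ (x - y) (Y x - Y y) - ρ y • Lk d η (x - y) (Y x - Y y))
      (g := fun z => N * ((1 + d) * c1 d) * gG d γ η z) x (hi.1.const_mul _) (by
        intro y hy
        rw [← smul_sub, ← _root_.sub_apply]
        refine (h.norm_smul_le y _).trans ((ContinuousLinearMap.le_opNorm _ _).trans ?_)
        have h4 := Dk_diff_gG (γ := γ) hδ hη hy
        calc _ ≤ ((1 + d) * ‖Dk d δ (x - y) - Dk d η (x - y)‖) * (N * ‖x - y‖ ^ γ) := by
              gcongr
              · exact Lk_sub_le hδ hη0 _ _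
              · exact hh x y
          _ = (N * (1 + d)) * (‖Dk d δ (x - y) - Dk d η (x - y)‖ * ‖x - y‖ ^ γ) := by ring
          _ ≤ (N * (1 + d)) * (c1 d * gG d γ η (x - y)) := by gcongr
          _ = _ := by ring)
  rw [integral_const_mul, hi.2] at this
  exact this.trans (le_of_eq (by ring))

lemma comm_holder (hd : 1 ≤ d) {δ a N R γ : ℝ} (hδ : 0 < δ)
    (h0 : 0 < γ) (h1 : γ < 1) (hN : 0 ≤ N)
    {ρ : Eu d → ℝ} {Y : Eu d → Eu d} (h : Dens R ρ) (hY : Continuous Y)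
    (hh : ∀ x y, ‖Y x - Y y‖ ≤ N * ‖x - y‖ ^ γ)
    (hA : ∀ η, δ ≤ η → ∀ x, ‖Aop η ρ x‖ ≤ a) (x x' : Eu d) :
    ‖comm δ ρ Y x - comm δ ρ Y x'‖ ≤ (c2 d γ + a) * N * ‖x - x'‖ ^ γ := by
  have hG := cG_nonneg (d := d) h0 h1
  have hc := c1_pos d
  rcases eq_or_ne x x' with rfl | hne
  · simp [Real.zero_rpow h0.ne']
  set r := ‖x - x'‖ with hr
  have hr0 : 0 < r := norm_pos_iff.2 (sub_ne_zero.2 hne)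
  have main : ∀ η, δ ≤ η → r ≤ η → ‖comm η ρ Y x - comm η ρ Y x'‖
      ≤ (a + mass d + (1 + d) * (c1 d * 2 ^ (d + 1)) * cG d γ) * N * r ^ γ := by
    intro η hδη hrη
    have hη0 : 0 < η := hδ.trans_le hδη
    have hi := gG_int (d := d) hd h0 h1 hr0
    have e : comm η ρ Y x - comm η ρ Y x' = (Aop η ρ x (Y x - Y x') - bb η ρ x • (Y x - Y x'))
        + ∫ y, ρ y • (Lk d η (x - y) - Lk d η (x' - y)) (Y x' - Y y) := by
      have hYc : Continuous fun y => Y x - Y y := by fun_prop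
      have hYc' : Continuous fun y => Y x' - Y y := by fun_prop
      have l1 := contLk (d := d) hη0 x
      have l2 := contLk (d := d) hη0 x'
      have hL : Continuous fun y => Lk d η (x - y) - Lk d η (x' - y) := by fun_prop
      rw [← Lint_apply hη0 h, comm, comm, ← integral_sub (h.int (l1.clm_apply hYc))
        (h.int (l2.clm_apply hYc')), ← integral_add
        (h.int (l1.clm_apply continuous_const))
        (h.int (hL.clm_apply hYc'))]
      congr 1; funext y
      simp only [map_sub, _root_.sub_apply]; module
    have t1 : ‖Aop η ρ x (Y x - Y x') - bb η ρ x • (Y x - Y x')‖ ≤ (a + mass d) * (N * r ^ γ) := by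
      have hb := bb_bound hd hη0 h x
      have hyy := hh x x'
      have ha0 : 0 ≤ a := (norm_nonneg _).trans (hA η hδη x)
      have hm := mass_nonneg d
      calc _ ≤ ‖Aop η ρ x (Y x - Y x')‖ + ‖bb η ρ x • (Y x - Y x')‖ := norm_sub_le _ _
        _ ≤ a * (N * r ^ γ) + mass d * (N * r ^ γ) := by
            rw [norm_smul, Real.norm_of_nonneg hb.1]
            refine add_le_add (((Aop η ρ x).le_opNorm _).trans ?_) ?_
            · exact mul_le_mul (hA η hδη x) hyy (norm_nonneg _) ha0
            · exact mul_le_mul hb.2 hyy (norm_nonneg _) hm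
        _ = _ := by ring
    have t2 := norm_int_le hd (f := fun y => ρ y • (Lk d η (x - y) - Lk d η (x' - y)) (Y x' - Y y))
      (g := fun z => N * ((1 + d) * (c1 d * 2 ^ (d + 1))) * gG d γ r z) x' (hi.1.const_mul _) (by
        intro y hy
        refine (h.norm_smul_le y _).trans ((ContinuousLinearMap.le_opNorm _ _).trans ?_)
        have hz : ‖(x - y) - (x' - y)‖ = r := by rw [hr]; congr 1; abel
        have h4 := Lk_shift (γ := γ) hr0 hrη hy hz
        calc _ ≤ ‖Lk d η (x - y) - Lk d η (x' - y)‖ * (N * ‖x' - y‖ ^ γ) := by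
              gcongr; exact hh x' y
          _ = N * (‖Lk d η (x - y) - Lk d η (x' - y)‖ * ‖x' - y‖ ^ γ) := by ring
          _ ≤ N * ((1 + d) * (c1 d * 2 ^ (d + 1)) * gG d γ r (x' - y)) := mul_le_mul_of_nonneg_left h4 hN
          _ = _ := by ring)
    rw [integral_const_mul, hi.2] at t2
    rw [e]
    refine (norm_add_le _ _).trans ((add_le_add t1 t2).trans (le_of_eq (by ring)))
  rcases le_or_gt r δ with hrd | hrd
  · refine (main δ le_rfl hrd).trans ?_
    have : 0 ≤ 2 * ((1 + d) * c1 d * cG d γ) * N * r ^ γ := by positivity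
    unfold c2
    nlinarith
  · have m := main r hrd.le le_rfl
    have d1 := comm_diff hd hδ hrd.le h0 h1 hN h hY hh x
    have d2 := comm_diff hd hδ hrd.le h0 h1 hN h hY hh x'
    have : comm δ ρ Y x - comm δ ρ Y x' = (comm δ ρ Y x - comm r ρ Y x) - (comm δ ρ Y x' - comm r ρ Y x')
        + (comm r ρ Y x - comm r ρ Y x') := by abel
    rw [this]
    refine (norm_add_le _ _).trans ((add_le_add ((norm_sub_le _ _).trans (add_le_add d1 d2)) m).trans ?_)
    unfold c2
    apply le_of_eq; ring

lemma kk_holder (hd : 1 ≤ d) {δ γ : ℝ} (hδ : 0 < δ) (h0 : 0 < γ) (h1 : γ < 1) {z z' : Eu d}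
    (hz : z ≠ 0) (hz' : z' ≠ 0) :
    ‖kk d δ z - kk d δ z'‖ ≤ (2 * (d + 1) * ‖z - z'‖ ^ γ) * ‖z‖ ^ ((1 - γ) - d)
      + (2 * (d + 1) * ‖z - z'‖ ^ γ) * ‖z'‖ ^ ((1 - γ) - d) := by
  set M := max (uu δ z) (uu δ z') with hM
  have hM0 : 0 < M := lt_max_of_lt_left (uu_pos hδ z)
  have a := kk_sub_le hδ hd z z' (le_max_left _ (uu δ z')) (le_max_right (uu δ z) _)
  rw [← hM] at a
  have b : ‖kk d δ z - kk d δ z'‖ ≤ 2 * M ^ (d - 1) := by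
    refine (norm_sub_le _ _).trans ?_
    have p := (norm_kk_le hδ hd z).trans (pow_le_pow_left₀ (uu_nonneg δ z) (le_max_left _ (uu δ z')) (d-1))
    have q := (norm_kk_le hδ hd z').trans (pow_le_pow_left₀ (uu_nonneg δ z') (le_max_right (uu δ z) _) (d-1))
    linarith
  set Δ := ‖z - z'‖ with hΔ
  have hΔ0 : 0 ≤ Δ := norm_nonneg _
  have hMd : M ^ d = M ^ (d - 1) * M := by rw [← pow_succ, Nat.sub_add_cancel hd]
  have hd0 : (1:ℝ) ≤ d := by exact_mod_cast hd
  have hMp : 0 ≤ M ^ (d - 1) := by positivity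
  have c : ‖kk d δ z - kk d δ z'‖ ≤ 2 * (d + 1) * M ^ (d - 1) * (M * Δ) ^ γ := by
    rcases le_or_gt (M * Δ) 1 with h | h
    · have : M * Δ ≤ (M * Δ) ^ γ := by
        calc M * Δ = (M * Δ) ^ (1:ℝ) := (Real.rpow_one _).symm
          _ ≤ _ := Real.rpow_le_rpow_of_exponent_ge_of_imp (by positivity) h h1.le (by intro _ h; linarith)
      calc _ ≤ (d + 1) * M ^ (d - 1) * (M * Δ) := by rw [hMd] at a; linarith
        _ ≤ (d + 1) * M ^ (d - 1) * (M * Δ) ^ γ := by gcongr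
        _ ≤ _ := by
          have : 0 ≤ (d + 1) * M ^ (d - 1) * (M * Δ) ^ γ := by positivity
          linarith
    · have : 1 ≤ (M * Δ) ^ γ := Real.one_le_rpow h.le h0.le
      calc _ ≤ 2 * M ^ (d - 1) := b
        _ ≤ (2 * (d + 1) * M ^ (d - 1)) * 1 := by nlinarith
        _ ≤ _ := by gcongr
  have e : M ^ (d - 1) * (M * Δ) ^ γ = Δ ^ γ * M ^ ((d:ℝ) - (1 - γ)) := by
    rw [Real.mul_rpow hM0.le hΔ0, ← Real.rpow_natCast]
    have : M ^ ((d:ℝ) - (1 - γ)) = M ^ (((d - 1 : ℕ) : ℝ)) * M ^ γ := by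
      rw [← Real.rpow_add hM0]; congr 1; push_cast [Nat.cast_sub hd]; ring
    rw [this]; ring
  have f : M ^ ((d:ℝ) - (1 - γ)) ≤ ‖z‖ ^ ((1 - γ) - d) + ‖z'‖ ^ ((1 - γ) - d) := by
    have g : ∀ w : Eu d, w ≠ 0 → uu δ w ^ ((d:ℝ) - (1 - γ)) ≤ ‖w‖ ^ ((1 - γ) - d) := by
      intro w hw
      have := Real.rpow_le_rpow (uu_nonneg δ w) (uu_le_inv_norm hδ hw) (by linarith : 0 ≤ (d:ℝ) - (1 - γ))
      rwa [Real.inv_rpow (norm_nonneg _), ← Real.rpow_neg (norm_nonneg _), neg_sub] at this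
    have p1 : 0 ≤ ‖z‖ ^ ((1 - γ) - d) := by positivity
    have p2 : 0 ≤ ‖z'‖ ^ ((1 - γ) - d) := by positivity
    rcases max_choice (uu δ z) (uu δ z') with hm | hm
    · rw [hM, hm]; have := g z hz; linarith
    · rw [hM, hm]; have := g z' hz'; linarith
  calc _ ≤ 2 * (d + 1) * (M ^ (d - 1) * (M * Δ) ^ γ) := by linarith
    _ = 2 * (d + 1) * Δ ^ γ * M ^ ((d:ℝ) - (1 - γ)) := by rw [e]; ring
    _ ≤ 2 * (d + 1) * Δ ^ γ * (‖z‖ ^ ((1 - γ) - d) + ‖z'‖ ^ ((1 - γ) - d)) := by gcongr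
    _ = _ := by ring

/-- constant for the remainder -/
noncomputable def c3 (d : ℕ) (γ R : ℝ) : ℝ := d * (4 * (d + 1) * cS d (1 - γ) R)

lemma rem_holder (hd : 1 ≤ d) {δ N R γ ω : ℝ} (hδ : 0 < δ)
    (h0 : 0 < γ) (h1 : γ < 1) (hω : 0 ≤ ω) (hR : 0 < R)
    {ρ : Eu d → ℝ} {Y : Eu d → Eu d} (h : Dens R ρ) (hY : Fld ρ Y N ω γ) (x x' : Eu d) :
    ‖rem δ ρ Y x - rem δ ρ Y x'‖ ≤ c3 d γ R * ω * ‖x - x'‖ ^ γ := by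
  set bs := EuclideanSpace.basisFun (Fin d) ℝ
  have hYc := hY.smooth.continuous
  have hS := cS_nonneg (d := d) (by linarith : 0 < 1 - γ) hR
  have form : ∀ x w, ⟪rem δ ρ Y x, w⟫
      = -∑ i, ⟪bs i, ∫ y, ρ y • (curl Y y (bs i) w • kk d δ (x - y))⟫ := by
    intro x w
    have hii : ∀ i, Integrable fun y => ρ y • Dk d δ (x - y) (⟪Y y, w⟫ • bs i - ⟪Y y, bs i⟫ • w) := fun i =>
      h.int ((contDk hδ x).clm_apply (by fun_prop))
    have hR' : Integrable fun y => ρ y • Lk d δ (x - y) (Y y) := h.int ((contLk hδ x).clm_apply hYc)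
    have : ∀ i, ⟪bs i, ∫ y, ρ y • (curl Y y (bs i) w • kk d δ (x - y))⟫
        = ∫ y, ⟪bs i, ρ y • Dk d δ (x - y) (⟪Y y, w⟫ • bs i - ⟪Y y, bs i⟫ • w)⟫ := by
      intro i
      rw [← ident hδ h hY, integral_inner (hii i)]
    simp_rw [this]
    rw [← integral_finsetSum _ (fun i _ => (hii i).const_inner (bs i)), ← integral_neg, rem, real_inner_comm,
      ← integral_inner hR']
    congr 1; funext y
    simp only [map_sub, map_smul, inner_smul_right, inner_sub_right, mul_sub, Finset.sum_sub_distrib]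
    have e1 : ∑ i, ρ y * (⟪Y y, w⟫ * ⟪bs i, Dk d δ (x - y) (bs i)⟫) = ρ y * ⟪Y y, w⟫ * psi d δ (x - y) := by
      rw [← trace_Dk hδ (x - y) bs, Finset.mul_sum]
      exact Finset.sum_congr rfl fun i _ => by ring
    have e2 : ∑ i, ρ y * (⟪Y y, bs i⟫ * ⟪bs i, Dk d δ (x - y) w⟫) = ρ y * ⟪Y y, Dk d δ (x - y) w⟫ := by
      rw [← bs.sum_inner_mul_inner, Finset.mul_sum]
    rw [e1, e2, Lk, _root_.sub_apply, _root_.smul_apply, inner_sub_right, ← Dk_symm]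
    simp only [ContinuousLinearMap.id_apply, inner_smul_right]
    rw [real_inner_comm (Y y) w, real_inner_comm (Y y) (Dk d δ (x - y) w)]; ring
  set Q := 4 * (d + 1) * cS d (1 - γ) R * ω * ‖x - x'‖ ^ γ with hQ
  have hQ0 : 0 ≤ Q := by positivity
  have hintg : ∀ i w, ‖(∫ y, ρ y • (curl Y y (bs i) w • kk d δ (x - y)))
      - ∫ y, ρ y • (curl Y y (bs i) w • kk d δ (x' - y))‖ ≤ Q * ‖w‖ := by
    intro i w
    have hcc := continuous_curl hY.smooth (bs i) w
    have q := integral_sub (h.int (hcc.smul (contkk hδ x))) (h.int (hcc.smul (contkk hδ x')))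
    simp only [Pi.smul_apply'] at q
    rw [← q]
    set A := 2 * (d + 1) * ‖x - x'‖ ^ γ * (ω * ‖w‖) with hA
    have hA0 : 0 ≤ A := by positivity
    have i1 := gM_int (d := d) hd (s := 1 - γ) (by linarith) hR x
    have i2 := gM_int (d := d) hd (s := 1 - γ) (by linarith) hR x'
    have : ‖∫ y, (ρ y • (curl Y y (bs i) w • kk d δ (x - y)) - ρ y • (curl Y y (bs i) w • kk d δ (x' - y)))‖
        ≤ ∫ y, (A * gM d (1 - γ) R x y + A * gM d (1 - γ) R x' y) := by
      apply norm_integral_le_of_norm_le ((i1.1.const_mul A).add (i2.1.const_mul A))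
      filter_upwards [ae_ne hd x, ae_ne hd x'] with y hy hy'
      have hsd : 1 - γ ≤ (d:ℝ) := by
        have : (1:ℝ) ≤ d := by exact_mod_cast hd
        linarith
      by_cases hyR : y ∈ closedBall (0 : Eu d) R
      · rw [← smul_sub, ← smul_sub]
        refine (h.norm_smul_le y _).trans ?_
        rw [norm_smul, Real.norm_eq_abs]
        have hcu := hY.curl y (bs i) w
        rw [show ‖bs i‖ = 1 from bs.orthonormal.1 i, one_mul] at hcu
        have hk := kk_holder hd hδ h0 h1 hy hy'
        have : (x - y) - (x' - y) = x - x' := by abel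
        rw [this] at hk
        have g1 := le_gM (x := x) hR hsd hyR
        have g2 := le_gM (x := x') hR hsd hyR
        calc _ ≤ (ω * ‖w‖) * ((2 * (d + 1) * ‖x - x'‖ ^ γ) * ‖x - y‖ ^ ((1 - γ) - d)
            + (2 * (d + 1) * ‖x - x'‖ ^ γ) * ‖x' - y‖ ^ ((1 - γ) - d)) :=
              mul_le_mul hcu hk (norm_nonneg _) (by positivity)
          _ = A * ‖x - y‖ ^ ((1 - γ) - d) + A * ‖x' - y‖ ^ ((1 - γ) - d) := by rw [hA]; ring
          _ ≤ _ := add_le_add (mul_le_mul_of_nonneg_left g1 hA0) (mul_le_mul_of_nonneg_left g2 hA0)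
      · simp only [h.supp y hyR, zero_smul, sub_self, norm_zero]
        have g1 := gM_nonneg (s := 1 - γ) hR x y
        have g2 := gM_nonneg (s := 1 - γ) hR x' y
        exact add_nonneg (mul_nonneg hA0 g1) (mul_nonneg hA0 g2)
    refine this.trans (le_of_eq ?_)
    rw [integral_add (i1.1.const_mul A) (i2.1.const_mul A), integral_const_mul, integral_const_mul, i1.2, i2.2, hA, hQ]
    ring
  have hw : ∀ w, ⟪rem δ ρ Y x - rem δ ρ Y x', w⟫ ≤ d * Q * ‖w‖ := by
    intro w
    rw [inner_sub_left, form, form, neg_sub_neg, ← Finset.sum_sub_distrib]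
    calc _ ≤ ∑ i : Fin d, Q * ‖w‖ := by
          apply Finset.sum_le_sum
          intro i _
          rw [← inner_sub_right]
          refine (real_inner_le_norm _ _).trans ?_
          rw [show ‖bs i‖ = 1 from bs.orthonormal.1 i, one_mul, norm_sub_rev]
          exact hintg i w
      _ = _ := by simp; ring
  have := hw (rem δ ρ Y x - rem δ ρ Y x')
  rw [real_inner_self_eq_norm_sq] at this
  have fin : ‖rem δ ρ Y x - rem δ ρ Y x'‖ ≤ d * Q := by
    by_contra hcon
    push Not at hcon
    have : 0 ≤ d * Q := by positivity
    nlinarith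
  refine fin.trans (le_of_eq ?_)
  rw [hQ, c3]; ring

end AggPatch

namespace AggPatch
open MeasureTheory Metric Set
open scoped RealInnerProductSpace
variable {d : ℕ}

lemma contDiff_vel {δ R : ℝ} {n : ℕ∞} (hδ : 0 < δ) {ρ : Eu d → ℝ} (h : Dens R ρ) (hs : ContDiff ℝ n ρ) :
    ContDiff ℝ n (vel δ ρ) :=
  HasCompactSupport.contDiff_convolution_left (ContinuousLinearMap.lsmul ℝ ℝ) h.cs hs
    (continuous_kk (d := d) hδ).locallyIntegrable

lemma contDiff_bb {δ R : ℝ} {n : ℕ∞} (hδ : 0 < δ) {ρ : Eu d → ℝ} (h : Dens R ρ) (hs : ContDiff ℝ n ρ) :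
    ContDiff ℝ n (bb δ ρ) :=
  HasCompactSupport.contDiff_convolution_left (ContinuousLinearMap.lsmul ℝ ℝ) h.cs hs
    (contDiff_psi (d := d) (n := 0) hδ).continuous.locallyIntegrable

lemma contD {R : ℝ} {ρ : Eu d → ℝ} (h : Dens R ρ) : Continuous (fderiv ℝ ρ) :=
  h.smooth.continuous_fderiv one_ne_zero

lemma fderiv_vel {δ R : ℝ} (hδ : 0 < δ) {ρ : Eu d → ℝ} (h : Dens R ρ) (x : Eu d) :
    HasFDerivAt (vel δ ρ) (Aop δ ρ x) x := by
  have a := HasCompactSupport.hasFDerivAt_convolution_left (μ := volume) (ContinuousLinearMap.lsmul ℝ ℝ) h.cs h.smooth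
    (continuous_kk (d := d) hδ).locallyIntegrable x
  refine HasFDerivAt.congr_fderiv a ?_
  refine ContinuousLinearMap.ext fun u => ?_
  rw [Aop_apply hδ h, ibp hδ h.smooth h.cs]
  unfold convolution
  rw [ContinuousLinearMap.integral_apply]
  · rfl
  · apply Continuous.integrable_of_hasCompactSupport
    · have := contD h
      have := contkk (d := d) hδ x
      fun_prop
    · refine (h.cs.fderiv ℝ).mono' ?_
      refine (Function.support_subset_iff'.2 ?_).trans subset_closure
      intro y hy
      rw [Function.notMem_support.1 hy]
      simp

lemma fderiv_bb {δ R : ℝ} (hδ : 0 < δ) {ρ : Eu d → ℝ} (h : Dens R ρ) (x u : Eu d) :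
    fderiv ℝ (bb δ ρ) x u = ∫ y, fderiv ℝ ρ y u * psi d δ (x - y) := by
  have a := HasCompactSupport.hasFDerivAt_convolution_left (μ := volume) (ContinuousLinearMap.lsmul ℝ ℝ) h.cs h.smooth
    (contDiff_psi (d := d) (n := 0) hδ).continuous.locallyIntegrable x
  have e : fderiv ℝ (bb δ ρ) x = _ := a.fderiv
  rw [e]
  unfold convolution
  rw [ContinuousLinearMap.integral_apply]
  · rfl
  · apply Continuous.integrable_of_hasCompactSupport
    · have := contD h
      have := contpsi (d := d) hδ x
      fun_prop
    · refine (h.cs.fderiv ℝ).mono' ?_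
      refine (Function.support_subset_iff'.2 ?_).trans subset_closure
      intro y hy
      rw [Function.notMem_support.1 hy]
      simp

lemma norm_vel_le (hd : 1 ≤ d) {δ R : ℝ} (hδ : 0 < δ) (hR : 0 < R) {ρ : Eu d → ℝ} (h : Dens R ρ) (x : Eu d) :
    ‖vel δ ρ x‖ ≤ cS d 1 R := by
  have hd0 : (1:ℝ) ≤ d := by exact_mod_cast hd
  have := norm_int_supp hd (f := fun y => ρ y • kk d δ (x - y)) (A := 1) zero_le_one one_pos hd0 hR x
    (by
      intro y _ hy
      rw [one_mul]
      exact (h.norm_smul_le y _).trans (kk_le_rpow hd hδ hy))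
    (by intro y hy; rw [h.supp y hy]; exact zero_smul ℝ _)
  rwa [one_mul] at this

/-- Lipschitz constant of the regularized velocity gradient -/
noncomputable def cA (d : ℕ) (δ R : ℝ) : ℝ :=
  c1 d * δ⁻¹ ^ (d + 1) * (volume : Measure (Eu d)).real (closedBall 0 R)

lemma cA_nonneg {δ : ℝ} (hδ : 0 < δ) (R : ℝ) : 0 ≤ cA d δ R := by
  have := c1_pos d
  unfold cA; positivity

lemma Aop_lip {δ R : ℝ} (hδ : 0 < δ) {ρ : Eu d → ℝ} (h : Dens R ρ) (x x' : Eu d) :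
    ‖Aop δ ρ x - Aop δ ρ x'‖ ≤ cA d δ R * ‖x - x'‖ := by
  unfold Aop
  rw [← integral_sub (h.int (contDk hδ x)) (h.int (contDk hδ x')),
    ← setIntegral_eq_integral_of_forall_compl_eq_zero (s := closedBall 0 R)]
  · have := norm_setIntegral_le_of_norm_le_const (μ := volume) (s := closedBall (0 : Eu d) R)
      (f := fun y => ρ y • Dk d δ (x - y) - ρ y • Dk d δ (x' - y))
      (C := c1 d * δ⁻¹ ^ (d + 1) * ‖x - x'‖) measure_closedBall_lt_top (by
        intro y _
        have e : ρ y • Dk d δ (x - y) - ρ y • Dk d δ (x' - y) = ρ y • (Dk d δ (x - y) - Dk d δ (x' - y)) := by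
          refine ContinuousLinearMap.ext fun u => ?_
          simp only [_root_.sub_apply, _root_.smul_apply]; module
        rw [e]
        refine (h.norm_smul_le y (Dk d δ (x - y) - Dk d δ (x' - y))).trans ?_
        have a := Dk_sub_le hδ hδ (x - y) (x' - y) (uu_le_inv hδ _) (uu_le_inv hδ _)
        rw [sub_self, abs_zero, add_zero, sub_sub_sub_cancel_right] at a
        have hc1 : (d:ℝ) + d * (d + 4) ≤ c1 d := by
          unfold c1; linarith [show (0:ℝ) ≤ d by positivity]
        have : 0 < δ⁻¹ := inv_pos.2 hδ
        exact a.trans (by gcongr))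
    exact this.trans (le_of_eq (by rw [cA]; ring))
  · intro y hy
    rw [h.supp y hy]
    refine ContinuousLinearMap.ext fun u => ?_
    simp only [_root_.sub_apply, _root_.smul_apply]; simp

lemma psi_int_holder (hd : 1 ≤ d) {δ γ L : ℝ} (hδ : 0 < δ) (h0 : 0 < γ) (h1 : γ < 1)
    {f : Eu d → ℝ} (x : Eu d) (hf : ∀ y, |f y| ≤ L * ‖x - y‖ ^ γ) :
    |∫ y, psi d δ (x - y) * f y| ≤ L * (d * (cG d γ * δ ^ γ)) := by
  have hi := gG_int (d := d) hd h0 h1 hδ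
  have := norm_int_le hd (f := fun y => psi d δ (x - y) * f y) (g := fun z => (L * d) * gG d γ δ z) x
    (hi.1.const_mul _) (by
      intro y hy
      rw [norm_mul, Real.norm_of_nonneg (psi_nonneg _ _), Real.norm_eq_abs]
      have hL : 0 ≤ L := by
        have := (abs_nonneg _).trans (hf y)
        exact nonneg_of_mul_nonneg_left this (by have := norm_pos_iff.2 hy; positivity)
      calc _ ≤ psi d δ (x - y) * (L * ‖x - y‖ ^ γ) := mul_le_mul_of_nonneg_left (hf y) (psi_nonneg _ _)
        _ = L * (psi d δ (x - y) * ‖x - y‖ ^ γ) := by ring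
        _ ≤ L * (d * gG d γ δ (x - y)) := mul_le_mul_of_nonneg_left (psi_rpow_le hd hδ hy) hL
        _ = _ := by ring)
  rw [integral_const_mul, hi.2, Real.norm_eq_abs] at this
  exact this.trans (le_of_eq (by ring))

lemma bb_sub_mass (hd : 1 ≤ d) {δ γ L R : ℝ} (hδ : 0 < δ) (h0 : 0 < γ) (h1 : γ < 1)
    {ρ : Eu d → ℝ} (h : Dens R ρ) (x : Eu d) (hf : ∀ y, |ρ y - ρ x| ≤ L * ‖x - y‖ ^ γ) :
    |bb δ ρ x - mass d * ρ x| ≤ L * (d * (cG d γ * δ ^ γ)) := by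
  have := psi_int_holder hd hδ h0 h1 x hf
  have e : bb δ ρ x - mass d * ρ x = ∫ y, psi d δ (x - y) * (ρ y - ρ x) := by
    rw [← integral_psi hδ, ← integral_sub_left_eq_self (psi d δ) volume x, ← integral_mul_const, bb,
      ← integral_sub (h.int (contpsi hδ x)) (((integrable_psi hd hδ).comp_sub_left x).mul_const _)]
    congr 1; funext y
    simp only [smul_eq_mul]; ring
  rwa [e]

lemma db_wedge (hd : 1 ≤ d) {δ γ Q N N' R : ℝ} (hδ : 0 < δ) (h0 : 0 < γ) (h1 : γ < 1)
    {ρ q : Eu d → ℝ} {Y : Eu d → Eu d} (h : Dens R ρ)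
    (hq : ∀ y u, fderiv ℝ ρ y u = q y * ⟪Y y, u⟫) (hQ : ∀ y, |q y| ≤ Q)
    (hY : ∀ x y, ‖Y x - Y y‖ ≤ N * ‖x - y‖ ^ γ) (hYb : ∀ x, ‖Y x‖ ≤ N') (x u w : Eu d) :
    |fderiv ℝ (bb δ ρ) x u * ⟪Y x, w⟫ - fderiv ℝ (bb δ ρ) x w * ⟪Y x, u⟫|
      ≤ (Q * (2 * N * N')) * (d * (cG d γ * δ ^ γ)) * (‖u‖ * ‖w‖) := by
  have hi : ∀ u, Integrable fun y => fderiv ℝ ρ y u * psi d δ (x - y) := fun u => by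
    apply Continuous.integrable_of_hasCompactSupport
    · have := contD h
      have := contpsi (d := d) hδ x
      fun_prop
    · exact (h.cs.fderiv_apply ℝ u).mul_right
  have e : fderiv ℝ (bb δ ρ) x u * ⟪Y x, w⟫ - fderiv ℝ (bb δ ρ) x w * ⟪Y x, u⟫
      = ∫ y, psi d δ (x - y) * (q y * (⟪Y y - Y x, u⟫ * ⟪Y x, w⟫ - ⟪Y y - Y x, w⟫ * ⟪Y x, u⟫)) := by
    rw [fderiv_bb hδ h, fderiv_bb hδ h, ← integral_mul_const, ← integral_mul_const,
      ← integral_sub ((hi u).mul_const _) ((hi w).mul_const _)]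
    congr 1; funext y
    rw [hq, hq, inner_sub_left, inner_sub_left]; ring
  rw [e]
  have hN' : 0 ≤ N' := (norm_nonneg _).trans (hYb x)
  have hQ0 : 0 ≤ Q := (abs_nonneg _).trans (hQ x)
  refine (psi_int_holder hd hδ h0 h1 (L := (Q * (2 * N * N')) * (‖u‖ * ‖w‖)) x ?_).trans (le_of_eq (by ring))
  intro y
  rw [abs_mul]
  have h3 := hY x y
  have a : ∀ p r : Eu d, |⟪Y y - Y x, p⟫ * ⟪Y x, r⟫| ≤ (N * ‖x - y‖ ^ γ * N') * (‖p‖ * ‖r‖) := by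
    intro p r
    rw [abs_mul]
    calc _ ≤ (‖Y y - Y x‖ * ‖p‖) * (‖Y x‖ * ‖r‖) :=
          mul_le_mul (abs_real_inner_le_norm _ _) (abs_real_inner_le_norm _ _) (abs_nonneg _) (by positivity)
      _ ≤ ((N * ‖x - y‖ ^ γ) * ‖p‖) * (N' * ‖r‖) := by
          rw [norm_sub_rev (Y y)]
          have := hYb x
          have : 0 ≤ N * ‖x - y‖ ^ γ := (norm_nonneg _).trans h3
          gcongr
      _ = _ := by ring
  calc _ ≤ Q * ((N * ‖x - y‖ ^ γ * N') * (‖u‖ * ‖w‖) + (N * ‖x - y‖ ^ γ * N') * (‖w‖ * ‖u‖)) := by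
        refine mul_le_mul (hQ y) ((abs_sub _ _).trans (add_le_add (a u w) (a w u))) (abs_nonneg _) hQ0
    _ = _ := by ring

end AggPatch

namespace AggPatch
open MeasureTheory Metric Set
open scoped RealInnerProductSpace
variable {d : ℕ}

/-- smooth cutoffs -/
structure Cut (ε L : ℝ) (H : ℝ → ℝ) : Prop where
  smooth : ContDiff ℝ 2 H
  nonneg : ∀ s, 0 ≤ H s
  le_one : ∀ s, H s ≤ 1
  one : ∀ s, s ≤ -ε → H s = 1
  zero : ∀ s, 0 ≤ s → H s = 0
  der : ∀ s, |deriv H s| ≤ L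

/-- the weighted gradient field -/
noncomputable def Yf (J Φ : Eu d → ℝ) (x : Eu d) : Eu d := J x • gradient Φ x

lemma inner_grad (Φ : Eu d → ℝ) (x u : Eu d) : ⟪gradient Φ x, u⟫ = fderiv ℝ Φ x u := by
  unfold gradient; exact InnerProductSpace.toDual_symm_apply

lemma norm_grad (Φ : Eu d → ℝ) (x : Eu d) : ‖gradient Φ x‖ = ‖fderiv ℝ Φ x‖ := by
  unfold gradient; exact LinearIsometryEquiv.norm_map _ _

lemma contDiff_grad {Φ : Eu d → ℝ} (h : ContDiff ℝ 2 Φ) : ContDiff ℝ 1 (gradient Φ) := by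
  have : ContDiff ℝ 1 (fderiv ℝ Φ) := h.fderiv_right (by norm_num)
  exact ((InnerProductSpace.toDual ℝ (Eu d)).symm.toContinuousLinearEquiv.contDiff).comp this

lemma contDiff_Yf {J Φ : Eu d → ℝ} (hJ : ContDiff ℝ 1 J) (h : ContDiff ℝ 2 Φ) : ContDiff ℝ 1 (Yf J Φ) :=
  hJ.smul (contDiff_grad h)

lemma inner_Yf (J Φ : Eu d → ℝ) (x u : Eu d) : ⟪Yf J Φ x, u⟫ = J x * fderiv ℝ Φ x u := by
  rw [Yf, inner_smul_left, inner_grad]; rfl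

lemma curl_formula {J Φ : Eu d → ℝ} (hJ : ContDiff ℝ 1 J) (h : ContDiff ℝ 2 Φ) (x u w : Eu d) :
    curl (Yf J Φ) x u w = fderiv ℝ J x u * fderiv ℝ Φ x w - fderiv ℝ J x w * fderiv ℝ Φ x u := by
  have hY : DifferentiableAt ℝ (Yf J Φ) x := (contDiff_Yf hJ h).differentiable one_ne_zero x
  have hJ' : DifferentiableAt ℝ J x := hJ.differentiable one_ne_zero x
  have hΦ : ContDiff ℝ 1 (fderiv ℝ Φ) := h.fderiv_right (by norm_num)
  have hΦ' : DifferentiableAt ℝ (fderiv ℝ Φ) x := hΦ.differentiable one_ne_zero x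
  have key : ∀ u w, ⟪fderiv ℝ (Yf J Φ) x u, w⟫
      = J x * fderiv ℝ (fderiv ℝ Φ) x u w + fderiv ℝ J x u * fderiv ℝ Φ x w := by
    intro u w
    have a : HasFDerivAt (fun x => ⟪Yf J Φ x, w⟫) ((innerSL ℝ w).comp (fderiv ℝ (Yf J Φ) x)) x := by
      have := (innerSL ℝ w).hasFDerivAt.comp x hY.hasFDerivAt
      refine this.congr_of_eventuallyEq (Filter.Eventually.of_forall fun z => ?_)
      exact real_inner_comm _ _
    have b0 : HasFDerivAt (fun x => fderiv ℝ Φ x w) ((fderiv ℝ (fderiv ℝ Φ) x).flip w) x := by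
      have := hΦ'.hasFDerivAt.clm_apply (hasFDerivAt_const w x)
      refine this.congr_fderiv (ContinuousLinearMap.ext fun u => ?_)
      simp
    have b := hJ'.hasFDerivAt.mul b0
    have c := a.unique (b.congr_of_eventuallyEq (Filter.Eventually.of_forall fun z => inner_Yf J Φ z w))
    have := congrArg (fun T : Eu d →L[ℝ] ℝ => T u) c
    simp only [ContinuousLinearMap.comp_apply, _root_.add_apply, _root_.smul_apply, smul_eq_mul,
      ContinuousLinearMap.flip_apply, innerSL_apply_apply] at this
    rw [real_inner_comm, this]; ring
  have sy : IsSymmSndFDerivAt ℝ Φ x := h.contDiffAt.isSymmSndFDerivAt (by simp)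
  rw [curl, key, key, sy.eq u w]; ring

/-- state of the discrete evolution -/
structure St (H : ℝ → ℝ) (γ κ h c lam R e : ℝ) (k : ℕ) (Φ J : Eu d → ℝ) : Prop where
  smΦ : ContDiff ℝ 2 Φ
  smJ : ContDiff ℝ 1 J
  dens : Dens R (H ∘ Φ)
  Jlo : ∀ x, Real.exp (-lam) ≤ J x
  Jhi : ∀ x, J x ≤ Real.exp lam
  Yhi : ∀ x, ‖Yf J Φ x‖ ≤ Real.exp lam
  Yhol : ∀ x y, ‖Yf J Φ x - Yf J Φ y‖ ≤ Real.exp lam * ‖x - y‖ ^ γ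
  Ylo : ∀ x, |Φ x| ≤ c → Real.exp (-lam) ≤ ‖Yf J Φ x‖
  curl : ∀ x u w, |curl (Yf J Φ) x u w| ≤ e * (‖u‖ * ‖w‖)
  Jerr : ∀ x, |J x - (1 + h * (κ * (mass d * H (Φ x)))) ^ k| ≤ e

variable {H : ℝ → ℝ} {γ κ h c lam R e ε L δ : ℝ} {k : ℕ} {Φ J : Eu d → ℝ}

lemma fderiv_rho (hH : Cut ε L H) (hΦ : ContDiff ℝ 2 Φ) (y u : Eu d) :
    fderiv ℝ (H ∘ Φ) y u = deriv H (Φ y) * fderiv ℝ Φ y u := by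
  have a := (hH.smooth.differentiable two_ne_zero (Φ y)).hasDerivAt
  have b := (hΦ.differentiable two_ne_zero y).hasFDerivAt
  rw [(a.comp_hasFDerivAt y b).fderiv]; rfl

lemma Dens.mono {R R' : ℝ} {ρ : Eu d → ℝ} (h : Dens R ρ) (hR : R ≤ R') : Dens R' ρ :=
  ⟨h.smooth, h.nonneg, h.le_one, fun y hy => h.supp y fun hy' => hy (closedBall_subset_closedBall hR hy')⟩

lemma St.Jpos (s : St H γ κ h c lam R e k Φ J) (x : Eu d) : 0 < J x :=
  (Real.exp_pos _).trans_le (s.Jlo x)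

lemma St.rho (s : St H γ κ h c lam R e k Φ J) (hH : Cut ε L H) (y u : Eu d) :
    fderiv ℝ (H ∘ Φ) y u = (deriv H (Φ y) / J y) * ⟪Yf J Φ y, u⟫ := by
  have := s.Jpos y
  rw [fderiv_rho hH s.smΦ, inner_Yf]; field_simp

lemma St.fld (s : St H γ κ h c lam R e k Φ J) (hH : Cut ε L H) :
    Fld (H ∘ Φ) (Yf J Φ) (Real.exp lam) e γ :=
  ⟨contDiff_Yf s.smJ s.smΦ, fun y a b => by rw [s.rho hH, s.rho hH]; ring, s.curl, s.Yhol⟩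

lemma St.grad (s : St H γ κ h c lam R e k Φ J) (x : Eu d) : ‖fderiv ℝ Φ x‖ ≤ Real.exp (2 * lam) := by
  have a := s.Yhi x
  have b := s.Jlo x
  rw [Yf, norm_smul, Real.norm_of_nonneg (s.Jpos x).le, norm_grad] at a
  have c : Real.exp (-lam) * ‖fderiv ℝ Φ x‖ ≤ Real.exp lam :=
    (mul_le_mul_of_nonneg_right b (norm_nonneg _)).trans a
  have e1 : Real.exp lam * Real.exp (-lam) = 1 := by rw [← Real.exp_add]; simp
  calc ‖fderiv ℝ Φ x‖ = Real.exp lam * (Real.exp (-lam) * ‖fderiv ℝ Φ x‖) := by rw [← mul_assoc, e1, one_mul]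
    _ ≤ Real.exp lam * Real.exp lam := by gcongr
    _ = _ := by rw [← Real.exp_add]; ring_nf

lemma St.lip (s : St H γ κ h c lam R e k Φ J) (x y : Eu d) :
    |Φ y - Φ x| ≤ Real.exp (2 * lam) * ‖y - x‖ :=
  convex_univ.norm_image_sub_le_of_norm_fderiv_le (fun x _ => s.smΦ.differentiable two_ne_zero x)
    (fun x _ => s.grad x) (mem_univ x) (mem_univ y)

lemma Aop_unif (hd : 1 ≤ d) {γ c R : ℝ} (h0 : 0 < γ) (h1 : γ < 1) (hc : 0 < c) (hc1 : c ≤ 1) (hR : 1 ≤ R) :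
    ∃ Ca : ℝ, 0 ≤ Ca ∧ ∀ (H : ℝ → ℝ) (ε L κ h lam e : ℝ) (k : ℕ) (Φ J : Eu d → ℝ), Cut ε L H → ε ≤ c / 2 →
      St H γ κ h c lam R e k Φ J → 0 ≤ lam → e ≤ Real.exp (-lam) → 0 ≤ e → ∀ δ, 0 < δ → ∀ x,
      ‖Aop δ (H ∘ Φ) x‖ ≤ Ca * (1 + lam) := by
  obtain ⟨C, hC0, hC⟩ := far (d := d) hd hR
  have hR0 : 0 < R := by linarith
  have hm := mass_nonneg d
  have hG := cG_nonneg (d := d) h0 h1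
  have hS := cS_nonneg (d := d) one_pos hR0
  have hL := cL_nonneg (d := d) hR0
  have hc1' := c1_pos d
  have hlc : 0 ≤ -Real.log (c / 2) := by
    have := Real.log_nonpos (by positivity : 0 ≤ c / 2) (by linarith)
    linarith
  set K1 := (1 + d) * (cL d R * (1 + 2 / γ)) + mass d + (d + 2) * (2 * c1 d * cG d γ + 2 * cS d 1 R) with hK1
  set K2 := C * (3 - Real.log (c / 2)) with hK2
  have hK10 : 0 ≤ K1 := by positivity
  have hK20 : 0 ≤ K2 := mul_nonneg hC0 (by linarith)
  refine ⟨K1 + K2, by positivity, ?_⟩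
  intro H ε L κ h lam e k Φ J hH hε s hlam he he0 δ hδ x
  rcases le_or_gt |Φ x| c with hx | hx
  · have hY := s.Ylo x hx
    have hYp : 0 < ‖Yf J Φ x‖ := (Real.exp_pos _).trans_le hY
    set η := Real.exp (-(2 * lam / γ)) with hη
    have n := near hd (η := η) hδ (Real.exp_pos _) (Real.exp_le_one_iff.2 (by
      have : 0 ≤ 2 * lam / γ := by positivity
      linarith)) hR h0 h1 he0 (Real.exp_pos _).le s.dens (s.fld hH) x (norm_pos_iff.1 hYp)
    rw [hη, Real.log_exp, ← hη] at n
    have e1 : η ^ γ = Real.exp (-(2 * lam)) := by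
      rw [hη, ← Real.exp_mul]; congr 1; field_simp
    have e2 : (2 * Real.exp lam * c1 d * (cG d γ * η ^ γ) + 2 * e * cS d 1 R) / ‖Yf J Φ x‖
        ≤ 2 * c1 d * cG d γ + 2 * cS d 1 R := by
      rw [div_le_iff₀ hYp, e1]
      have : Real.exp lam * Real.exp (-(2 * lam)) = Real.exp (-lam) := by
        rw [← Real.exp_add]; ring_nf
      calc _ = 2 * c1 d * cG d γ * (Real.exp lam * Real.exp (-(2 * lam))) + 2 * cS d 1 R * e := by ring
        _ ≤ 2 * c1 d * cG d γ * ‖Yf J Φ x‖ + 2 * cS d 1 R * ‖Yf J Φ x‖ := by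
          rw [this]
          have : e ≤ ‖Yf J Φ x‖ := he.trans hY
          gcongr
        _ = _ := by ring
    have e3 : (1 + d) * (cL d R * (1 - -(2 * lam / γ))) ≤ ((1 + d) * (cL d R * (1 + 2 / γ))) * (1 + lam) := by
      have : 1 - -(2 * lam / γ) ≤ (1 + 2 / γ) * (1 + lam) := by
        have : 0 ≤ 2 / γ := by positivity
        have e : 2 * lam / γ = 2 / γ * lam := by ring
        rw [e]; nlinarith
      calc _ ≤ (1 + d) * (cL d R * ((1 + 2 / γ) * (1 + lam))) := by gcongr
        _ = _ := by ring
    have e4 : (d + 2) * ((2 * Real.exp lam * c1 d * (cG d γ * η ^ γ) + 2 * e * cS d 1 R) / ‖Yf J Φ x‖)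
        ≤ (d + 2) * (2 * c1 d * cG d γ + 2 * cS d 1 R) := by gcongr
    have p1 : 0 ≤ mass d * lam := by positivity
    have p2 : 0 ≤ (d + 2) * (2 * c1 d * cG d γ + 2 * cS d 1 R) * lam := by positivity
    have p3 : 0 ≤ K2 * (1 + lam) := by positivity
    calc _ ≤ K1 * (1 + lam) := by rw [hK1]; linarith
      _ ≤ _ := by linarith
  · set r := c / 2 * Real.exp (-(2 * lam)) with hr
    have hee : Real.exp (-(2 * lam)) ≤ 1 := Real.exp_le_one_iff.2 (by linarith)
    have hr0 : 0 < r := by positivity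
    have hr1 : r ≤ 1 := by nlinarith [Real.exp_pos (-(2 * lam))]
    have hΦ : ∀ y, ‖x - y‖ < r → |Φ y - Φ x| ≤ c / 2 := by
      intro y hy
      have a := s.lip x y
      rw [norm_sub_rev] at a
      have e1 : Real.exp (2 * lam) * Real.exp (-(2 * lam)) = 1 := by rw [← Real.exp_add]; simp
      calc _ ≤ Real.exp (2 * lam) * r := a.trans (by gcongr)
        _ = c / 2 * (Real.exp (2 * lam) * Real.exp (-(2 * lam))) := by rw [hr]; ring
        _ = _ := by rw [e1, mul_one]
    have hlog : 1 - Real.log r ≤ (3 - Real.log (c / 2)) * (1 + lam) := by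
      rw [hr, Real.log_mul (by positivity) (Real.exp_pos _).ne', Real.log_exp]
      nlinarith
    have fin : ∀ cc : ℝ, 0 ≤ cc → cc ≤ 1 → (∀ y, ‖x - y‖ < r → (H ∘ Φ) y = cc) →
        ‖Aop δ (H ∘ Φ) x‖ ≤ (K1 + K2) * (1 + lam) := by
      intro cc hc0 hc1 hcc
      refine (hC δ r cc (H ∘ Φ) x hδ hr0 hr1 hc0 hc1 s.dens hcc).trans ?_
      have p3 : 0 ≤ K1 * (1 + lam) := by positivity
      calc _ ≤ C * ((3 - Real.log (c / 2)) * (1 + lam)) := mul_le_mul_of_nonneg_left hlog hC0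
        _ = K2 * (1 + lam) := by rw [hK2]; ring
        _ ≤ _ := by linarith
    rcases lt_abs.1 hx with hp | hp
    · refine fin 0 le_rfl zero_le_one fun y hy => hH.zero _ ?_
      have := (abs_le.1 (hΦ y hy)).1
      linarith
    · refine fin 1 zero_le_one le_rfl fun y hy => hH.one _ ?_
      have := (abs_le.1 (hΦ y hy)).2
      linarith

end AggPatch

namespace AggPatch
open MeasureTheory Metric Set
open scoped RealInnerProductSpace
variable {d : ℕ}

lemma near_id {f : Eu d → Eu d} (hf : ContDiff ℝ 2 f) {f' : Eu d → Eu d →L[ℝ] Eu d}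
    (hf' : ∀ x, HasFDerivAt f (f' x) x) {q : ℝ} (hq : q ≤ 1 / 2)
    (h : ∀ x, ‖f' x - ContinuousLinearMap.id ℝ (Eu d)‖ ≤ q) :
    (∃ g : Eu d → Eu d, ContDiff ℝ 2 g ∧ (∀ x, g (f x) = x) ∧ ∀ x, f (g x) = x) ∧
      ∀ x y, ‖f x - f y - (x - y)‖ ≤ q * ‖x - y‖ := by
  have hq0 : 0 ≤ q := (norm_nonneg _).trans (h 0)
  have est : ∀ x y, ‖f x - f y - (x - y)‖ ≤ q * ‖x - y‖ := by
    intro x y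
    have := convex_univ.norm_image_sub_le_of_norm_hasFDerivWithin_le (f := fun x => f x - x)
      (f' := fun x => f' x - ContinuousLinearMap.id ℝ (Eu d)) (C := q) (s := univ)
      (fun x _ => ((hf' x).sub (hasFDerivAt_id x)).hasFDerivWithinAt) (fun x _ => h x) (mem_univ y) (mem_univ x)
    rwa [sub_sub_sub_comm] at this
  refine ⟨?_, est⟩
  have ha : ApproximatesLinearOn f ((ContinuousLinearEquiv.refl ℝ (Eu d) : Eu d ≃L[ℝ] Eu d) : Eu d →L[ℝ] Eu d)
      univ q.toNNReal := fun x _ y _ => by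
    rw [Real.coe_toNNReal q hq0]; exact est x y
  have hc : Subsingleton (Eu d) ∨ q.toNNReal
      < ‖((ContinuousLinearEquiv.refl ℝ (Eu d)).symm : Eu d →L[ℝ] Eu d)‖₊⁻¹ := by
    rcases subsingleton_or_nontrivial (Eu d) with hs | hs
    · exact Or.inl hs
    · right
      have : ‖((ContinuousLinearEquiv.refl ℝ (Eu d)).symm : Eu d →L[ℝ] Eu d)‖₊ = 1 := by
        apply NNReal.eq
        exact ContinuousLinearMap.norm_id
      rw [this, inv_one, ← NNReal.coe_lt_coe, Real.coe_toNNReal q hq0, NNReal.coe_one]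
      linarith
  set T := ha.toHomeomorph f hc with hT
  have hTf : ∀ x, T x = f x := fun x => rfl
  have inj : ∀ x, Function.Injective (f' x : Eu d →ₗ[ℝ] Eu d) := by
    intro x
    refine (injective_iff_map_eq_zero _).2 fun w hw => ?_
    have hw' : f' x w = 0 := hw
    have a := (f' x - ContinuousLinearMap.id ℝ (Eu d)).le_of_opNorm_le (h x) w
    rw [_root_.sub_apply, hw', zero_sub, norm_neg, ContinuousLinearMap.id_apply] at a
    by_contra hne
    have := norm_pos_iff.2 hne
    nlinarith
  have cd := Homeomorph.contDiff_symm (n := 2) T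
    (f₀' := fun x => (LinearEquiv.ofInjectiveEndo (f' x : Eu d →ₗ[ℝ] Eu d) (inj x)).toContinuousLinearEquiv)
    (fun x => by
      refine HasFDerivAt.congr_fderiv (hf' x) ?_
      ext w; rfl) hf
  exact ⟨T.symm, cd, fun x => T.symm_apply_apply x, fun x => T.apply_symm_apply x⟩

lemma exp_q {q : ℝ} (h0 : 0 ≤ q) (h1 : q ≤ 1 / 2) : 1 ≤ (1 - q) * Real.exp (2 * q) := by
  have := Real.add_one_le_exp (2 * q)
  nlinarith

lemma exp_q' {q x y : ℝ} (h0 : 0 ≤ q) (h1 : q ≤ 1 / 2) (hx : 0 ≤ x) (h : (1 - q) * x ≤ y) :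
    x ≤ Real.exp (2 * q) * y := by
  have a := exp_q h0 h1
  have hp := Real.exp_pos (2 * q)
  calc x ≤ ((1 - q) * Real.exp (2 * q)) * x := le_mul_of_one_le_left hx a
    _ = Real.exp (2 * q) * ((1 - q) * x) := by ring
    _ ≤ _ := by gcongr

end AggPatch

namespace AggPatch
open MeasureTheory Metric Set
open scoped RealInnerProductSpace
variable {d : ℕ}

lemma holder_step {B B' : Eu d →L[ℝ] Eu d} {b b' h A E r : ℝ} {Y Y' Z Z' : Eu d} (hh : 0 < h)
    (hA0 : 0 ≤ A) (hE : 0 ≤ E) (hr : 0 ≤ r)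
    (hZ : Z + h • B Z = (1 + h * b) • Y) (hZ' : Z' + h • B' Z' = (1 + h * b') • Y')
    (hB : ‖B‖ ≤ A) (hB' : ‖B'‖ ≤ A) (hb' : |b'| ≤ A)
    (hW : ‖(b • Y - B Y) - (b' • Y' - B' Y')‖ ≤ 2 * A * E * r)
    (hY : ‖Y - Y'‖ ≤ E * r) (hBB : h * ‖B - B'‖ ≤ r) (hY' : ‖Y'‖ ≤ E) (hZ5 : ‖Z'‖ ≤ 5 * E) :
    (1 - h * A) * ‖Z - Z'‖ ≤ (1 + 9 * (h * A)) * E * r := by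
  have e1 : Z' - Y' = h • (b' • Y' - B' Z') := by
    have : Z' = (1 + h * b') • Y' - h • B' Z' := eq_sub_of_add_eq hZ'
    nth_rewrite 1 [this]
    module
  have n1 : ‖Z' - Y'‖ ≤ h * (6 * A * E) := by
    rw [e1, norm_smul, Real.norm_of_nonneg hh.le]
    gcongr
    calc _ ≤ ‖b' • Y'‖ + ‖B' Z'‖ := norm_sub_le _ _
      _ ≤ A * E + A * (5 * E) := by
        refine add_le_add ?_ ?_
        · rw [norm_smul, Real.norm_eq_abs]; gcongr
        · exact (B'.le_opNorm _).trans (mul_le_mul hB' hZ5 (norm_nonneg _) hA0)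
      _ = _ := by ring
  have e2 : Z - Z' = (Y - Y') + h • ((b • Y - B Y) - (b' • Y' - B' Y'))
      - h • B ((Z - Z') - (Y - Y')) - h • (B - B') (Z' - Y') := by
    have a : Z = (1 + h * b) • Y - h • B Z := eq_sub_of_add_eq hZ
    have a' : Z' = (1 + h * b') • Y' - h • B' Z' := eq_sub_of_add_eq hZ'
    have : Z - Z' = ((1 + h * b) • Y - h • B Z) - ((1 + h * b') • Y' - h • B' Z') := by rw [← a, ← a']
    rw [this]
    simp only [map_sub, map_add, map_smul, _root_.sub_apply]
    have c : B (((1 + h * b) • Y - h • B Z) - ((1 + h * b') • Y' - h • B' Z')) = B (Z - Z') := by rw [← a, ← a']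
    simp only [map_sub, map_smul] at c
    rw [c]; module
  have n2 : ‖Z - Z'‖ ≤ E * r + h * (2 * A * E * r) + h * (A * (‖Z - Z'‖ + E * r)) + r * (h * (6 * A * E)) := by
    have m1 : ‖h • ((b • Y - B Y) - (b' • Y' - B' Y'))‖ ≤ h * (2 * A * E * r) := by
      rw [norm_smul, Real.norm_of_nonneg hh.le]; gcongr
    have m2 : ‖h • B ((Z - Z') - (Y - Y'))‖ ≤ h * (A * (‖Z - Z'‖ + E * r)) := by
      rw [norm_smul, Real.norm_of_nonneg hh.le]
      gcongr
      refine (B.le_opNorm _).trans (mul_le_mul hB ((norm_sub_le _ _).trans ?_) (norm_nonneg _) hA0)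
      gcongr
    have m3 : ‖h • (B - B') (Z' - Y')‖ ≤ r * (h * (6 * A * E)) := by
      rw [norm_smul, Real.norm_of_nonneg hh.le]
      calc _ ≤ h * (‖B - B'‖ * ‖Z' - Y'‖) := by gcongr; exact (B - B').le_opNorm _
        _ = (h * ‖B - B'‖) * ‖Z' - Y'‖ := by ring
        _ ≤ _ := by gcongr
    nth_rewrite 1 [e2]
    refine (norm_sub_le _ _).trans (add_le_add ((norm_sub_le _ _).trans (add_le_add
      ((norm_add_le _ _).trans (add_le_add hY m1)) m2)) m3)
  have : 0 ≤ h * A * E * r := by positivity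
  nlinarith

lemma exp_five {q : ℝ} (h1 : q ≤ 1 / 2) : Real.exp (3 * q) ≤ 5 := by
  have h := Real.exp_one_lt_d9
  have : Real.exp (3 * q) ≤ Real.exp (3 / 2) := Real.exp_le_exp.2 (by linarith)
  have e : Real.exp (3 / 2) ^ 2 = Real.exp 1 ^ 3 := by
    rw [← Real.exp_nat_mul, ← Real.exp_nat_mul]; norm_num
  have p : Real.exp 1 ^ 3 ≤ 25 := by
    calc Real.exp 1 ^ 3 ≤ 2.8 ^ 3 := by gcongr; linarith
      _ ≤ 25 := by norm_num
  have : Real.exp (3 / 2) ≤ 5 := by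
    by_contra hc
    push Not at hc
    nlinarith
  linarith

variable {H : ℝ → ℝ} {γ κ h c lam R e ε L δ : ℝ} {k : ℕ} {Φ J : Eu d → ℝ}

lemma rho_holder (s : St H γ κ h c lam R e k Φ J) (hH : Cut ε L H) (hL : 0 ≤ L) (h0 : 0 < γ) (h1 : γ < 1) (x y : Eu d) :
    |(H ∘ Φ) y - (H ∘ Φ) x| ≤ (1 + L * Real.exp (2 * lam)) * ‖x - y‖ ^ γ := by
  have hp : 0 ≤ L * Real.exp (2 * lam) := by positivity
  rcases le_or_gt ‖x - y‖ 1 with hr | hr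
  · have a : ‖H (Φ y) - H (Φ x)‖ ≤ L * ‖Φ y - Φ x‖ :=
      convex_univ.norm_image_sub_le_of_norm_deriv_le
        (fun x _ => hH.smooth.differentiable two_ne_zero x) (fun x _ => hH.der x) (mem_univ _) (mem_univ _)
    have b := s.lip x y
    have c : ‖x - y‖ ≤ ‖x - y‖ ^ γ := by
      calc ‖x - y‖ = ‖x - y‖ ^ (1:ℝ) := (Real.rpow_one _).symm
        _ ≤ _ := Real.rpow_le_rpow_of_exponent_ge_of_imp (norm_nonneg _) hr h1.le (by intro _ h; linarith)
    rw [norm_sub_rev] at b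
    calc _ ≤ L * (Real.exp (2 * lam) * ‖x - y‖) := a.trans (mul_le_mul_of_nonneg_left b hL)
      _ = L * Real.exp (2 * lam) * ‖x - y‖ := by ring
      _ ≤ (1 + L * Real.exp (2 * lam)) * ‖x - y‖ := by nlinarith [norm_nonneg (x - y)]
      _ ≤ _ := by gcongr
  · have a1 := hH.nonneg (Φ x)
    have a2 := hH.nonneg (Φ y)
    have a3 := hH.le_one (Φ x)
    have a4 := hH.le_one (Φ y)
    have : |(H ∘ Φ) y - (H ∘ Φ) x| ≤ 1 := abs_le.2 ⟨by simp; linarith, by simp; linarith⟩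
    have : 1 ≤ ‖x - y‖ ^ γ := Real.one_le_rpow hr.le h0.le
    nlinarith

end AggPatch

namespace AggPatch
open MeasureTheory Metric Set
open scoped RealInnerProductSpace
variable {d : ℕ}
variable {H : ℝ → ℝ} {γ κ h c lam R e ε L δ : ℝ} {k : ℕ} {Φ J : Eu d → ℝ}

/-- Euler step map -/
noncomputable def Fs (H : ℝ → ℝ) (κ h δ : ℝ) (Φ : Eu d → ℝ) (x : Eu d) : Eu d :=
  x + h • (κ • vel δ (H ∘ Φ) x)

/-- hypotheses for a step -/
structure StepHyp (d : ℕ) (γ κ h lam R e L δ a A lam' sig : ℝ) (k : ℕ) : Prop where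
  hδ : 0 < δ
  hh : 0 < h
  hR : 0 < R
  hL : 0 ≤ L
  hlam : 0 ≤ lam
  he0 : 0 ≤ e
  he1 : e ≤ 1
  ha : 0 ≤ a
  hA : |κ| * (c2 d γ + a + mass d + c3 d γ R) ≤ A
  hq : h * A ≤ 1 / 2
  hC : h * (|κ| * (cA d δ R + 2 * a)) ≤ 1
  hl : lam + 13 * (h * A) ≤ lam'
  hs1 : |κ| * (((L * Real.exp lam) * (2 * Real.exp lam * Real.exp lam)) * (d * (cG d γ * δ ^ γ))) ≤ sig
  hs2 : (1 + h * (|κ| * mass d)) ^ k * (|κ| * ((1 + L * Real.exp (2 * lam)) * (d * (cG d γ * δ ^ γ)))) ≤ sig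

set_option maxHeartbeats 3200000 in
lemma one_step (hd : 1 ≤ d) (h0 : 0 < γ) (h1 : γ < 1) (hH : Cut ε L H)
    (s : St H γ κ h c lam R e k Φ J) {a A lam' sig : ℝ}
    (p : StepHyp d γ κ h lam R e L δ a A lam' sig k)
    (haA : ∀ η, δ ≤ η → ∀ x, ‖Aop η (H ∘ Φ) x‖ ≤ a) :
    ∃ Φ' J' : Eu d → ℝ, Function.Bijective (Fs H κ h δ Φ) ∧ (∀ x, Φ' (Fs H κ h δ Φ x) = Φ x) ∧
      (∀ x y, ‖Fs H κ h δ Φ x - Fs H κ h δ Φ y‖ ≤ Real.exp (lam' - lam) * ‖x - y‖) ∧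
      (∀ x y, ‖x - y‖ ≤ Real.exp (lam' - lam) * ‖Fs H κ h δ Φ x - Fs H κ h δ Φ y‖) ∧
      St H γ κ h c lam' (R + h * (|κ| * cS d 1 R)) ((e + h * sig) * Real.exp (lam' - lam)) (k + 1) Φ' J' := by
  obtain ⟨hδ, hh, hR, hL, hlam, he0, he1, ha, hA, hq, hC, hl, hs1, hs2⟩ := p
  set ρ := H ∘ Φ with hρ
  set F := Fs H κ h δ Φ with hF
  have hc2 := c2_nonneg (d := d) h0 h1
  have hm := mass_nonneg d
  have hc3 : 0 ≤ c3 d γ R := by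
    have := cS_nonneg (d := d) (by linarith : 0 < 1 - γ) hR
    unfold c3; positivity
  have hG := cG_nonneg (d := d) h0 h1
  have hκ := abs_nonneg κ
  have hA0 : 0 ≤ A := le_trans (by positivity) hA
  have hAa : |κ| * a ≤ A := (mul_le_mul_of_nonneg_left (by linarith) hκ).trans hA
  have hAm : |κ| * mass d ≤ A := (mul_le_mul_of_nonneg_left (by linarith) hκ).trans hA
  have hAc : |κ| * (c2 d γ + a) ≤ A := (mul_le_mul_of_nonneg_left (by linarith) hκ).trans hA
  have hA3 : |κ| * c3 d γ R ≤ A := (mul_le_mul_of_nonneg_left (by linarith) hκ).trans hA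
  set q := h * A with hqdef
  have hq0 : 0 ≤ q := by positivity
  have hρ2 : ContDiff ℝ 2 ρ := hH.smooth.comp s.smΦ
  have hρ1 : Dens R ρ := s.dens
  set B : Eu d → Eu d →L[ℝ] Eu d := fun x => κ • Aop δ ρ x with hB
  set b : Eu d → ℝ := fun x => κ * bb δ ρ x with hb
  have hBn : ∀ x, ‖B x‖ ≤ A := fun x => by
    rw [hB]
    refine le_trans ?_ hAa
    rw [norm_smul, Real.norm_eq_abs]
    exact mul_le_mul_of_nonneg_left (haA δ le_rfl x) hκ
  have hbn' : ∀ x, |b x| ≤ |κ| * mass d := fun x => by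
    have := bb_bound hd hδ hρ1 x
    rw [hb, abs_mul, abs_of_nonneg this.1]
    exact mul_le_mul_of_nonneg_left this.2 hκ
  have hbn : ∀ x, |b x| ≤ A := fun x => (hbn' x).trans hAm
  have hhb : ∀ x, |h * b x| ≤ q := fun x => by
    rw [abs_mul, abs_of_pos hh]; exact mul_le_mul_of_nonneg_left (hbn x) hh.le
  set D : Eu d → Eu d →L[ℝ] Eu d := fun x => ContinuousLinearMap.id ℝ (Eu d) + h • B x with hD
  have hFd : ∀ x, HasFDerivAt F (D x) x := fun x =>
    (hasFDerivAt_id x).add (((fderiv_vel hδ hρ1 x).const_smul κ).const_smul h)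
  have hF2 : ContDiff ℝ 2 F :=
    contDiff_id.add (((contDiff_vel (n := 2) hδ hρ1 hρ2).const_smul κ).const_smul h)
  have hDid : ∀ x, ‖D x - ContinuousLinearMap.id ℝ (Eu d)‖ ≤ q := fun x => by
    rw [hD, add_sub_cancel_left, norm_smul, Real.norm_of_nonneg hh.le]
    exact mul_le_mul_of_nonneg_left (hBn x) hh.le
  obtain ⟨⟨g, hg2, hgF, hFg⟩, est⟩ := near_id hF2 hFd hq hDid
  have lip : ∀ x y, ‖F x - F y‖ ≤ (1 + q) * ‖x - y‖ := fun x y => by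
    have := norm_add_le (F x - F y - (x - y)) (x - y)
    rw [sub_add_cancel] at this
    linarith [est x y]
  have low : ∀ x y, (1 - q) * ‖x - y‖ ≤ ‖F x - F y‖ := fun x y => by
    have := norm_sub_le (F x - F y) (F x - F y - (x - y))
    rw [sub_sub_cancel] at this
    linarith [est x y]
  have hl2 : Real.exp (2 * q) ≤ Real.exp (lam' - lam) := Real.exp_le_exp.2 (by linarith)
  have hl1 : 1 + q ≤ Real.exp (lam' - lam) := by
    have := Real.add_one_le_exp (lam' - lam)
    linarith
  set Φ' : Eu d → ℝ := fun z => Φ (g z) with hΦ'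
  set J' : Eu d → ℝ := fun z => J (g z) * (1 + h * b (g z)) with hJ'
  have hb1 : ContDiff ℝ 1 b := contDiff_const.mul (contDiff_bb (n := 1) hδ hρ1 hρ1.smooth)
  have hΦ'2 : ContDiff ℝ 2 Φ' := s.smΦ.comp hg2
  have hJb : ContDiff ℝ 1 fun x => J x * (1 + h * b x) := s.smJ.mul (contDiff_const.add (contDiff_const.mul hb1))
  have hJ'1 : ContDiff ℝ 1 J' := hJb.comp (hg2.of_le (by norm_num))
  have hΦF : ∀ x, Φ' (F x) = Φ x := fun x => by simp only [hΦ', hgF]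
  have hJF : ∀ x, J' (F x) = J x * (1 + h * b x) := fun x => by simp only [hJ', hgF]
  have surj : ∀ z, ∃ x, F x = z := fun z => ⟨g z, hFg z⟩
  -- derivative identities
  have dΦ : ∀ x u, fderiv ℝ Φ' (F x) (D x u) = fderiv ℝ Φ x u := by
    intro x u
    have c1 := ((hΦ'2.differentiable two_ne_zero (F x)).hasFDerivAt).comp x (hFd x)
    have c2 : HasFDerivAt (Φ' ∘ F) (fderiv ℝ Φ x) x := by
      have : Φ' ∘ F = Φ := funext hΦF
      rw [this]
      exact (s.smΦ.differentiable two_ne_zero x).hasFDerivAt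
    exact congrArg (fun T : Eu d →L[ℝ] ℝ => T u) (c1.unique c2)
  have dJ : ∀ x u, fderiv ℝ J' (F x) (D x u)
      = (1 + h * b x) * fderiv ℝ J x u + h * J x * (κ * fderiv ℝ (bb δ ρ) x u) := by
    intro x u
    have c1 := ((hJ'1.differentiable one_ne_zero (F x)).hasFDerivAt).comp x (hFd x)
    have b1 : HasFDerivAt (bb δ ρ) (fderiv ℝ (bb δ ρ) x) x :=
      ((contDiff_bb (n := 1) hδ hρ1 hρ1.smooth).differentiable one_ne_zero x).hasFDerivAt
    have c2 := (s.smJ.differentiable one_ne_zero x).hasFDerivAt.mul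
        (((b1.const_mul κ).const_mul h).const_add 1)
    have cE : J' ∘ F = fun x => J x * (1 + h * (κ * bb δ ρ x)) := funext hJF
    rw [cE] at c1
    have := congrArg (fun T : Eu d →L[ℝ] ℝ => T u) (c1.unique c2)
    simp only [ContinuousLinearMap.comp_apply, _root_.add_apply, _root_.smul_apply, smul_eq_mul] at this
    rw [this, hb]; ring
  have Dsym : ∀ x u w, ⟪D x u, w⟫ = ⟪u, D x w⟫ := by
    intro x u w
    simp only [hD, hB, _root_.add_apply, _root_.smul_apply, ContinuousLinearMap.id_apply, inner_add_left,
      inner_add_right, inner_smul_left, inner_smul_right, conj_trivial]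
    rw [Aop_symm hδ hρ1]
  have Zeq : ∀ x, Yf J' Φ' (F x) + h • B x (Yf J' Φ' (F x)) = (1 + h * b x) • Yf J Φ x := by
    intro x
    have : Yf J' Φ' (F x) + h • B x (Yf J' Φ' (F x)) = D x (Yf J' Φ' (F x)) := rfl
    rw [this]
    refine ext_inner_right ℝ fun w => ?_
    rw [Dsym, inner_Yf, dΦ, hJF, inner_smul_left, inner_Yf]
    simp only [conj_trivial]; ring
  have Zn : ∀ x, ‖Yf J' Φ' (F x)‖ ≤ Real.exp (3 * q) * ‖Yf J Φ x‖ ∧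
      ‖Yf J Φ x‖ ≤ Real.exp (3 * q) * ‖Yf J' Φ' (F x)‖ := by
    intro x
    have z := Zeq x
    set Z := Yf J' Φ' (F x)
    set Y := Yf J Φ x
    have n1 : ‖h • B x Z‖ ≤ q * ‖Z‖ := by
      rw [norm_smul, Real.norm_of_nonneg hh.le, hqdef, mul_assoc]
      exact mul_le_mul_of_nonneg_left ((B x).le_of_opNorm_le (hBn x) Z) hh.le
    have hb1 := abs_le.1 (hhb x)
    have n2 : ‖(1 + h * b x) • Y‖ = (1 + h * b x) * ‖Y‖ := by
      rw [norm_smul, Real.norm_of_nonneg (by linarith)]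
    have n3 : (1 + h * b x) * ‖Y‖ ≤ (1 + q) * ‖Y‖ := by gcongr; linarith
    have n4 : (1 - q) * ‖Y‖ ≤ (1 + h * b x) * ‖Y‖ := by gcongr; linarith
    have m1 := norm_sub_le (Z + h • B x Z) (h • B x Z)
    have m2 := norm_add_le Z (h • B x Z)
    rw [add_sub_cancel_right, z] at m1
    rw [z] at m2
    have q1 : 1 + q ≤ Real.exp q := by linarith [Real.add_one_le_exp q]
    have e3 : Real.exp (3 * q) = Real.exp (2 * q) * Real.exp q := by rw [← Real.exp_add]; ring_nf
    rw [e3, mul_assoc, mul_assoc]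
    constructor
    · exact exp_q' hq0 hq (norm_nonneg _) (le_trans (by linarith) (mul_le_mul_of_nonneg_right q1 (norm_nonneg _)))
    · exact exp_q' hq0 hq (norm_nonneg _) (le_trans (by linarith) (mul_le_mul_of_nonneg_right q1 (norm_nonneg _)))
  have E3 : Real.exp (3 * q) ≤ Real.exp (lam' - lam) := Real.exp_le_exp.2 (by linarith)
  have El : Real.exp (lam' - lam) * Real.exp lam = Real.exp lam' := by rw [← Real.exp_add]; ring_nf
  have El' : Real.exp (lam' - lam) * Real.exp (-lam') = Real.exp (-lam) := by rw [← Real.exp_add]; ring_nf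
  have inv_le : ∀ u : ℝ, Real.exp (-lam) ≤ Real.exp (lam' - lam) * u → Real.exp (-lam') ≤ u := by
    intro u hu
    rw [← El'] at hu
    exact le_of_mul_le_mul_left hu (Real.exp_pos _)
  have he' : 0 ≤ sig := le_trans (by positivity) hs1
  refine ⟨Φ', J', ⟨fun x y hxy => by rw [← hgF x, hxy, hgF], surj⟩, hΦF, ?_, ?_, ?_⟩
  · intro x y
    exact (lip x y).trans (mul_le_mul_of_nonneg_right hl1 (norm_nonneg _))
  · intro x y
    exact (exp_q' hq0 hq (norm_nonneg _) (low x y)).trans (mul_le_mul_of_nonneg_right hl2 (norm_nonneg _))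
  refine ⟨hΦ'2, hJ'1, ?_, ?_, ?_, ?_, ?_, ?_, ?_, ?_⟩
  · -- density
    refine ⟨(hH.smooth.comp hΦ'2).of_le (by norm_num), fun y => hH.nonneg _, fun y => hH.le_one _, ?_⟩
    intro y hy
    obtain ⟨x, rfl⟩ := surj y
    have e : (H ∘ Φ') (F x) = ρ x := by simp only [Function.comp, hΦF, hρ]
    rw [e]
    apply hρ1.supp
    intro hx
    apply hy
    rw [mem_closedBall_zero_iff] at hx ⊢
    have : ‖F x‖ ≤ ‖x‖ + ‖h • (κ • vel δ ρ x)‖ := norm_add_le _ _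
    rw [norm_smul, norm_smul, Real.norm_of_nonneg hh.le, Real.norm_eq_abs] at this
    refine this.trans (add_le_add hx ?_)
    have := norm_vel_le hd hδ hR hρ1 x
    gcongr
  · intro z
    obtain ⟨x, rfl⟩ := surj z
    apply inv_le
    rw [hJF]
    have hb1 := abs_le.1 (hhb x)
    have := s.Jlo x
    refine this.trans ((exp_q' hq0 hq (s.Jpos x).le ?_).trans
      (mul_le_mul_of_nonneg_right hl2 (mul_nonneg (s.Jpos x).le (by linarith))))
    rw [mul_comm]
    exact mul_le_mul_of_nonneg_left (by linarith) (s.Jpos x).le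
  · intro z
    obtain ⟨x, rfl⟩ := surj z
    rw [hJF, ← El, mul_comm]
    have hb1 := abs_le.1 (hhb x)
    exact mul_le_mul (by linarith) (s.Jhi x) (s.Jpos x).le (Real.exp_pos _).le
  · intro z
    obtain ⟨x, rfl⟩ := surj z
    rw [← El]
    exact (Zn x).1.trans (mul_le_mul E3 (s.Yhi x) (norm_nonneg _) (Real.exp_pos _).le)
  · -- Hoelder
    intro z z'
    obtain ⟨x, rfl⟩ := surj z
    obtain ⟨x', rfl⟩ := surj z'
    have hfld := s.fld hH
    have hcomm := comm_holder hd hδ h0 h1 (Real.exp_pos lam).le hρ1 hfld.smooth.continuous s.Yhol haA x x'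
    have hrem := rem_holder hd hδ h0 h1 he0 hR hρ1 hfld x x'
    have hW : ‖(b x • Yf J Φ x - B x (Yf J Φ x)) - (b x' • Yf J Φ x' - B x' (Yf J Φ x'))‖
        ≤ 2 * A * Real.exp lam * ‖x - x'‖ ^ γ := by
      have i1 := comm_add_rem hδ hρ1 hfld.smooth.continuous x
      have i2 := comm_add_rem hδ hρ1 hfld.smooth.continuous x'
      have : (b x • Yf J Φ x - B x (Yf J Φ x)) - (b x' • Yf J Φ x' - B x' (Yf J Φ x'))
          = -κ • ((comm δ ρ (Yf J Φ) x - comm δ ρ (Yf J Φ) x') + (rem δ ρ (Yf J Φ) x - rem δ ρ (Yf J Φ) x')) := by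
        have j : (comm δ ρ (Yf J Φ) x - comm δ ρ (Yf J Φ) x') + (rem δ ρ (Yf J Φ) x - rem δ ρ (Yf J Φ) x')
          = (comm δ ρ (Yf J Φ) x + rem δ ρ (Yf J Φ) x) - (comm δ ρ (Yf J Φ) x' + rem δ ρ (Yf J Φ) x') := by abel
        rw [j, i1, i2]
        simp only [hb, hB, _root_.smul_apply]
        module
      rw [this, norm_smul, norm_neg, Real.norm_eq_abs]
      have hE1 : 1 ≤ Real.exp lam := Real.one_le_exp hlam
      have hrp : 0 ≤ ‖x - x'‖ ^ γ := by positivity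
      calc _ ≤ |κ| * ((c2 d γ + a) * Real.exp lam * ‖x - x'‖ ^ γ + c3 d γ R * e * ‖x - x'‖ ^ γ) := by
            gcongr
            exact (norm_add_le _ _).trans (add_le_add hcomm hrem)
        _ = (|κ| * (c2 d γ + a)) * Real.exp lam * ‖x - x'‖ ^ γ + (|κ| * c3 d γ R) * e * ‖x - x'‖ ^ γ := by ring
        _ ≤ A * Real.exp lam * ‖x - x'‖ ^ γ + A * Real.exp lam * ‖x - x'‖ ^ γ := by
            gcongr
            linarith
        _ = _ := by ring
    have hBB : h * ‖B x - B x'‖ ≤ ‖x - x'‖ ^ γ := by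
      have nn : ‖B x - B x'‖ ≤ |κ| * ‖Aop δ ρ x - Aop δ ρ x'‖ := by
        rw [hB, ← Real.norm_eq_abs, ← norm_smul]
        apply le_of_eq; congr 1
        refine ContinuousLinearMap.ext fun u => ?_
        simp only [_root_.sub_apply, _root_.smul_apply]; module
      have hcA := cA_nonneg (d := d) hδ R
      have mm : ‖Aop δ ρ x - Aop δ ρ x'‖ ≤ (cA d δ R + 2 * a) * ‖x - x'‖ ^ γ := by
        rcases le_or_gt ‖x - x'‖ 1 with hr | hr
        · have c : ‖x - x'‖ ≤ ‖x - x'‖ ^ γ := by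
            calc ‖x - x'‖ = ‖x - x'‖ ^ (1:ℝ) := (Real.rpow_one _).symm
              _ ≤ _ := Real.rpow_le_rpow_of_exponent_ge_of_imp (norm_nonneg _) hr h1.le (by intro _ h; linarith)
          calc _ ≤ cA d δ R * ‖x - x'‖ := Aop_lip hδ hρ1 x x'
            _ ≤ (cA d δ R + 2 * a) * ‖x - x'‖ ^ γ := by gcongr; linarith
        · have : 1 ≤ ‖x - x'‖ ^ γ := Real.one_le_rpow hr.le h0.le
          have t := norm_sub_le (Aop δ ρ x) (Aop δ ρ x')
          have t1 := haA δ le_rfl x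
          have t2 := haA δ le_rfl x'
          calc ‖Aop δ ρ x - Aop δ ρ x'‖ ≤ 2 * a := by linarith
            _ ≤ (cA d δ R + 2 * a) * 1 := by linarith
            _ ≤ (cA d δ R + 2 * a) * ‖x - x'‖ ^ γ := mul_le_mul_of_nonneg_left this (by positivity)
      calc _ ≤ h * (|κ| * ((cA d δ R + 2 * a) * ‖x - x'‖ ^ γ)) := by
            gcongr; exact nn.trans (mul_le_mul_of_nonneg_left mm hκ)
        _ = (h * (|κ| * (cA d δ R + 2 * a))) * ‖x - x'‖ ^ γ := by ring
        _ ≤ 1 * ‖x - x'‖ ^ γ := by gcongr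
        _ = _ := one_mul _
    have hZ5 : ‖Yf J' Φ' (F x')‖ ≤ 5 * Real.exp lam :=
      (Zn x').1.trans (mul_le_mul (exp_five hq) (s.Yhi x') (norm_nonneg _) (by norm_num))
    have st := holder_step hh hA0 (Real.exp_pos lam).le (by positivity) (Zeq x) (Zeq x') (hBn x) (hBn x')
      (hbn x') hW (s.Yhol x x') hBB (s.Yhi x') hZ5
    have st' := exp_q' hq0 hq (norm_nonneg _) st
    have rr : ‖x - x'‖ ^ γ ≤ Real.exp (2 * q) * ‖F x - F x'‖ ^ γ := by
      have := exp_q' hq0 hq (norm_nonneg _) (low x x')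
      calc _ ≤ (Real.exp (2 * q) * ‖F x - F x'‖) ^ γ := Real.rpow_le_rpow (norm_nonneg _) this h0.le
        _ = Real.exp (2 * q) ^ γ * ‖F x - F x'‖ ^ γ := Real.mul_rpow (Real.exp_pos _).le (norm_nonneg _)
        _ ≤ _ := by
          gcongr
          calc _ ≤ Real.exp (2 * q) ^ (1:ℝ) :=
                Real.rpow_le_rpow_of_exponent_le (Real.one_le_exp (by linarith)) h1.le
            _ = _ := Real.rpow_one _
    have q9 : 1 + 9 * q ≤ Real.exp (9 * q) := by linarith [Real.add_one_le_exp (9 * q)]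
    calc _ ≤ Real.exp (2 * q) * ((1 + 9 * q) * Real.exp lam * ‖x - x'‖ ^ γ) := st'
      _ ≤ Real.exp (2 * q) * (Real.exp (9 * q) * Real.exp lam * (Real.exp (2 * q) * ‖F x - F x'‖ ^ γ)) := by
          gcongr
      _ = Real.exp (lam + 13 * q) * ‖F x - F x'‖ ^ γ := by
          have : Real.exp (lam + 13 * q) = Real.exp (2 * q) * (Real.exp (9 * q) * Real.exp lam * Real.exp (2 * q)) := by
            simp only [← Real.exp_add]; ring_nf
          rw [this]; ring
      _ ≤ _ := by gcongr
  · intro z hz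
    obtain ⟨x, rfl⟩ := surj z
    rw [hΦF] at hz
    apply inv_le
    exact (s.Ylo x hz).trans ((Zn x).2.trans (mul_le_mul_of_nonneg_right E3 (norm_nonneg _)))
  · -- curl
    intro z u' w'
    obtain ⟨x, rfl⟩ := surj z
    have Ds : ∀ u', ∃ u, D x u = u' ∧ ‖u‖ ≤ Real.exp (2 * q) * ‖u'‖ := by
      intro u'
      have hlow : ∀ u, (1 - q) * ‖u‖ ≤ ‖D x u‖ := by
        intro u
        have a := (D x - ContinuousLinearMap.id ℝ (Eu d)).le_of_opNorm_le (hDid x) u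
        rw [_root_.sub_apply, ContinuousLinearMap.id_apply] at a
        have := norm_sub_le (D x u) (D x u - u)
        rw [sub_sub_cancel] at this
        linarith
      have inj : Function.Injective (D x : Eu d →ₗ[ℝ] Eu d) := by
        refine (injective_iff_map_eq_zero _).2 fun w hw => ?_
        have hw' : D x w = 0 := hw
        have a := hlow w
        rw [hw', norm_zero] at a
        by_contra hne
        have := norm_pos_iff.2 hne
        nlinarith
      obtain ⟨u, hu⟩ := LinearMap.surjective_of_injective inj u'
      have hu' : D x u = u' := hu
      exact ⟨u, hu', exp_q' hq0 hq (norm_nonneg _) (by rw [← hu']; exact hlow u)⟩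
    obtain ⟨u, rfl, hu⟩ := Ds u'
    obtain ⟨w, rfl, hw⟩ := Ds w'
    rw [curl_formula hJ'1 hΦ'2, dΦ, dΦ, dJ, dJ]
    have ident : ((1 + h * b x) * fderiv ℝ J x u + h * J x * (κ * fderiv ℝ (bb δ ρ) x u)) * fderiv ℝ Φ x w
        - ((1 + h * b x) * fderiv ℝ J x w + h * J x * (κ * fderiv ℝ (bb δ ρ) x w)) * fderiv ℝ Φ x u
        = (1 + h * b x) * curl (Yf J Φ) x u w
          + h * (κ * (fderiv ℝ (bb δ ρ) x u * ⟪Yf J Φ x, w⟫ - fderiv ℝ (bb δ ρ) x w * ⟪Yf J Φ x, u⟫)) := by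
      rw [curl_formula s.smJ s.smΦ, inner_Yf, inner_Yf]; ring
    rw [ident]
    have hQ : ∀ y, |deriv H (Φ y) / J y| ≤ L * Real.exp lam := by
      intro y
      rw [abs_div, abs_of_pos (s.Jpos y), div_le_iff₀ (s.Jpos y)]
      have e1 : Real.exp lam * Real.exp (-lam) = 1 := by rw [← Real.exp_add]; simp
      calc _ ≤ L := hH.der _
        _ = L * (Real.exp lam * Real.exp (-lam)) := by rw [e1, mul_one]
        _ ≤ L * (Real.exp lam * J y) := by
          have := s.Jlo y
          gcongr
        _ = _ := by ring
    have wd := db_wedge hd hδ h0 h1 hρ1 (s.rho hH) hQ s.Yhol s.Yhi x u w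
    have t1 : |(1 + h * b x) * curl (Yf J Φ) x u w| ≤ (1 + q) * (e * (‖u‖ * ‖w‖)) := by
      have hb1 := abs_le.1 (hhb x)
      rw [abs_mul, abs_of_nonneg (by linarith : 0 ≤ 1 + h * b x)]
      exact mul_le_mul (by linarith) (s.curl x u w) (abs_nonneg _) (by linarith)
    have t2 : |h * (κ * (fderiv ℝ (bb δ ρ) x u * ⟪Yf J Φ x, w⟫ - fderiv ℝ (bb δ ρ) x w * ⟪Yf J Φ x, u⟫))|
        ≤ h * (sig * (‖u‖ * ‖w‖)) := by
      rw [abs_mul, abs_mul, abs_of_pos hh]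
      refine mul_le_mul_of_nonneg_left ?_ hh.le
      calc _ ≤ |κ| * _ := mul_le_mul_of_nonneg_left wd hκ
        _ = (|κ| * (((L * Real.exp lam) * (2 * Real.exp lam * Real.exp lam)) * (d * (cG d γ * δ ^ γ)))) * (‖u‖ * ‖w‖) := by ring
        _ ≤ _ := by gcongr
    have q1 : 1 + q ≤ Real.exp q := by linarith [Real.add_one_le_exp q]
    have q2 : 1 ≤ Real.exp q := Real.one_le_exp hq0
    calc _ ≤ (1 + q) * (e * (‖u‖ * ‖w‖)) + h * (sig * (‖u‖ * ‖w‖)) := (abs_add_le _ _).trans (add_le_add t1 t2)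
      _ ≤ Real.exp q * (e * (‖u‖ * ‖w‖)) + Real.exp q * (h * (sig * (‖u‖ * ‖w‖))) := by
          refine add_le_add (by gcongr) (le_mul_of_one_le_left (by positivity) q2)
      _ = Real.exp q * (e + h * sig) * (‖u‖ * ‖w‖) := by ring
      _ ≤ Real.exp q * (e + h * sig) * ((Real.exp (2 * q) * ‖D x u‖) * (Real.exp (2 * q) * ‖D x w‖)) := by
          gcongr
      _ = (e + h * sig) * Real.exp (5 * q) * (‖D x u‖ * ‖D x w‖) := by
          have : Real.exp (5 * q) = Real.exp q * Real.exp (2 * q) * Real.exp (2 * q) := by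
            simp only [← Real.exp_add]; ring_nf
          rw [this]; ring
      _ ≤ _ := by gcongr; linarith
  · -- jacobian error
    intro z
    obtain ⟨x, rfl⟩ := surj z
    rw [hJF, hΦF]
    set P := 1 + h * (κ * (mass d * H (Φ x))) with hP
    have hPk : |P ^ k| ≤ (1 + h * (|κ| * mass d)) ^ k := by
      rw [abs_pow]
      gcongr
      refine (abs_add_le _ _).trans ?_
      rw [abs_one, abs_mul, abs_mul, abs_mul, abs_of_pos hh, abs_of_nonneg hm, abs_of_nonneg (hH.nonneg _)]
      gcongr
      exact mul_le_of_le_one_right hm (hH.le_one _)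
    have ms := bb_sub_mass hd hδ h0 h1 hρ1 x (fun y => rho_holder s hH hL h0 h1 x y)
    have ident : J x * (1 + h * b x) - P ^ (k + 1)
        = (J x - P ^ k) * (1 + h * b x) + h * (P ^ k * (κ * (bb δ ρ x - mass d * ρ x))) := by
      rw [pow_succ, hP, hb, hρ]; simp only [Function.comp]; ring
    rw [ident]
    have t1 : |(J x - P ^ k) * (1 + h * b x)| ≤ e * (1 + q) := by
      have hb1 := abs_le.1 (hhb x)
      rw [abs_mul, abs_of_nonneg (by linarith : 0 ≤ 1 + h * b x)]
      exact mul_le_mul (s.Jerr x) (by linarith) (by linarith) he0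
    have t2 : |h * (P ^ k * (κ * (bb δ ρ x - mass d * ρ x)))| ≤ h * sig := by
      rw [abs_mul, abs_of_pos hh, abs_mul, abs_mul]
      refine mul_le_mul_of_nonneg_left (le_trans ?_ hs2) hh.le
      gcongr
    calc _ ≤ e * (1 + q) + h * sig := (abs_add_le _ _).trans (add_le_add t1 t2)
      _ ≤ e * (1 + q) + h * sig * (1 + q) := by
          have : 0 ≤ h * sig * q := by positivity
          linarith
      _ = (e + h * sig) * (1 + q) := by ring
      _ ≤ _ := by gcongr

end AggPatch

namespace AggPatch
open MeasureTheory Metric Set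
open scoped RealInnerProductSpace
variable {d : ℕ}
variable {H : ℝ → ℝ} {γ κ h c lam R e ε L δ : ℝ} {k : ℕ} {Φ J : Eu d → ℝ}

lemma St.mono {lam' R' e' : ℝ} (s : St H γ κ h c lam R e k Φ J) (h1 : lam ≤ lam') (h2 : R ≤ R') (h3 : e ≤ e') :
    St H γ κ h c lam' R' e' k Φ J := by
  have a1 : Real.exp lam ≤ Real.exp lam' := Real.exp_le_exp.2 h1
  have a2 : Real.exp (-lam') ≤ Real.exp (-lam) := Real.exp_le_exp.2 (by linarith)
  refine ⟨s.smΦ, s.smJ, s.dens.mono h2, fun x => a2.trans (s.Jlo x), fun x => (s.Jhi x).trans a1,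
    fun x => (s.Yhi x).trans a1, fun x y => (s.Yhol x y).trans ?_, fun x hx => a2.trans (s.Ylo x hx),
    fun x u w => (s.curl x u w).trans ?_, fun x => (s.Jerr x).trans h3⟩
  · gcongr
  · gcongr

lemma seq_ex {S : Type*} (P : ℕ → S → Prop) (r : ℕ → S → S → Prop) (M : ℕ) (s0 : S) (h0 : P 0 s0)
    (hs : ∀ k < M, ∀ s, P k s → ∃ s', P (k + 1) s' ∧ r k s s') :
    ∃ f : ℕ → S, f 0 = s0 ∧ (∀ k ≤ M, P k (f k)) ∧ ∀ k < M, r k (f k) (f (k + 1)) := by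
  classical
  have : ∀ k s, ∃ s', (k < M → P k s → P (k + 1) s' ∧ r k s s') := by
    intro k s
    by_cases h : k < M ∧ P k s
    · obtain ⟨s', h'⟩ := hs k h.1 s h.2
      exact ⟨s', fun _ _ => h'⟩
    · exact ⟨s, fun a b => absurd ⟨a, b⟩ h⟩
  choose g hg using this
  set f : ℕ → S := fun n => Nat.rec s0 (fun k s => g k s) n with hf
  have fs : ∀ k, f (k + 1) = g k (f k) := fun k => rfl
  have hP : ∀ k ≤ M, P k (f k) := by
    intro k
    induction k with
    | zero => intro _; exact h0
    | succ k ih =>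
      intro hk
      rw [fs]
      exact (hg k (f k) (by omega) (ih (by omega))).1
  refine ⟨f, rfl, hP, fun k hk => ?_⟩
  rw [fs]
  exact (hg k (f k) hk (hP k hk.le)).2

lemma c3_mono {R R' : ℝ} (h0 : 0 < γ) (h1 : γ < 1) (hR : 0 < R) (h : R ≤ R') : c3 d γ R ≤ c3 d γ R' := by
  have := sphereVol_nonneg d
  have := vB_nonneg d
  have h2 : 0 < 1 - γ := by linarith
  unfold c3 cS
  gcongr

lemma cA_mono {R R' : ℝ} (hδ : 0 < δ) (h : R ≤ R') : cA d δ R ≤ cA d δ R' := by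
  have := c1_pos d
  unfold cA
  gcongr
  exact measure_closedBall_lt_top.ne

/-- data of an approximate flow -/
structure Apx (H : ℝ → ℝ) (γ κ c lam R η δ : ℝ) (M : ℕ) (Φ J : ℕ → Eu d → ℝ) (X : ℕ → Eu d → Eu d) : Prop where
  hδ : 0 < δ
  hδη : δ ≤ η
  hM : 0 < M
  hMη : (1:ℝ) / M ≤ η
  X0 : ∀ α, X 0 α = α
  step : ∀ k < M, ∀ α, X (k + 1) α = Fs H κ (1 / M) δ (Φ k) (X k α)
  st : ∀ k ≤ M, St H γ κ (1 / M) c lam R η k (Φ k) (J k)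
  bij : ∀ k ≤ M, Function.Bijective (X k)
  lab : ∀ k ≤ M, ∀ α, Φ k (X k α) = Φ 0 α
  lip : ∀ k ≤ M, ∀ x y, ‖X k x - X k y‖ ≤ Real.exp lam * ‖x - y‖
  low : ∀ k ≤ M, ∀ x y, ‖x - y‖ ≤ Real.exp lam * ‖X k x - X k y‖

set_option maxHeartbeats 1600000 in
lemma approx (hd : 1 ≤ d) (h0 : 0 < γ) (h1 : γ < 1) (κ : ℝ) (hc : 0 < c) (hc1 : c ≤ 1) {lam0 R0 : ℝ}
    (hl0 : 0 ≤ lam0) (hR0 : 1 ≤ R0) :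
    ∃ lam R : ℝ, 0 ≤ lam ∧ 1 ≤ R ∧ ∀ (H : ℝ → ℝ) (ε L : ℝ), Cut ε L H → ε ≤ c / 2 → ∀ Φ0 : Eu d → ℝ,
      (∀ h, St H γ κ h c lam0 R0 0 0 Φ0 (fun _ => 1)) → ∀ η, 0 < η →
      ∃ (δ : ℝ) (M : ℕ) (Φ J : ℕ → Eu d → ℝ) (X : ℕ → Eu d → Eu d), Φ 0 = Φ0 ∧
        Apx H γ κ c lam R η δ M Φ J X := by
  have hκ := abs_nonneg κ
  have hsv := sphereVol_nonneg d
  have hvB := vB_nonneg d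
  set CR := |κ| * (sphereVol d + vB d) with hCR
  have hCR0 : 0 ≤ CR := by positivity
  set Rm := R0 * Real.exp CR with hRm
  have hRm1 : 1 ≤ Rm := one_le_mul_of_one_le_of_one_le hR0 (Real.one_le_exp hCR0)
  obtain ⟨Ca, hCa0, hCa⟩ := Aop_unif (d := d) hd h0 h1 hc hc1 hRm1
  have hc2 := c2_nonneg (d := d) h0 h1
  have hm := mass_nonneg d
  have hc3 : 0 ≤ c3 d γ Rm := by
    have := cS_nonneg (d := d) (by linarith : 0 < 1 - γ) (by linarith : 0 < Rm)
    unfold c3; positivity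
  have hG := cG_nonneg (d := d) h0 h1
  set C0 := |κ| * (c2 d γ + Ca + mass d + c3 d γ Rm) with hC0
  have hC00 : 0 ≤ C0 := by positivity
  set C := 13 * C0 with hCdef
  have hC0' : 0 ≤ C := by positivity
  set lm := (1 + lam0) * Real.exp C - 1 with hlm
  have hlm0 : lam0 ≤ lm := by
    have := mul_le_mul_of_nonneg_left (Real.one_le_exp hC0') (by linarith : 0 ≤ 1 + lam0)
    linarith
  refine ⟨lm, Rm, hl0.trans hlm0, hRm1, ?_⟩
  intro H ε L hH hε Φ0 hΦ0 η hη
  have hL : 0 ≤ L := (abs_nonneg _).trans (hH.der 0)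
  set sig := min η 1 * Real.exp (-(2 * lm)) with hsig
  have hsig0 : 0 < sig := mul_pos (lt_min hη one_pos) (Real.exp_pos _)
  set K := |κ| * (((L * Real.exp lm) * (2 * Real.exp lm * Real.exp lm)) * (d * cG d γ))
    + Real.exp (|κ| * mass d) * (|κ| * ((1 + L * Real.exp (2 * lm)) * (d * cG d γ))) with hK
  have hK1 : 0 ≤ |κ| * (((L * Real.exp lm) * (2 * Real.exp lm * Real.exp lm)) * (d * cG d γ)) := by positivity
  have hK2 : 0 ≤ Real.exp (|κ| * mass d) * (|κ| * ((1 + L * Real.exp (2 * lm)) * (d * cG d γ))) := by positivity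
  have hK0 : 0 ≤ K := by positivity
  set w := sig / (K + 1) with hw
  have hw0 : 0 < w := by positivity
  obtain ⟨δ, hδ, hδη, hδw⟩ : ∃ δ, 0 < δ ∧ δ ≤ η ∧ δ ^ γ ≤ w := by
    refine ⟨min η (w ^ (1 / γ)), lt_min hη (Real.rpow_pos_of_pos hw0 _), min_le_left _ _, ?_⟩
    calc _ ≤ (w ^ (1 / γ)) ^ γ := Real.rpow_le_rpow (le_min hη.le (by positivity)) (min_le_right _ _) h0.le
      _ = w := by rw [← Real.rpow_mul hw0.le, one_div_mul_cancel h0.ne', Real.rpow_one]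
  have hKδ : K * δ ^ γ ≤ sig := by
    calc _ ≤ (K + 1) * w := by gcongr; linarith
      _ = sig := by rw [hw]; field_simp
  have hdγ : 0 ≤ δ ^ γ := by positivity
  have hcA := cA_nonneg (d := d) hδ Rm
  set am := Ca * (1 + lm) with ham
  have hlm1 : 0 ≤ lm := hl0.trans hlm0
  have ham0 : 0 ≤ am := by positivity
  set Am := C0 * (1 + lm) with hAm
  have hAm0 : 0 ≤ Am := by positivity
  obtain ⟨M, hM⟩ := exists_nat_ge (2 * Am + |κ| * (cA d δ Rm + 2 * am) + 1 / η + 1)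
  have t1 : 0 ≤ |κ| * (cA d δ Rm + 2 * am) := by positivity
  have t2 : 0 < 1 / η := by positivity
  have hMp : (0:ℝ) < M := by linarith
  have hM0 : 0 < M := by exact_mod_cast hMp
  set h := (1:ℝ) / M with hh
  have hh0 : 0 < h := by positivity
  have hhM : h * M = 1 := by rw [hh]; field_simp
  have hhle : ∀ u : ℝ, u ≤ M → h * u ≤ 1 := fun u hu => by
    rw [← hhM]; exact mul_le_mul_of_nonneg_left hu hh0.le
  set lk : ℕ → ℝ := fun k => (1 + lam0) * Real.exp (C * (k * h)) - 1 with hlk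
  set Rk : ℕ → ℝ := fun k => R0 * Real.exp (CR * (k * h)) with hRk
  set ek : ℕ → ℝ := fun k => k * h * sig * Real.exp (lk k) with hek
  have hkh : ∀ k ≤ M, (k:ℝ) * h ≤ 1 := fun k hk => by
    rw [mul_comm]; exact hhle _ (by exact_mod_cast hk)
  have hlkm : ∀ k ≤ M, lk k ≤ lm := fun k hk => by
    have : C * (k * h) ≤ C := mul_le_of_le_one_right hC0' (hkh k hk)
    simp only [hlk, hlm]; gcongr
  have hRkm : ∀ k ≤ M, Rk k ≤ Rm := fun k hk => by
    have : CR * (k * h) ≤ CR := mul_le_of_le_one_right hCR0 (hkh k hk)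
    simp only [hRk, hRm]; gcongr
  have hlk0 : ∀ k : ℕ, lam0 ≤ lk k := fun k => by
    have := mul_le_mul_of_nonneg_left (Real.one_le_exp (by positivity : 0 ≤ C * (k * h))) (by linarith : 0 ≤ 1 + lam0)
    simp only [hlk]
    linarith
  have hRk0 : ∀ k : ℕ, R0 ≤ Rk k := fun k =>
    le_mul_of_one_le_right (by linarith) (Real.one_le_exp (by positivity : 0 ≤ CR * (k * h)))
  have hek0 : ∀ k : ℕ, 0 ≤ ek k := fun k => by simp only [hek]; positivity
  have heks : ∀ k ≤ M, ek k ≤ min η 1 * Real.exp (-lm) := fun k hk => by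
    calc ek k = (k * h) * (sig * Real.exp (lk k)) := by simp only [hek]; ring
      _ ≤ 1 * (sig * Real.exp lm) := by
        have := hlkm k hk
        have := hkh k hk
        gcongr
      _ = _ := by
        rw [hsig, one_mul, mul_assoc, ← Real.exp_add]; ring_nf
  have hexl : Real.exp (-lm) ≤ 1 := Real.exp_le_one_iff.2 (by linarith)
  have hmin0 : 0 ≤ min η 1 := (lt_min hη one_pos).le
  have hekη : ∀ k ≤ M, ek k ≤ η := fun k hk =>
    (heks k hk).trans ((mul_le_of_le_one_right hmin0 hexl).trans (min_le_left _ _))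
  have hek1 : ∀ k ≤ M, ek k ≤ 1 := fun k hk =>
    (heks k hk).trans ((mul_le_of_le_one_right hmin0 hexl).trans (min_le_right _ _))
  have hekl : ∀ k ≤ M, ek k ≤ Real.exp (-lk k) := fun k hk => by
    refine (heks k hk).trans ((mul_le_of_le_one_left (Real.exp_pos _).le (min_le_right _ _)).trans ?_)
    exact Real.exp_le_exp.2 (by linarith [hlkm k hk])
  have lk0 : lk 0 = lam0 := by simp [hlk]
  have Rk0 : Rk 0 = R0 := by simp [hRk]
  have ek0 : ek 0 = 0 := by simp [hek]
  have lks : ∀ k : ℕ, lk k + 13 * (h * (C0 * (1 + lk k))) ≤ lk (k + 1) := fun k => by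
    have a : 1 + lk (k + 1) = (1 + lk k) * Real.exp (C * h) := by
      simp only [hlk]
      have : Real.exp (C * ((↑(k + 1) : ℝ) * h)) = Real.exp (C * (k * h)) * Real.exp (C * h) := by
        rw [← Real.exp_add]; push_cast; ring_nf
      rw [this]; ring
    have b := mul_le_mul_of_nonneg_left (Real.add_one_le_exp (C * h)) (by linarith [hlk0 k] : 0 ≤ 1 + lk k)
    have c : 13 * (h * (C0 * (1 + lk k))) = (1 + lk k) * (C * h) := by rw [hCdef]; ring
    linarith
  have Rks : ∀ k : ℕ, Rk k + h * (|κ| * cS d 1 (Rk k)) ≤ Rk (k + 1) := fun k => by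
    have a : Rk (k + 1) = Rk k * Real.exp (CR * h) := by
      simp only [hRk]
      have : Real.exp (CR * ((↑(k + 1) : ℝ) * h)) = Real.exp (CR * (k * h)) * Real.exp (CR * h) := by
        rw [← Real.exp_add]; push_cast; ring_nf
      rw [this]; ring
    have b := mul_le_mul_of_nonneg_left (Real.add_one_le_exp (CR * h)) (by linarith [hRk0 k] : 0 ≤ Rk k)
    have c : h * (|κ| * cS d 1 (Rk k)) = Rk k * (CR * h) := by
      unfold cS; rw [Real.rpow_one, hCR]; ring
    linarith
  have lkmono : ∀ k : ℕ, lk k ≤ lk (k + 1) := fun k => by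
    have := lks k
    have : 0 ≤ 13 * (h * (C0 * (1 + lk k))) := by
      have : 0 ≤ 1 + lk k := by linarith [hlk0 k]
      positivity
    linarith
  have eks : ∀ k : ℕ, (ek k + h * sig) * Real.exp (lk (k + 1) - lk k) ≤ ek (k + 1) := fun k => by
    have a : ek k * Real.exp (lk (k + 1) - lk k) = k * h * sig * Real.exp (lk (k + 1)) := by
      simp only [hek]
      rw [mul_assoc (↑k * h * sig), ← Real.exp_add]; congr 2; ring
    have b : Real.exp (lk (k + 1) - lk k) ≤ Real.exp (lk (k + 1)) := Real.exp_le_exp.2 (by linarith [hlk0 k])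
    have b' := mul_le_mul_of_nonneg_left b (by positivity : 0 ≤ h * sig)
    have c : ek (k + 1) = k * h * sig * Real.exp (lk (k + 1)) + h * sig * Real.exp (lk (k + 1)) := by
      simp only [hek]; push_cast; ring
    linarith
  obtain ⟨f, f0, fP, fr⟩ := seq_ex (S := (Eu d → ℝ) × (Eu d → ℝ) × (Eu d → Eu d))
    (fun k s => St H γ κ h c (lk k) (Rk k) (ek k) k s.1 s.2.1 ∧ Function.Bijective s.2.2 ∧
      (∀ α, s.1 (s.2.2 α) = Φ0 α) ∧ (∀ x y, ‖s.2.2 x - s.2.2 y‖ ≤ Real.exp (lk k - lam0) * ‖x - y‖) ∧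
      (∀ x y, ‖x - y‖ ≤ Real.exp (lk k - lam0) * ‖s.2.2 x - s.2.2 y‖))
    (fun k s s' => ∀ α, s'.2.2 α = Fs H κ h δ s.1 (s.2.2 α)) M (Φ0, (fun _ => 1), id)
    (by
      refine ⟨?_, Function.bijective_id, fun α => rfl, ?_, ?_⟩
      · rw [lk0, Rk0, ek0]; exact hΦ0 h
      · intro x y; simp [lk0]
      · intro x y; simp [lk0])
    (by
      rintro k hk ⟨Φ, J, X⟩ ⟨s, hbij, hlab, hlip, hlow⟩
      have hkM := hk.le
      have l1 := hlkm k hkM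
      have l0 : 0 ≤ lk k := hl0.trans (hlk0 k)
      have p : StepHyp d γ κ h (lk k) (Rk k) (ek k) L δ (Ca * (1 + lk k)) (C0 * (1 + lk k)) (lk (k + 1)) sig k := by
        refine ⟨hδ, hh0, by linarith [hRk0 k], hL, l0, hek0 k, hek1 k hkM, by positivity, ?_, ?_, ?_, lks k, ?_, ?_⟩
        · have := c3_mono (d := d) h0 h1 (by linarith [hRk0 k]) (hRkm k hkM)
          rw [hC0, mul_assoc]
          refine mul_le_mul_of_nonneg_left ?_ hκ
          have := mul_nonneg (by positivity : 0 ≤ c2 d γ + mass d + c3 d γ Rm) l0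
          nlinarith
        · have : C0 * (1 + lk k) ≤ Am := by rw [hAm]; gcongr
          have := hhle (2 * (C0 * (1 + lk k))) (by linarith)
          linarith
        · refine hhle _ ?_
          have : |κ| * (cA d δ (Rk k) + 2 * (Ca * (1 + lk k))) ≤ |κ| * (cA d δ Rm + 2 * am) := by
            have := cA_mono (d := d) hδ (hRkm k hkM)
            rw [ham]; gcongr
          linarith
        · calc _ ≤ |κ| * (((L * Real.exp lm) * (2 * Real.exp lm * Real.exp lm)) * (d * (cG d γ * δ ^ γ))) := by
                gcongr
            _ = (|κ| * (((L * Real.exp lm) * (2 * Real.exp lm * Real.exp lm)) * (d * cG d γ))) * δ ^ γ := by ring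
            _ ≤ K * δ ^ γ := by gcongr; linarith
            _ ≤ sig := hKδ
        · have pw : (1 + h * (|κ| * mass d)) ^ k ≤ Real.exp (|κ| * mass d) := by
            calc _ ≤ (Real.exp (h * (|κ| * mass d))) ^ k := by
                  gcongr; linarith [Real.add_one_le_exp (h * (|κ| * mass d))]
              _ = Real.exp ((k * h) * (|κ| * mass d)) := by rw [← Real.exp_nat_mul]; ring_nf
              _ ≤ _ := Real.exp_le_exp.2 (mul_le_of_le_one_left (by positivity) (hkh k hkM))
          calc _ ≤ Real.exp (|κ| * mass d) * (|κ| * ((1 + L * Real.exp (2 * lm)) * (d * (cG d γ * δ ^ γ)))) := by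
                gcongr
            _ = (Real.exp (|κ| * mass d) * (|κ| * ((1 + L * Real.exp (2 * lm)) * (d * cG d γ)))) * δ ^ γ := by ring
            _ ≤ K * δ ^ γ := by gcongr; linarith
            _ ≤ sig := hKδ
      have haA : ∀ η, δ ≤ η → ∀ x, ‖Aop η (H ∘ Φ) x‖ ≤ Ca * (1 + lk k) := fun η' hη' x =>
        hCa H ε L κ h (lk k) (ek k) k Φ J hH hε (s.mono le_rfl (hRkm k hkM) le_rfl) l0 (hekl k hkM) (hek0 k) η'
          (hδ.trans_le hη') x
      obtain ⟨Φ', J', b1, b2, b3, b4, b5⟩ := one_step hd h0 h1 hH s p haA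
      refine ⟨(Φ', J', fun α => Fs H κ h δ Φ (X α)), ⟨b5.mono le_rfl (Rks k) (eks k), b1.comp hbij,
        fun α => (b2 _).trans (hlab α), ?_, ?_⟩, fun α => rfl⟩
      · intro x y
        refine (b3 _ _).trans ?_
        have := mul_le_mul_of_nonneg_left (hlip x y) (Real.exp_pos (lk (k + 1) - lk k)).le
        rw [← mul_assoc, ← Real.exp_add] at this
        rwa [show lk (k + 1) - lk k + (lk k - lam0) = lk (k + 1) - lam0 by ring] at this
      · intro x y
        refine (hlow x y).trans ?_
        have := mul_le_mul_of_nonneg_left (b4 (X x) (X y)) (Real.exp_pos (lk k - lam0)).le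
        rw [← mul_assoc, ← Real.exp_add] at this
        rwa [show lk k - lam0 + (lk (k + 1) - lk k) = lk (k + 1) - lam0 by ring] at this)
  have fexp : ∀ k ≤ M, Real.exp (lk k - lam0) ≤ Real.exp lm := fun k hk =>
    Real.exp_le_exp.2 (by linarith [hlkm k hk])
  refine ⟨δ, M, fun k => (f k).1, fun k => (f k).2.1, fun k => (f k).2.2, by simp only [f0], ?_⟩
  refine ⟨hδ, hδη, hM0, ?_, by intro α; simp only [f0, id], fr, fun k hk => (fP k hk).1.mono (hlkm k hk) (hRkm k hk) (hekη k hk),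
    fun k hk => (fP k hk).2.1, fun k hk α => ?_, fun k hk x y => ?_, fun k hk x y => ?_⟩
  · rw [div_le_iff₀ hMp]
    have : 1 / η ≤ M := by linarith
    rw [div_le_iff₀ hη] at this
    linarith
  · rw [(fP k hk).2.2.1 α]; simp only [f0]
  · exact ((fP k hk).2.2.2.1 x y).trans (mul_le_mul_of_nonneg_right (fexp k hk) (norm_nonneg _))
  · exact ((fP k hk).2.2.2.2 x y).trans (mul_le_mul_of_nonneg_right (fexp k hk) (norm_nonneg _))

end AggPatch

namespace AggPatch
open MeasureTheory Metric Set
open scoped RealInnerProductSpace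
variable {d : ℕ}

lemma cut_ex {ε : ℝ} (hε : 0 < ε) : ∃ (L : ℝ) (H : ℝ → ℝ), Cut ε L H := by
  set H : ℝ → ℝ := fun s => Real.smoothTransition (-s / ε) with hH
  have hs : ContDiff ℝ 2 H := by
    have : ContDiff ℝ 2 fun s : ℝ => -s / ε := by fun_prop
    exact Real.smoothTransition.contDiff.comp this
  have one : ∀ s, s ≤ -ε → H s = 1 := fun s hs =>
    Real.smoothTransition.one_of_one_le (by rw [le_div_iff₀ hε]; linarith)
  have zero : ∀ s, 0 ≤ s → H s = 0 := fun s hs =>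
    Real.smoothTransition.zero_of_nonpos (div_nonpos_of_nonpos_of_nonneg (by linarith) hε.le)
  have hc : Continuous (deriv H) := hs.continuous_deriv (by norm_num)
  obtain ⟨L, hL⟩ := (isCompact_Icc (a := -ε) (b := (0:ℝ))).exists_bound_of_continuousOn hc.continuousOn
  have hL0 : 0 ≤ L := (norm_nonneg _).trans (hL 0 ⟨by linarith, le_rfl⟩)
  refine ⟨L, H, hs, fun s => Real.smoothTransition.nonneg _, fun s => Real.smoothTransition.le_one _, one, zero, ?_⟩
  intro s
  rcases lt_or_ge s (-ε) with h | h
  · have : deriv H s = 0 := by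
      have e : H =ᶠ[nhds s] fun _ => 1 := by
        filter_upwards [Iio_mem_nhds h] with t ht using one t (le_of_lt ht)
      rw [e.deriv_eq]; simp
    rw [this]; simpa using hL0
  · rcases lt_or_ge 0 s with h' | h'
    · have : deriv H s = 0 := by
        have e : H =ᶠ[nhds s] fun _ => 0 := by
          filter_upwards [Ioi_mem_nhds h'] with t ht using zero t (le_of_lt ht)
        rw [e.deriv_eq]; simp
      rw [this]; simpa using hL0
    · exact hL s ⟨h, h'⟩

lemma lip_hol {V : Type*} [NormedAddCommGroup V] {F : Eu d → V} {L B γ : ℝ} (h0 : 0 < γ) (h1 : γ < 1)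
    (hL : ∀ x y, ‖F x - F y‖ ≤ L * ‖x - y‖) (hB : ∀ x, ‖F x‖ ≤ B) (hL0 : 0 ≤ L) (x y : Eu d) :
    ‖F x - F y‖ ≤ (L + 2 * B) * ‖x - y‖ ^ γ := by
  have hB0 : 0 ≤ B := (norm_nonneg _).trans (hB x)
  rcases le_or_gt ‖x - y‖ 1 with hr | hr
  · have c : ‖x - y‖ ≤ ‖x - y‖ ^ γ := by
      calc ‖x - y‖ = ‖x - y‖ ^ (1:ℝ) := (Real.rpow_one _).symm
        _ ≤ _ := Real.rpow_le_rpow_of_exponent_ge_of_imp (norm_nonneg _) hr h1.le (by intro _ h; linarith)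
    calc _ ≤ L * ‖x - y‖ := hL x y
      _ ≤ _ := by gcongr; linarith
  · have : 1 ≤ ‖x - y‖ ^ γ := Real.one_le_rpow hr.le h0.le
    calc ‖F x - F y‖ ≤ 2 * B := by linarith [norm_sub_le (F x) (F y), hB x, hB y]
      _ ≤ (L + 2 * B) * 1 := by linarith
      _ ≤ _ := mul_le_mul_of_nonneg_left this (by positivity)

lemma c1_cs_hol {V : Type*} [NormedAddCommGroup V] [NormedSpace ℝ V] {F : Eu d → V} {γ : ℝ} (h0 : 0 < γ) (h1 : γ < 1)
    (hF : ContDiff ℝ 1 F) (hs : HasCompactSupport F) :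
    ∃ K, 0 ≤ K ∧ ∀ x y, ‖F x - F y‖ ≤ K * ‖x - y‖ ^ γ := by
  obtain ⟨C, hC⟩ := hF.lipschitzWith_of_hasCompactSupport hs one_ne_zero
  obtain ⟨B, hB⟩ := hs.exists_bound_of_continuous hF.continuous
  refine ⟨C + 2 * B, ?_, lip_hol h0 h1 (fun x y => hC.norm_sub_le x y) hB C.2⟩
  have := (norm_nonneg _).trans (hB 0)
  positivity

lemma mul_hol {V : Type*} [NormedAddCommGroup V] [NormedSpace ℝ V] {θ : Eu d → ℝ} {A : Eu d → V} {γ K R : ℝ}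
    (h0 : 0 < γ) (h1 : γ < 1) (hθ : ContDiff ℝ 1 θ) (hθ1 : ∀ x, |θ x| ≤ 1)
    (hs : ∀ x, x ∉ closedBall (0 : Eu d) R → θ x = 0) (hA : Continuous A)
    (hK : ∀ x y, ‖A x - A y‖ ≤ K * ‖x - y‖ ^ γ) :
    ∃ K, 0 ≤ K ∧ ∀ x y, ‖θ x • A x - θ y • A y‖ ≤ K * ‖x - y‖ ^ γ := by
  have hcs : HasCompactSupport θ := HasCompactSupport.intro (isCompact_closedBall 0 R) hs
  obtain ⟨T, hT0, hT⟩ := c1_cs_hol h0 h1 hθ hcs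
  obtain ⟨B, hB⟩ := (isCompact_closedBall (0 : Eu d) R).exists_bound_of_continuousOn hA.continuousOn
  have key : ∀ x y, x ∈ closedBall (0 : Eu d) R → ‖θ x • A x - θ y • A y‖ ≤ (T * |B| + |K|) * ‖x - y‖ ^ γ := by
    intro x y hx
    have e : θ x • A x - θ y • A y = (θ x - θ y) • A x + θ y • (A x - A y) := by module
    rw [e]
    have a1 : ‖(θ x - θ y) • A x‖ ≤ (T * ‖x - y‖ ^ γ) * |B| := by
      rw [norm_smul]
      exact mul_le_mul (hT x y) ((hB x hx).trans (le_abs_self _)) (norm_nonneg _) (by positivity)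
    have a2 : ‖θ y • (A x - A y)‖ ≤ 1 * (|K| * ‖x - y‖ ^ γ) := by
      rw [norm_smul]
      refine mul_le_mul (hθ1 y) ((hK x y).trans ?_) (norm_nonneg _) zero_le_one
      gcongr; exact le_abs_self _
    calc _ ≤ _ := (norm_add_le _ _).trans (add_le_add a1 a2)
      _ = _ := by ring
  refine ⟨T * |B| + |K|, by positivity, fun x y => ?_⟩
  by_cases hx : x ∈ closedBall (0 : Eu d) R
  · exact key x y hx
  · by_cases hy : y ∈ closedBall (0 : Eu d) R
    · rw [norm_sub_rev, norm_sub_rev x]; exact key y x hy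
    · rw [hs x hx, hs y hy]; simp; positivity

/-- mollification -/
noncomputable def mol {V : Type*} [NormedAddCommGroup V] [NormedSpace ℝ V] (f : ContDiffBump (0 : Eu d)) (A : Eu d → V)
    (x : Eu d) : V := ∫ t, f.normed volume t • A (x - t)

section mol
variable {V : Type*} [NormedAddCommGroup V] [NormedSpace ℝ V] [CompleteSpace V] (f : ContDiffBump (0 : Eu d))

lemma mol_int {A : Eu d → V} (hA : Continuous A) (x : Eu d) :
    Integrable (fun t => f.normed volume t • A (x - t)) := by
  have hc : Continuous fun t => f.normed volume t • A (x - t) := by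
    have := f.continuous_normed (μ := volume)
    fun_prop
  exact hc.integrable_of_hasCompactSupport (f.hasCompactSupport_normed.smul_right)

lemma mol_le {A : Eu d → V} {B : ℝ} {x : Eu d} (h : ∀ t, ‖t‖ < f.rOut → ‖A (x - t)‖ ≤ B) :
    ‖mol f A x‖ ≤ B := by
  have : ∫ t, f.normed volume t * B = B := by
    rw [integral_mul_const, f.integral_normed, one_mul]
  rw [← this]
  refine norm_integral_le_of_norm_le (f.integrable_normed.mul_const B) (Filter.Eventually.of_forall fun t => ?_)
  rw [norm_smul, Real.norm_of_nonneg (f.nonneg_normed t)]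
  by_cases ht : ‖t‖ < f.rOut
  · exact mul_le_mul_of_nonneg_left (h t ht) (f.nonneg_normed t)
  · have : f.normed volume t = 0 := by
      have hs := f.support_normed_eq (μ := volume)
      by_contra hne
      have : t ∈ Function.support (f.normed volume) := hne
      rw [hs, mem_ball_zero_iff] at this
      exact ht this
    rw [this]; simp

lemma mol_sub {A B : Eu d → V} (hA : Continuous A) (hB : Continuous B) (x y : Eu d) :
    mol f (fun z => A (x + z) - B (y + z)) 0 = mol f A x - mol f B y := by
  unfold mol
  rw [← integral_sub (mol_int f hA x) (mol_int f hB y)]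
  congr 1; ext t
  rw [smul_sub]; simp [sub_eq_add_neg]

lemma mol_const (v : V) (x : Eu d) : mol f (fun _ => v) x = v := by
  unfold mol
  rw [integral_smul_const, f.integral_normed, one_smul]

end mol

lemma mol_smooth (f : ContDiffBump (0 : Eu d)) {g : Eu d → ℝ} (hg : Continuous g) : ContDiff ℝ 2 (mol f g) := by
  have := HasCompactSupport.contDiff_convolution_left (μ := volume) (n := 2) (ContinuousLinearMap.lsmul ℝ ℝ)
    (f.hasCompactSupport_normed (μ := volume)) (f.contDiff_normed (μ := volume)) (hg.locallyIntegrable (μ := volume))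
  exact this

lemma mol_deriv (f : ContDiffBump (0 : Eu d)) {g : Eu d → ℝ} (hg : ContDiff ℝ 1 g) (hs : HasCompactSupport g) (x : Eu d) :
    HasFDerivAt (mol f g) (mol f (fderiv ℝ g) x) x := by
  have := HasCompactSupport.hasFDerivAt_convolution_right (μ := volume) (ContinuousLinearMap.lsmul ℝ ℝ)
    hs ((f.continuous_normed (μ := volume)).locallyIntegrable (μ := volume)) hg x
  exact this

end AggPatch

namespace AggPatch
open MeasureTheory Metric Set
open scoped RealInnerProductSpace
variable {d : ℕ}

lemma null_zero {φ : Eu d → ℝ} (h : ContDiff ℝ 1 φ) {s : Set (Eu d)} (hs : ∀ x ∈ s, φ x = 0)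
    (hg : ∀ x ∈ s, gradient φ x ≠ 0) : volume s = 0 := by
  have key := addHaar_image_eq_zero_of_det_fderivWithin_eq_zero (μ := volume) (s := s) (f := id)
    (f' := fun x => ContinuousLinearMap.id ℝ (Eu d)
      - (fderiv ℝ φ x).smulRight ((‖gradient φ x‖ ^ 2)⁻¹ • gradient φ x)) ?_ ?_
  · simpa using key
  · intro x hx
    have h1 := (h.differentiable one_ne_zero x).hasFDerivAt.hasFDerivWithinAt (s := s)
    have h2 := h1.smul_const ((‖gradient φ x‖ ^ 2)⁻¹ • gradient φ x)
    have h3 := (hasFDerivWithinAt_id x s).sub h2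
    refine h3.congr (fun y hy => ?_) ?_
    · simp [hs y hy]
    · simp [hs x hx]
  · intro x hx
    have hne := hg x hx
    rw [ContinuousLinearMap.det]
    by_contra hdet
    have inj := (LinearMap.isUnit_iff_ker_eq_bot _).1
      ((LinearMap.isUnit_iff_isUnit_det _).2 (isUnit_iff_ne_zero.2 hdet))
    rw [LinearMap.ker_eq_bot'] at inj
    apply hne
    apply inj
    have e : fderiv ℝ φ x (gradient φ x) = ‖gradient φ x‖ ^ 2 := by
      rw [← inner_grad, real_inner_self_eq_norm_sq]
    have hn : ‖gradient φ x‖ ^ 2 ≠ 0 := by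
      have := norm_pos_iff.2 hne
      positivity
    simp only [ContinuousLinearMap.coe_coe, _root_.sub_apply, ContinuousLinearMap.id_apply,
      ContinuousLinearMap.smulRight_apply, e, smul_smul]
    rw [mul_inv_cancel₀ hn, one_smul, sub_self]

lemma grad_sub (f g : Eu d → ℝ) (x y : Eu d) :
    ‖gradient f x - gradient g y‖ = ‖fderiv ℝ f x - fderiv ℝ g y‖ := by
  unfold gradient
  rw [← map_sub]; exact LinearIsometryEquiv.norm_map _ _

/-- initial data package -/
structure Ini (γ c lam R : ℝ) (D : Set (Eu d)) (φ : Eu d → ℝ) : Prop where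
  cont : Continuous φ
  neg : D = {x | φ x < 0}
  fr : frontier D = {x | φ x = 0}
  null : volume {x | φ x = 0} = 0
  bd : ∀ x, x ∉ closedBall (0 : Eu d) R → φ x = 1
  lip : ∃ C, ∀ x y, |φ x - φ y| ≤ C * ‖x - y‖
  apx : ∀ η, 0 < η → ∃ (ε L : ℝ) (H : ℝ → ℝ) (Φ0 : Eu d → ℝ), 0 < ε ∧ ε ≤ η ∧ ε ≤ c / 2 ∧ Cut ε L H ∧ (∀ x, |Φ0 x - φ x| ≤ η) ∧
    ∀ κ h, St H γ κ h c lam R 0 0 Φ0 (fun _ => 1)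

set_option maxHeartbeats 1600000 in
lemma ini_ex {γ : ℝ} (h0 : 0 < γ) (h1 : γ < 1) {D : Set (Eu d)} (hD : IsC1Domain d γ D) :
    ∃ c lam R φ, 0 < c ∧ c ≤ 1 ∧ 0 ≤ lam ∧ 1 ≤ R ∧ Ini γ c lam R D φ := by
  obtain ⟨hDo, hDb, φ0, hs0, ⟨K0, hK0⟩, hneg, hfr, hgr⟩ := hD
  obtain ⟨R1, hR1⟩ := hDb.subset_closedBall (0 : Eu d)
  set r := |R1| + 1 with hr
  have hr1 : 1 ≤ r := by have := abs_nonneg R1; linarith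
  have hcl : closure D ⊆ ball (0 : Eu d) r := by
    refine (closure_minimal hR1 isClosed_closedBall).trans (closedBall_subset_ball ?_)
    have := le_abs_self R1
    linarith
  obtain ⟨θ, hθs, hθn, hθl, hθ1, hθ0⟩ : ∃ θ : Eu d → ℝ, ContDiff ℝ 2 θ ∧ (∀ x, 0 ≤ θ x) ∧ (∀ x, θ x ≤ 1) ∧
      (∀ x ∈ closedBall (0 : Eu d) r, θ x = 1) ∧ (∀ x, x ∉ closedBall (0 : Eu d) (r + 1) → θ x = 0) := by
    let θ : ContDiffBump (0 : Eu d) := ⟨r, r + 1, by linarith, by linarith⟩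
    exact ⟨θ, θ.contDiff, fun x => θ.nonneg, fun x => θ.le_one, fun x hx => θ.one_of_mem_closedBall hx,
      fun x hx => θ.zero_of_le_dist (by rw [mem_closedBall] at hx; push Not at hx; exact hx.le)⟩
  have hθcs : HasCompactSupport θ := HasCompactSupport.intro (isCompact_closedBall 0 (r + 1)) hθ0
  set g : Eu d → ℝ := fun x => θ x * (φ0 x - 1) with hg
  have hg1 : ContDiff ℝ 1 g := (hθs.of_le (by norm_num)).mul (hs0.sub contDiff_const)
  have hg0 : ∀ x, x ∉ closedBall (0 : Eu d) (r + 1) → g x = 0 := fun x hx => by simp only [hg, hθ0 x hx, zero_mul]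
  have hgs : HasCompactSupport g := HasCompactSupport.intro (isCompact_closedBall 0 (r + 1)) hg0
  have hgd : Continuous (fderiv ℝ g) := hg1.continuous_fderiv (by norm_num)
  have hgds : HasCompactSupport (fderiv ℝ g) := hgs.fderiv ℝ
  -- Hölder bound
  have hgf : ∀ x, fderiv ℝ g x = θ x • fderiv ℝ φ0 x + (φ0 x - 1) • fderiv ℝ θ x := fun x => by
    have a := (hθs.differentiable two_ne_zero x).hasFDerivAt
    have b := ((hs0.differentiable one_ne_zero x).hasFDerivAt).sub_const 1
    exact (a.mul b).fderiv
  have hfr0 : ∀ x, x ∈ closure D → φ0 x ≤ 0 := by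
    intro x hx
    rw [closure_eq_self_union_frontier, hfr] at hx
    rcases hx with hx | hx
    · rw [hneg] at hx; exact le_of_lt hx
    · exact le_of_eq hx
  obtain ⟨Ka, hKa0, hKa⟩ := mul_hol (A := fderiv ℝ φ0) h0 h1 (hθs.of_le (by norm_num))
    (fun x => by rw [abs_of_nonneg (hθn x)]; exact hθl x) hθ0 (hs0.continuous_fderiv (by norm_num))
    (K := K0) (fun x y => by rw [← grad_sub]; exact hK0 x y)
  have hθ' : ContDiff ℝ 1 (fderiv ℝ θ) := hθs.fderiv_right (by norm_num)
  have hKs : ContDiff ℝ 1 (fun x => (φ0 x - 1) • fderiv ℝ θ x) := by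
    have : ContDiff ℝ 1 fun x => φ0 x - 1 := hs0.sub contDiff_const
    exact this.smul hθ'
  have hKc : HasCompactSupport (fun x => (φ0 x - 1) • fderiv ℝ θ x) := by
    have : HasCompactSupport (fderiv ℝ θ) := hθcs.fderiv ℝ
    exact this.smul_left (f := fun x => φ0 x - 1)
  obtain ⟨Kb, hKb0, hKb⟩ := c1_cs_hol h0 h1 hKs hKc
  set K := Ka + Kb with hK
  have hKg : ∀ x y, ‖fderiv ℝ g x - fderiv ℝ g y‖ ≤ K * ‖x - y‖ ^ γ := by
    intro x y
    rw [hgf, hgf, add_sub_add_comm, hK, add_mul]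
    exact (norm_add_le _ _).trans (add_le_add (hKa x y) (hKb x y))
  obtain ⟨B, hB⟩ := hgds.exists_bound_of_continuous hgd
  obtain ⟨C, hC⟩ := hg1.lipschitzWith_of_hasCompactSupport hgs one_ne_zero
  have hCl : ∀ x y, |g x - g y| ≤ C * ‖x - y‖ := fun x y => hC.norm_sub_le x y
  set φ : Eu d → ℝ := fun x => g x + 1 with hφ
  have hφc : Continuous φ := hg1.continuous.add continuous_const
  have hφe : ∀ x ∈ closedBall (0 : Eu d) r, φ x = φ0 x := fun x hx => by simp only [hφ, hg, hθ1 x hx]; ring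
  have hφp : ∀ x, 0 < φ0 x → 0 < φ x := fun x hx => by
    have e : φ x = θ x * φ0 x + (1 - θ x) := by simp only [hφ, hg]; ring
    rw [e]
    have a := hθn x
    have b := hθl x
    rcases a.lt_or_eq with h | h
    · have := mul_pos h hx; linarith
    · rw [← h]; norm_num
  have hout : ∀ x, x ∉ closure D → 0 < φ0 x := fun x hx => by
    rw [closure_eq_self_union_frontier, hfr, mem_union, not_or] at hx
    have a := hx.1
    rw [hneg] at a
    exact lt_of_le_of_ne (not_lt.1 a) (Ne.symm hx.2)
  have hφcl : ∀ x ∈ closure D, φ x = φ0 x := fun x hx => hφe x (ball_subset_closedBall (hcl hx))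
  have hneg' : D = {x | φ x < 0} := by
    ext x
    by_cases hx : x ∈ closure D
    · rw [mem_setOf_eq, hφcl x hx]; exact Set.ext_iff.1 hneg x
    · have := hφp x (hout x hx)
      exact ⟨fun h => absurd (subset_closure h) hx, fun h => absurd h (not_lt.2 this.le)⟩
  have hfr' : frontier D = {x | φ x = 0} := by
    ext x
    by_cases hx : x ∈ closure D
    · rw [mem_setOf_eq, hφcl x hx]; exact Set.ext_iff.1 hfr x
    · have := hφp x (hout x hx)
      exact ⟨fun h => absurd (frontier_subset_closure h) hx, fun h => absurd h this.ne'⟩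
  have hφ1 : ContDiff ℝ 1 φ := hg1.add contDiff_const
  have hφd : ∀ x, fderiv ℝ φ x = fderiv ℝ g x := fun x => by rw [hφ, fderiv_add_const]
  have hgr' : ∀ x, φ x = 0 → fderiv ℝ g x ≠ 0 := by
    intro x hx
    have hxf : x ∈ frontier D := by rw [hfr']; exact hx
    have e : φ =ᶠ[nhds x] φ0 := by
      filter_upwards [isOpen_ball.mem_nhds (hcl (frontier_subset_closure hxf))] with y hy
        using hφe y (ball_subset_closedBall hy)
    rw [← hφd, e.fderiv_eq]
    intro h
    apply hgr x hxf
    rw [← norm_eq_zero, norm_grad, h, norm_zero]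
  -- lower bound
  obtain ⟨m, hm0, hm⟩ : ∃ m > 0, ∀ x, |φ x| ≤ 1 / 2 → m ≤ max |φ x| ‖fderiv ℝ g x‖ := by
    have hcomp : IsCompact {x | |φ x| ≤ 1 / 2} := by
      refine (isCompact_closedBall (0 : Eu d) (r + 1)).of_isClosed_subset
        (isClosed_le hφc.abs continuous_const) fun x hx => ?_
      by_contra hx'
      have : φ x = 1 := by simp only [hφ, hg0 x hx', zero_add]
      rw [mem_setOf_eq, this] at hx
      norm_num at hx
    rcases ({x | |φ x| ≤ 1 / 2}).eq_empty_or_nonempty with he | hne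
    · refine ⟨1, one_pos, fun x hx => ?_⟩
      have : x ∈ ({x | |φ x| ≤ 1 / 2} : Set (Eu d)) := hx
      rw [he] at this; exact this.elim
    · obtain ⟨x0, hx0, hmin⟩ := hcomp.exists_isMinOn hne
        (f := fun x => max |φ x| ‖fderiv ℝ g x‖) (hφc.abs.max hgd.norm).continuousOn
      refine ⟨max |φ x0| ‖fderiv ℝ g x0‖, ?_, fun x hx => hmin hx⟩
      by_cases h : φ x0 = 0
      · exact lt_max_of_lt_right (norm_pos_iff.2 (hgr' x0 h))
      · exact lt_max_of_lt_left (abs_pos.2 h)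
  set c := min (m / 4) (1 / 4) with hc
  have hc0 : 0 < c := lt_min (by linarith) (by norm_num)
  have hc4 : c ≤ 1 / 4 := min_le_right _ _
  have hcm : c ≤ m / 4 := min_le_left _ _
  have hB0 : 0 ≤ B := (norm_nonneg _).trans (hB 0)
  set lam := B + K + 2 / m with hlam
  have hKn : 0 ≤ K := by positivity
  have h2m : 0 < 2 / m := by positivity
  have hlam0 : 0 < lam := by linarith
  have hexp : lam ≤ Real.exp lam := by linarith [Real.add_one_le_exp lam]
  have hexpn : Real.exp (-lam) ≤ m / 2 := by
    rw [Real.exp_neg]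
    calc _ ≤ (2 / m)⁻¹ := inv_anti₀ h2m (by linarith)
      _ = m / 2 := by rw [inv_div]
  refine ⟨c, lam, r + 2, φ, hc0, by linarith, hlam0.le, by linarith, hφc, hneg', hfr', ?_, ?_, ⟨C, ?_⟩, ?_⟩
  · refine null_zero hφ1 (fun x hx => hx) fun x hx h => hgr' x hx ?_
    rw [← hφd, ← norm_eq_zero, ← norm_grad, h, norm_zero]
  · intro x hx
    have : x ∉ closedBall (0 : Eu d) (r + 1) := fun h => hx (closedBall_subset_closedBall (by linarith) h)
    simp only [hφ, hg0 x this, zero_add]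
  · intro x y; simp only [hφ, add_sub_add_right_eq_sub]; exact hCl x y
  -- approximation
  intro η hη
  set η' := min (min η c) (m / 2) with hη'
  have hη'0 : 0 < η' := lt_min (lt_min hη hc0) (by linarith)
  have hη1 : η' ≤ η := (min_le_left _ _).trans (min_le_left _ _)
  have hη2 : η' ≤ c := (min_le_left _ _).trans (min_le_right _ _)
  have hη3 : η' ≤ m / 2 := min_le_right _ _
  have hC0 : (0:ℝ) ≤ C := C.2
  obtain ⟨ρ, hρ0, hρ1, hρC, hρK⟩ : ∃ ρ, 0 < ρ ∧ ρ ≤ 1 ∧ C * ρ ≤ η' ∧ K * ρ ^ γ ≤ η' := by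
    refine ⟨min (min 1 (η' / (C + 1))) ((η' / (K + 1)) ^ (1 / γ)), ?_, ?_, ?_, ?_⟩
    · exact lt_min (lt_min one_pos (by positivity)) (Real.rpow_pos_of_pos (by positivity) _)
    · exact (min_le_left _ _).trans (min_le_left _ _)
    · calc _ ≤ (C + 1) * (η' / (C + 1)) := by
            refine mul_le_mul (by linarith) ((min_le_left _ _).trans (min_le_right _ _)) ?_ (by linarith)
            exact le_min (le_min zero_le_one (by positivity)) (Real.rpow_nonneg (by positivity) _)
        _ = η' := by field_simp
    · calc _ ≤ (K + 1) * (((η' / (K + 1)) ^ (1 / γ)) ^ γ) := by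
            refine mul_le_mul (by linarith) (Real.rpow_le_rpow ?_ (min_le_right _ _) h0.le) ?_ (by linarith)
            · exact le_min (le_min zero_le_one (by positivity)) (Real.rpow_nonneg (by positivity) _)
            · refine Real.rpow_nonneg ?_ _
              exact le_min (le_min zero_le_one (by positivity)) (Real.rpow_nonneg (by positivity) _)
        _ = (K + 1) * (η' / (K + 1)) := by
            rw [← Real.rpow_mul (by positivity), one_div_mul_cancel h0.ne', Real.rpow_one]
        _ = η' := by field_simp
  obtain ⟨f, hfo⟩ : ∃ f : ContDiffBump (0 : Eu d), f.rOut = ρ :=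
    ⟨⟨ρ / 2, ρ, by linarith, by linarith⟩, rfl⟩
  have hε : 0 < min η (c / 2) := lt_min hη (by linarith)
  obtain ⟨L, H, hH⟩ := cut_ex hε
  set Φ0 : Eu d → ℝ := fun x => mol f g x + 1 with hΦ0
  have hΦs : ContDiff ℝ 2 Φ0 := (mol_smooth f hg1.continuous).add contDiff_const
  have hΦd : ∀ x, fderiv ℝ Φ0 x = mol f (fderiv ℝ g) x := fun x => by
    rw [hΦ0, fderiv_add_const]; exact (mol_deriv f hg1 hgs x).fderiv
  have cl : ∀ x, |Φ0 x - φ x| ≤ η' := by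
    intro x
    simp only [hΦ0, hφ, add_sub_add_right_eq_sub]
    have e := mol_sub f hg1.continuous (continuous_const (y := g x)) x x
    rw [mol_const] at e
    rw [← e, ← Real.norm_eq_abs]
    refine mol_le f fun t ht => ?_
    simp only [zero_sub]
    refine (hCl _ _).trans ?_
    have : ‖x + -t - x‖ ≤ ρ := by
      rw [show x + -t - x = -t by abel, norm_neg, ← hfo]; exact ht.le
    exact (mul_le_mul_of_nonneg_left this hC0).trans hρC
  have cld : ∀ x, ‖fderiv ℝ Φ0 x - fderiv ℝ g x‖ ≤ η' := by
    intro x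
    have e := mol_sub f hgd (continuous_const (y := fderiv ℝ g x)) x x
    rw [mol_const] at e
    rw [hΦd, ← e]
    refine mol_le f fun t ht => ?_
    simp only [zero_sub]
    refine (hKg _ _).trans ?_
    have : ‖x + -t - x‖ ≤ ρ := by
      rw [show x + -t - x = -t by abel, norm_neg, ← hfo]; exact ht.le
    exact (mul_le_mul_of_nonneg_left (Real.rpow_le_rpow (norm_nonneg _) this h0.le) hKn).trans hρK
  have one' : Yf (fun _ => (1:ℝ)) Φ0 = gradient Φ0 := by
    ext1 x; unfold Yf; rw [one_smul]
  refine ⟨min η (c / 2), L, H, Φ0, hε, min_le_left _ _, min_le_right _ _, hH, fun x => (cl x).trans hη1, fun κ h => ?_⟩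
  have hl1 : 1 ≤ Real.exp lam := Real.one_le_exp hlam0.le
  refine ⟨hΦs, contDiff_const, ⟨(hH.smooth.comp hΦs).of_le (by norm_num), fun y => hH.nonneg _, fun y => hH.le_one _, ?_⟩,
    fun x => Real.exp_le_one_iff.2 (by linarith), fun x => hl1, ?_, ?_, ?_, ?_, ?_⟩
  · intro y hy
    refine hH.zero _ ?_
    have : mol f g y = 0 := by
      rw [← norm_le_zero_iff]
      refine mol_le f fun t ht => ?_
      rw [hg0, norm_zero]
      intro h'
      apply hy
      rw [mem_closedBall_zero_iff] at h' ⊢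
      have := norm_add_le (y - t) t
      rw [sub_add_cancel] at this
      have : ‖t‖ < ρ := hfo ▸ ht
      linarith
    simp only [hΦ0, this]; norm_num
  · intro x
    rw [one', norm_grad, hΦd]
    refine (mol_le f fun t _ => hB _).trans ?_
    linarith
  · intro x y
    rw [one', grad_sub, hΦd, hΦd, ← mol_sub f hgd hgd]
    refine mol_le f fun t _ => ?_
    simp only [zero_sub]
    refine (hKg _ _).trans ?_
    rw [add_sub_add_right_eq_sub]
    gcongr; linarith
  · intro x hx
    rw [one', norm_grad]
    have a := cl x
    have : |φ x| ≤ 2 * c := by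
      have := abs_sub_abs_le_abs_sub (φ x) (Φ0 x)
      rw [abs_sub_comm] at this
      linarith
    have b := hm x (by linarith)
    have : m ≤ ‖fderiv ℝ g x‖ := by
      rcases le_max_iff.1 b with h | h
      · linarith
      · exact h
    have := norm_sub_norm_le (fderiv ℝ g x) (fderiv ℝ Φ0 x)
    rw [norm_sub_rev] at this
    linarith [cld x]
  · intro x u w
    rw [curl_formula contDiff_const hΦs]
    simp
  · intro x; simp

end AggPatch

namespace AggPatch
open MeasureTheory Metric Set Filter Topology
open scoped RealInnerProductSpace
variable {d : ℕ}

lemma seq_extract {P : Type*} [PseudoMetricSpace P] [TopologicalSpace.SeparableSpace P] [Nonempty P]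
    (F : ℕ → P → Eu d) (hb : ∀ p, ∃ B, ∀ n, ‖F n p‖ ≤ B) {C : ℝ} (hC : 0 ≤ C) {τ : ℕ → ℝ} (hτ : Tendsto τ atTop (𝓝 0))
    (hE : ∀ n p q, ‖F n p - F n q‖ ≤ C * dist p q + τ n) :
    ∃ σ : ℕ → ℕ, StrictMono σ ∧ ∃ G : P → Eu d, ∀ p, Tendsto (fun n => F (σ n) p) atTop (𝓝 (G p)) := by
  choose B hB using hb
  set q := TopologicalSpace.denseSeq P with hq
  have hcomp : IsCompact (Set.pi univ fun i : ℕ => closedBall (0 : Eu d) (B (q i))) :=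
    isCompact_univ_pi fun i => isCompact_closedBall _ _
  obtain ⟨a, -, σ, hσ, ha⟩ := hcomp.tendsto_subseq (x := fun n i => F n (q i))
    (fun n i _ => by rw [mem_closedBall_zero_iff]; exact hB _ _)
  rw [tendsto_pi_nhds] at ha
  refine ⟨σ, hσ, ?_⟩
  have : ∀ p, ∃ g, Tendsto (fun n => F (σ n) p) atTop (𝓝 g) := by
    intro p
    apply cauchySeq_tendsto_of_complete
    rw [Metric.cauchySeq_iff']
    intro e he
    obtain ⟨i, hi⟩ := (TopologicalSpace.denseRange_denseSeq P).exists_dist_lt p (ε := e / (8 * (C + 1))) (by positivity)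
    have hCi : C * dist p (q i) ≤ e / 8 := by
      calc _ ≤ (C + 1) * (e / (8 * (C + 1))) := by
            refine mul_le_mul (by linarith) hi.le dist_nonneg (by linarith)
        _ = e / 8 := by field_simp
    have hτσ := hτ.comp hσ.tendsto_atTop
    have e1 : ∀ᶠ n in atTop, τ (σ n) < e / 8 := hτσ.eventually (Iio_mem_nhds (by linarith))
    have e2 : ∀ᶠ n in atTop, dist (F (σ n) (q i)) (a i) < e / 8 :=
      (Metric.tendsto_nhds.1 (ha i)) (e / 8) (by linarith)
    obtain ⟨N, hN⟩ := eventually_atTop.1 (e1.and e2)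
    refine ⟨N, fun n hn => ?_⟩
    have k : ∀ m ≥ N, dist (F (σ m) p) (a i) < 3 * e / 8 := by
      intro m hm
      obtain ⟨u1, u2⟩ := hN m hm
      have u3 := hE (σ m) p (q i)
      rw [← dist_eq_norm] at u3
      have := dist_triangle (F (σ m) p) (F (σ m) (q i)) (a i)
      linarith
    have := dist_triangle_right (F (σ n) p) (F (σ N) p) (a i)
    linarith [k n hn, k N le_rfl]
  choose G hG using this
  exact ⟨G, hG⟩

/-- family of approximate flows -/
structure Fam (γ κ c lam R : ℝ) (φ : Eu d → ℝ) (η ε L δ : ℕ → ℝ) (H : ℕ → ℝ → ℝ) (M : ℕ → ℕ)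
    (Φ J : ℕ → ℕ → Eu d → ℝ) (X : ℕ → ℕ → Eu d → Eu d) : Prop where
  η0 : Tendsto η atTop (𝓝 0)
  εpos : ∀ n, 0 < ε n
  εη : ∀ n, ε n ≤ η n
  cut : ∀ n, Cut (ε n) (L n) (H n)
  apx : ∀ n, Apx (H n) γ κ c lam R (η n) (δ n) (M n) (Φ n) (J n) (X n)
  ini : ∀ n x, |Φ n 0 x - φ x| ≤ η n

variable {γ κ c lam R : ℝ} {φ : Eu d → ℝ} {η ε L δ : ℕ → ℝ} {H : ℕ → ℝ → ℝ} {M : ℕ → ℕ}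
    {Φ J : ℕ → ℕ → Eu d → ℝ} {X : ℕ → ℕ → Eu d → Eu d}

lemma Fam.sub (f : Fam γ κ c lam R φ η ε L δ H M Φ J X) {σ : ℕ → ℕ} (hσ : StrictMono σ) :
    Fam γ κ c lam R φ (η ∘ σ) (ε ∘ σ) (L ∘ σ) (δ ∘ σ) (H ∘ σ) (M ∘ σ) (Φ ∘ σ) (J ∘ σ) (X ∘ σ) :=
  ⟨f.η0.comp hσ.tendsto_atTop, fun n => f.εpos _, fun n => f.εη _, fun n => f.cut _, fun n => f.apx _,
    fun n => f.ini _⟩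

lemma fam_ex (hd : 1 ≤ d) (h0 : 0 < γ) (h1 : γ < 1) (κ : ℝ) (hc : 0 < c) (hc1 : c ≤ 1) {lam0 R0 : ℝ}
    (hl0 : 0 ≤ lam0) (hR0 : 1 ≤ R0) {D : Set (Eu d)} (hI : Ini γ c lam0 R0 D φ) :
    ∃ (lam R : ℝ) (η ε L δ : ℕ → ℝ) (H : ℕ → ℝ → ℝ) (M : ℕ → ℕ)
    (Φ J : ℕ → ℕ → Eu d → ℝ) (X : ℕ → ℕ → Eu d → Eu d), 0 ≤ lam ∧ 1 ≤ R ∧ Fam γ κ c lam R φ η ε L δ H M Φ J X := by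
  obtain ⟨lam, R, hl, hR, hA⟩ := approx (d := d) hd h0 h1 κ hc hc1 hl0 hR0
  have hη : ∀ n : ℕ, 0 < 1 / ((n:ℝ) + 1) := fun n => by positivity
  choose ε L H Φ0 e1 e2 e3 e4 e5 e6 using fun n : ℕ => hI.apx (1 / ((n:ℝ) + 1)) (hη n)
  choose δ M Φ J X a1 a2 using fun n : ℕ => hA (H n) (ε n) (L n) (e4 n) (e3 n) (Φ0 n) (fun h => e6 n κ h) _ (hη n)
  refine ⟨lam, R, fun n => 1 / ((n:ℝ) + 1), ε, L, δ, H, M, Φ, J, X, hl, hR, tendsto_one_div_add_atTop_nhds_zero_nat,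
    e1, e2, e4, a2, fun n x => ?_⟩
  rw [a1]; exact e5 n x

/-- speed bound -/
noncomputable def VV (d : ℕ) (κ R : ℝ) : ℝ := |κ| * cS d 1 R

lemma VV_nonneg (hR : 1 ≤ R) : 0 ≤ VV d κ R := mul_nonneg (abs_nonneg _) (cS_nonneg one_pos (by linarith))

lemma Fam.incr (f : Fam γ κ c lam R φ η ε L δ H M Φ J X) {n k : ℕ} (hk : k < M n) (α : Eu d) :
    X n (k + 1) α - X n k α = ((1:ℝ) / M n) • (κ • vel (δ n) (H n ∘ Φ n k) (X n k α)) := by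
  rw [(f.apx n).step k hk α, Fs, add_sub_cancel_left]

lemma Fam.vel_le (f : Fam γ κ c lam R φ η ε L δ H M Φ J X) (hd : 1 ≤ d) (hR : 1 ≤ R) {n k : ℕ} (hk : k ≤ M n) (x : Eu d) :
    ‖κ • vel (δ n) (H n ∘ Φ n k) x‖ ≤ VV d κ R := by
  rw [norm_smul, Real.norm_eq_abs]
  exact mul_le_mul_of_nonneg_left (norm_vel_le hd (f.apx n).hδ (by linarith) ((f.apx n).st k hk).dens x) (abs_nonneg _)

lemma Fam.dist_le (f : Fam γ κ c lam R φ η ε L δ H M Φ J X) {n : ℕ} {α v : Eu d} {e : ℝ} {k : ℕ} (l : ℕ)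
    (hl : k + l ≤ M n)
    (hv : ∀ i, k ≤ i → i < k + l → ‖κ • vel (δ n) (H n ∘ Φ n i) (X n i α) - v‖ ≤ e) :
    ‖X n (k + l) α - X n k α - ((l:ℝ) / M n) • v‖ ≤ e * (l / M n) := by
  induction l with
  | zero => simp
  | succ l ih =>
    have a := ih (by omega) (fun i h1 h2 => hv i h1 (by omega))
    have b := f.incr (n := n) (k := k + l) (by omega) α
    have c := hv (k + l) (by omega) (by omega)
    have hM : (0:ℝ) < M n := by exact_mod_cast (f.apx n).hM
    have e1 : X n (k + (l + 1)) α - X n k α - ((↑(l + 1) : ℝ) / M n) • v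
        = (X n (k + l) α - X n k α - ((l:ℝ) / M n) • v)
          + ((1:ℝ) / M n) • (κ • vel (δ n) (H n ∘ Φ n (k + l)) (X n (k + l) α) - v) := by
      rw [smul_sub, ← b, ← add_assoc k l 1]
      push_cast
      rw [add_div, add_smul]
      abel
    rw [e1]
    refine (norm_add_le _ _).trans ?_
    rw [norm_smul ((1:ℝ) / M n), Real.norm_of_nonneg (by positivity : (0:ℝ) ≤ 1 / M n)]
    have c' := mul_le_mul_of_nonneg_left c (by positivity : (0:ℝ) ≤ 1 / M n)
    have : e * (((l + 1 : ℕ) : ℝ) / M n) = e * (l / M n) + 1 / M n * e := by push_cast; ring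
    linarith

lemma Fam.time (f : Fam γ κ c lam R φ η ε L δ H M Φ J X) (hd : 1 ≤ d) (hR : 1 ≤ R) {n j k : ℕ} (hj : j ≤ M n) (hk : k ≤ M n)
    (α : Eu d) : ‖X n j α - X n k α‖ ≤ VV d κ R * |(j:ℝ) / M n - (k:ℝ) / M n| := by
  have key : ∀ j k : ℕ, j ≤ M n → k ≤ j → ‖X n j α - X n k α‖ ≤ VV d κ R * |(j:ℝ) / M n - (k:ℝ) / M n| := by
    intro j k hj hkj
    obtain ⟨l, rfl⟩ := Nat.exists_eq_add_of_le hkj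
    have a := f.dist_le (n := n) (α := α) (v := 0) (e := VV d κ R) l hj (fun i h1 h2 => by
      rw [sub_zero]; exact f.vel_le hd hR (by omega) _)
    rw [smul_zero, sub_zero] at a
    have : |((k + l : ℕ) : ℝ) / M n - (k:ℝ) / M n| = l / M n := by
      rw [← sub_div]; push_cast; rw [add_sub_cancel_left, abs_of_nonneg (by positivity)]
    rw [this]; exact a
  rcases le_total k j with h | h
  · exact key j k hj h
  · rw [norm_sub_rev, abs_sub_comm]; exact key k j hk h

/-- joint filter in index and discrete time -/
noncomputable def Ft (M : ℕ → ℕ) (t : ℝ) : Filter (ℕ × ℕ) :=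
  comap Prod.fst atTop ⊓ comap (fun p : ℕ × ℕ => (p.2 : ℝ) / M p.1) (𝓝 t) ⊓ 𝓟 {p | p.2 ≤ M p.1}

instance (M : ℕ → ℕ) (t : ℝ) : (Ft M t).IsCountablyGenerated := by unfold Ft; infer_instance

lemma Ft_fst (M : ℕ → ℕ) (t : ℝ) : Tendsto Prod.fst (Ft M t) atTop :=
  tendsto_comap.mono_left (inf_le_left.trans inf_le_left)

lemma Ft_time (M : ℕ → ℕ) (t : ℝ) : Tendsto (fun p : ℕ × ℕ => (p.2 : ℝ) / M p.1) (Ft M t) (𝓝 t) :=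
  tendsto_comap.mono_left (inf_le_left.trans inf_le_right)

lemma Ft_le (M : ℕ → ℕ) (t : ℝ) : ∀ᶠ p in Ft M t, p.2 ≤ M p.1 :=
  (inf_le_right : Ft M t ≤ _) (mem_principal_self _)

lemma floor_le_M {m : ℕ} {t : ℝ} (ht : t ∈ Icc (0:ℝ) 1) : ⌊t * m⌋₊ ≤ m := by
  refine Nat.floor_le_of_le ?_
  exact mul_le_of_le_one_left (Nat.cast_nonneg _) ht.2

lemma floor_near {m : ℕ} (hm : 0 < m) {t : ℝ} (ht : t ∈ Icc (0:ℝ) 1) : |(⌊t * m⌋₊ : ℝ) / m - t| ≤ 1 / m := by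
  have hm' : (0:ℝ) < m := by exact_mod_cast hm
  have a := Nat.floor_le (mul_nonneg ht.1 hm'.le)
  have b := Nat.lt_floor_add_one (t * m)
  have e : (⌊t * m⌋₊ : ℝ) / m - t = ((⌊t * m⌋₊ : ℝ) - t * m) / m := by field_simp
  rw [e, abs_div, abs_of_pos hm']
  gcongr
  rw [abs_le]; constructor <;> linarith

lemma Fam.M0 (f : Fam γ κ c lam R φ η ε L δ H M Φ J X) : Tendsto (fun n => (1:ℝ) / M n) atTop (𝓝 0) :=
  squeeze_zero (fun n => by positivity) (fun n => (f.apx n).hMη) f.η0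

lemma Fam.floor (f : Fam γ κ c lam R φ η ε L δ H M Φ J X) {t : ℝ} (ht : t ∈ Icc (0:ℝ) 1) :
    Tendsto (fun n => (n, ⌊t * M n⌋₊)) atTop (Ft M t) := by
  refine tendsto_inf.2 ⟨tendsto_inf.2 ⟨tendsto_comap_iff.2 tendsto_id, tendsto_comap_iff.2 ?_⟩,
    tendsto_principal.2 (Eventually.of_forall fun n => floor_le_M ht)⟩
  rw [tendsto_iff_dist_tendsto_zero]
  refine squeeze_zero (fun n => dist_nonneg) (fun n => ?_) f.M0
  exact floor_near (f.apx n).hM ht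

lemma Fam.neBot (f : Fam γ κ c lam R φ η ε L δ H M Φ J X) {t : ℝ} (ht : t ∈ Icc (0:ℝ) 1) : (Ft M t).NeBot :=
  (f.floor ht).neBot

lemma Fam.conv (f : Fam γ κ c lam R φ η ε L δ H M Φ J X) (hd : 1 ≤ d) (hR : 1 ≤ R) :
    ∃ σ : ℕ → ℕ, StrictMono σ ∧ ∃ Y : Eu d → ℝ → Eu d, ∀ α, ∀ t ∈ Icc (0:ℝ) 1,
      Tendsto (fun p : ℕ × ℕ => (X ∘ σ) p.1 p.2 α) (Ft (M ∘ σ) t) (𝓝 (Y α t)) := by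
  have hV := VV_nonneg (d := d) (κ := κ) hR
  have key : ∀ n (p q : Eu d × Icc (0:ℝ) 1), ‖X n ⌊p.2.1 * M n⌋₊ p.1 - X n ⌊q.2.1 * M n⌋₊ q.1‖
      ≤ (Real.exp lam + VV d κ R) * dist p q + 2 * VV d κ R * ((1:ℝ) / M n) := by
    intro n p q
    have a := (f.apx n).lip _ (floor_le_M (m := M n) p.2.2) p.1 q.1
    have b := f.time (n := n) hd hR (floor_le_M (m := M n) p.2.2) (floor_le_M (m := M n) q.2.2) q.1
    have c1 := floor_near (f.apx n).hM p.2.2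
    have c2 := floor_near (f.apx n).hM q.2.2
    have d1 : ‖p.1 - q.1‖ ≤ dist p q := by rw [← dist_eq_norm]; exact le_max_left _ _
    have d2 : |p.2.1 - q.2.1| ≤ dist p q := le_max_right _ _
    have c3 : |(⌊p.2.1 * M n⌋₊ : ℝ) / M n - (⌊q.2.1 * M n⌋₊ : ℝ) / M n| ≤ dist p q + 2 * (1 / M n) := by
      have e : (⌊p.2.1 * M n⌋₊ : ℝ) / M n - (⌊q.2.1 * M n⌋₊ : ℝ) / M n
        = ((⌊p.2.1 * M n⌋₊ : ℝ) / M n - p.2.1) + (p.2.1 - q.2.1) - ((⌊q.2.1 * M n⌋₊ : ℝ) / M n - q.2.1) := by ring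
      rw [e]
      have := abs_sub (((⌊p.2.1 * M n⌋₊ : ℝ) / M n - p.2.1) + (p.2.1 - q.2.1)) ((⌊q.2.1 * M n⌋₊ : ℝ) / M n - q.2.1)
      have := abs_add_le ((⌊p.2.1 * M n⌋₊ : ℝ) / M n - p.2.1) (p.2.1 - q.2.1)
      linarith
    have t := norm_sub_le_norm_sub_add_norm_sub (X n ⌊p.2.1 * M n⌋₊ p.1) (X n ⌊p.2.1 * M n⌋₊ q.1) (X n ⌊q.2.1 * M n⌋₊ q.1)
    have a' := mul_le_mul_of_nonneg_left d1 (Real.exp_pos lam).le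
    have b' := mul_le_mul_of_nonneg_left c3 hV
    linarith
  have : Nonempty (Icc (0:ℝ) 1) := ⟨⟨0, by simp⟩⟩
  obtain ⟨σ, hσ, G, hG⟩ := seq_extract (P := Eu d × Icc (0:ℝ) 1) (fun n p => X n ⌊p.2.1 * M n⌋₊ p.1) (fun p => by
      refine ⟨‖p.1‖ + VV d κ R, fun n => ?_⟩
      have b := f.time (n := n) hd hR (floor_le_M (m := M n) p.2.2) (Nat.zero_le _) p.1
      rw [(f.apx n).X0] at b
      have hM : (0:ℝ) < M n := by exact_mod_cast (f.apx n).hM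
      have : |(⌊p.2.1 * M n⌋₊ : ℝ) / M n - ((0:ℕ):ℝ) / M n| ≤ 1 := by
        rw [Nat.cast_zero, zero_div, sub_zero, abs_of_nonneg (by positivity), div_le_one hM]
        exact_mod_cast floor_le_M p.2.2
      have b' := mul_le_mul_of_nonneg_left this hV
      have := norm_sub_norm_le (X n ⌊p.2.1 * M n⌋₊ p.1) p.1
      linarith) (by positivity) (τ := fun n => 2 * VV d κ R * ((1:ℝ) / M n))
      (by simpa using f.M0.const_mul (2 * VV d κ R)) key
  refine ⟨σ, hσ, fun α t => if ht : t ∈ Icc (0:ℝ) 1 then G (α, ⟨t, ht⟩) else 0, fun α t ht => ?_⟩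
  simp only [dif_pos ht]
  have g := f.sub hσ
  have h1 : Tendsto (fun p : ℕ × ℕ => (X ∘ σ) p.1 ⌊t * (M ∘ σ) p.1⌋₊ α) (Ft (M ∘ σ) t) (𝓝 (G (α, ⟨t, ht⟩))) :=
    (hG (α, ⟨t, ht⟩)).comp (Ft_fst _ _)
  have h2 : Tendsto (fun p : ℕ × ℕ => (X ∘ σ) p.1 p.2 α - (X ∘ σ) p.1 ⌊t * (M ∘ σ) p.1⌋₊ α) (Ft (M ∘ σ) t) (𝓝 0) := by
    have h3 : Tendsto (fun p : ℕ × ℕ => VV d κ R * (|(p.2 : ℝ) / (M ∘ σ) p.1 - t| + 1 / (M ∘ σ) p.1)) (Ft (M ∘ σ) t) (𝓝 0) := by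
      have a := (((Ft_time (M ∘ σ) t).sub_const t).abs.add (g.M0.comp (Ft_fst _ t))).const_mul (VV d κ R)
      simpa using a
    refine squeeze_zero_norm' ?_ h3
    filter_upwards [Ft_le (M ∘ σ) t] with p hp
    refine (g.time hd hR hp (floor_le_M ht) α).trans (mul_le_mul_of_nonneg_left ?_ hV)
    have c1 := floor_near (g.apx p.1).hM ht
    have := abs_sub ((p.2 : ℝ) / (M ∘ σ) p.1 - t) ((⌊t * (M ∘ σ) p.1⌋₊ : ℝ) / (M ∘ σ) p.1 - t)
    rw [sub_sub_sub_cancel_right] at this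
    linarith
  simpa using h2.add h1

end AggPatch

namespace AggPatch
open MeasureTheory Metric Set Filter Topology
open scoped RealInnerProductSpace
variable {d : ℕ}
variable {γ κ c lam R : ℝ} {φ : Eu d → ℝ} {η ε L δ : ℕ → ℝ} {H : ℕ → ℝ → ℝ} {M : ℕ → ℕ}
    {Φ J : ℕ → ℕ → Eu d → ℝ} {X : ℕ → ℕ → Eu d → Eu d} {Y : Eu d → ℝ → Eu d} {t : ℝ}

/-- convergence of the discrete flows -/
def LimY (M : ℕ → ℕ) (X : ℕ → ℕ → Eu d → Eu d) (Y : Eu d → ℝ → Eu d) : Prop :=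
  ∀ α, ∀ t ∈ Icc (0:ℝ) 1, Tendsto (fun p : ℕ × ℕ => X p.1 p.2 α) (Ft M t) (𝓝 (Y α t))

lemma LimY.seq (g : LimY M X Y) (f : Fam γ κ c lam R φ η ε L δ H M Φ J X) (ht : t ∈ Icc (0:ℝ) 1) (α : Eu d) :
    Tendsto (fun n => X n ⌊t * M n⌋₊ α) atTop (𝓝 (Y α t)) := (g α t ht).comp (f.floor ht)

lemma LimY.zero (g : LimY M X Y) (f : Fam γ κ c lam R φ η ε L δ H M Φ J X) (α : Eu d) : Y α 0 = α := by
  have a := g.seq f (t := 0) (by simp) α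
  refine tendsto_nhds_unique a ?_
  simp only [zero_mul, Nat.floor_zero, (f.apx _).X0]
  exact tendsto_const_nhds

lemma LimY.lip (g : LimY M X Y) (f : Fam γ κ c lam R φ η ε L δ H M Φ J X) (ht : t ∈ Icc (0:ℝ) 1) (x y : Eu d) :
    ‖Y x t - Y y t‖ ≤ Real.exp lam * ‖x - y‖ :=
  le_of_tendsto ((g.seq f ht x).sub (g.seq f ht y)).norm
    (Eventually.of_forall fun n => (f.apx n).lip _ (floor_le_M ht) x y)

lemma LimY.low (g : LimY M X Y) (f : Fam γ κ c lam R φ η ε L δ H M Φ J X) (ht : t ∈ Icc (0:ℝ) 1) (x y : Eu d) :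
    ‖x - y‖ ≤ Real.exp lam * ‖Y x t - Y y t‖ :=
  ge_of_tendsto (((g.seq f ht x).sub (g.seq f ht y)).norm.const_mul (Real.exp lam))
    (Eventually.of_forall fun n => (f.apx n).low _ (floor_le_M ht) x y)

lemma Fam.disp (f : Fam γ κ c lam R φ η ε L δ H M Φ J X) (hd : 1 ≤ d) (hR : 1 ≤ R) (ht : t ∈ Icc (0:ℝ) 1) (n : ℕ)
    (α : Eu d) : ‖X n ⌊t * M n⌋₊ α - α‖ ≤ VV d κ R := by
  have b := f.time (n := n) hd hR (floor_le_M (m := M n) ht) (Nat.zero_le _) α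
  rw [(f.apx n).X0] at b
  have hM : (0:ℝ) < M n := by exact_mod_cast (f.apx n).hM
  have : |(⌊t * M n⌋₊ : ℝ) / M n - ((0:ℕ):ℝ) / M n| ≤ 1 := by
    rw [Nat.cast_zero, zero_div, sub_zero, abs_of_nonneg (by positivity), div_le_one hM]
    exact_mod_cast floor_le_M ht
  have b' := mul_le_mul_of_nonneg_left this (VV_nonneg (d := d) (κ := κ) hR)
  linarith

lemma LimY.surj (g : LimY M X Y) (f : Fam γ κ c lam R φ η ε L δ H M Φ J X) (hd : 1 ≤ d) (hR : 1 ≤ R)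
    (ht : t ∈ Icc (0:ℝ) 1) (y : Eu d) : ∃ α, Y α t = y := by
  choose a ha using fun n => ((f.apx n).bij _ (floor_le_M (m := M n) ht)).2 y
  have hb : ∀ n, a n ∈ closedBall y (Real.exp lam * VV d κ R) := by
    intro n
    rw [mem_closedBall, dist_eq_norm]
    refine ((f.apx n).low _ (floor_le_M (m := M n) ht) (a n) y).trans ?_
    rw [ha, norm_sub_rev]
    exact mul_le_mul_of_nonneg_left (f.disp hd hR ht n y) (Real.exp_pos _).le
  obtain ⟨α, -, σ, hσ, hα⟩ := (isCompact_closedBall y _).tendsto_subseq hb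
  refine ⟨α, ?_⟩
  have h1 := (g.seq f ht α).comp hσ.tendsto_atTop
  refine tendsto_nhds_unique h1 ?_
  rw [tendsto_iff_norm_sub_tendsto_zero]
  have h2 : Tendsto (fun n => Real.exp lam * ‖α - a (σ n)‖) atTop (𝓝 0) := by
    have := (((tendsto_const_nhds (x := α)).sub hα).norm).const_mul (Real.exp lam)
    simpa using this
  refine squeeze_zero (fun _ => norm_nonneg _) (fun n => ?_) h2
  have := (f.apx (σ n)).lip _ (floor_le_M (m := M (σ n)) ht) α (a (σ n))
  rw [ha] at this
  exact this

lemma LimY.homeo (g : LimY M X Y) (f : Fam γ κ c lam R φ η ε L δ H M Φ J X) (hd : 1 ≤ d) (hR : 1 ≤ R)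
    (ht : t ∈ Icc (0:ℝ) 1) : ∃ h : Eu d ≃ₜ Eu d, ∀ α, h α = Y α t := by
  have inj : Function.Injective (fun α => Y α t) := by
    intro x y hxy
    have := g.low f ht x y
    simp only at hxy
    rw [hxy, sub_self, norm_zero, mul_zero] at this
    exact sub_eq_zero.1 (norm_le_zero_iff.1 this)
  have hE : (0:ℝ) ≤ Real.exp lam := (Real.exp_pos _).le
  let e := Equiv.ofBijective (fun α => Y α t) ⟨inj, g.surj f hd hR ht⟩
  have he : ∀ α, e α = Y α t := fun α => rfl
  have c1 : Continuous e := (LipschitzWith.of_dist_le_mul (K := ⟨Real.exp lam, hE⟩) (fun x y => by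
    rw [dist_eq_norm, dist_eq_norm]; exact g.lip f ht x y)).continuous
  have c2 : Continuous e.symm := (LipschitzWith.of_dist_le_mul (K := ⟨Real.exp lam, hE⟩) (fun x y => by
    rw [dist_eq_norm, dist_eq_norm]
    have := g.low f ht (e.symm x) (e.symm y)
    rw [← he, ← he, e.apply_symm_apply, e.apply_symm_apply] at this
    exact this)).continuous
  exact ⟨⟨e, c1, c2⟩, fun α => rfl⟩

lemma LimY.phi (g : LimY M X Y) (f : Fam γ κ c lam R φ η ε L δ H M Φ J X) (ht : t ∈ Icc (0:ℝ) 1) {α : Eu d}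
    {y : ℕ × ℕ → Eu d} (hy : Tendsto y (Ft M t) (𝓝 (Y α t))) :
    Tendsto (fun p => Φ p.1 p.2 (y p)) (Ft M t) (𝓝 (φ α)) := by
  rw [tendsto_iff_norm_sub_tendsto_zero]
  have h1 : Tendsto (fun p : ℕ × ℕ => Real.exp (2 * lam) * ‖y p - X p.1 p.2 α‖ + η p.1) (Ft M t) (𝓝 0) := by
    have := (((hy.sub (g α t ht)).norm).const_mul (Real.exp (2 * lam))).add (f.η0.comp (Ft_fst M t))
    simpa using this
  refine squeeze_zero' (Eventually.of_forall fun _ => norm_nonneg _) ?_ h1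
  filter_upwards [Ft_le M t] with p hp
  have a := ((f.apx p.1).st _ hp).lip (X p.1 p.2 α) (y p)
  rw [(f.apx p.1).lab _ hp] at a
  have b := f.ini p.1 α
  have := abs_add_le (Φ p.1 p.2 (y p) - Φ p.1 0 α) (Φ p.1 0 α - φ α)
  rw [sub_add_sub_cancel] at this
  rw [Real.norm_eq_abs]
  linarith

lemma LimY.rho (g : LimY M X Y) (f : Fam γ κ c lam R φ η ε L δ H M Φ J X) (ht : t ∈ Icc (0:ℝ) 1) {α : Eu d}
    (h0 : φ α ≠ 0) {y : ℕ × ℕ → Eu d} (hy : Tendsto y (Ft M t) (𝓝 (Y α t))) :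
    Tendsto (fun p => H p.1 (Φ p.1 p.2 (y p))) (Ft M t) (𝓝 (if φ α < 0 then 1 else 0)) := by
  have hp := g.phi f ht hy
  refine tendsto_const_nhds.congr' ?_
  split_ifs with h
  · have e : Tendsto (fun p : ℕ × ℕ => Φ p.1 p.2 (y p) + η p.1) (Ft M t) (𝓝 (φ α + 0)) := hp.add (f.η0.comp (Ft_fst M t))
    rw [add_zero] at e
    filter_upwards [e.eventually (Iio_mem_nhds h)] with p hp
    have := f.εη p.1
    have hp2 : Φ p.1 p.2 (y p) + η p.1 < 0 := hp
    exact ((f.cut p.1).one _ (by linarith)).symm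
  · have h : 0 < φ α := lt_of_le_of_ne (not_lt.1 h) (Ne.symm h0)
    filter_upwards [hp.eventually (Ioi_mem_nhds h)] with p hp
    exact ((f.cut p.1).zero _ (le_of_lt hp)).symm

lemma uu_tend {ι : Type*} {l : Filter ι} {δ : ι → ℝ} (hδ : Tendsto δ l (𝓝 0)) {z : Eu d} (hz : z ≠ 0) :
    Tendsto (fun i => kk d (δ i) z) l (𝓝 (kk d 0 z)) := by
  unfold kk uu
  refine Tendsto.smul_const (Tendsto.pow (Tendsto.inv₀ ?_ ?_) d) z
  · exact (Real.continuous_sqrt.tendsto _).comp ((hδ.pow 2).const_add _)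
  · have := norm_pos_iff.2 hz
    have : 0 < √(‖z‖ ^ 2 + 0 ^ 2) := Real.sqrt_pos.2 (by positivity)
    exact this.ne'

lemma vel_tend {ι : Type*} {l : Filter ι} [l.IsCountablyGenerated] (hd : 1 ≤ d) (hR : 0 < R) {δ : ι → ℝ} (hδ : Tendsto δ l (𝓝 0))
    {x : ι → Eu d} {x0 : Eu d} (hx : Tendsto x l (𝓝 x0)) {ρ : ι → Eu d → ℝ} {χ : Eu d → ℝ}
    (hρ : ∀ᶠ i in l, Dens R (ρ i) ∧ 0 < δ i)
    (hl : ∀ᵐ y, ∀ y' : ι → Eu d, Tendsto y' l (𝓝 y) → Tendsto (fun i => ρ i (y' i)) l (𝓝 (χ y))) :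
    Tendsto (fun i => vel (δ i) (ρ i) (x i)) l (𝓝 (∫ y, χ y • kk d 0 (x0 - y))) := by
  have s : ∀ (δ : ℝ) (ρ : Eu d → ℝ) (x : Eu d), ∫ y, ρ y • kk d δ (x - y) = ∫ z, ρ (x - z) • kk d δ z := by
    intro δ ρ x
    have := integral_sub_left_eq_self (fun y => ρ y • kk d δ (x - y)) volume x
    simp only [sub_sub_cancel] at this
    exact this.symm
  simp only [vel, s]
  set R' := R + ‖x0‖ + 1 with hR'
  have hR'0 : 0 < R' := by positivity
  have hx1 : ∀ᶠ i in l, ‖x i‖ < ‖x0‖ + 1 := hx.norm.eventually (Iio_mem_nhds (by linarith))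
  refine tendsto_integral_filter_of_dominated_convergence (gM d 1 R' 0) ?_ ?_ (gM_int hd one_pos hR'0 0).1 ?_
  · filter_upwards [hρ] with i hi
    refine Continuous.aestronglyMeasurable ?_
    have c1 : Continuous fun z => ρ i (x i - z) := hi.1.smooth.continuous.comp (continuous_const.sub continuous_id)
    exact c1.smul (continuous_kk hi.2)
  · filter_upwards [hρ, hx1] with i hi hxi
    filter_upwards [ae_ne hd (0 : Eu d)] with z hz
    have hz : z ≠ 0 := by simpa using hz
    by_cases hm : x i - z ∈ closedBall (0 : Eu d) R
    · have hz1 : z ∈ closedBall (0 : Eu d) R' := by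
        rw [mem_closedBall_zero_iff] at hm ⊢
        have := norm_sub_le (x i) (x i - z)
        rw [sub_sub_cancel] at this
        linarith
      have a := le_gM (s := 1) hR'0 (by exact_mod_cast hd) (x := 0) hz1
      rw [zero_sub, norm_neg] at a
      refine le_trans ?_ a
      rw [norm_smul, Real.norm_of_nonneg (hi.1.nonneg _)]
      exact (mul_le_of_le_one_left (norm_nonneg _) (hi.1.le_one _)).trans (kk_le_rpow hd hi.2 hz)
    · rw [hi.1.supp _ hm, zero_smul, norm_zero]
      exact gM_nonneg hR'0 _ _
  · have q := (quasiMeasurePreserving_sub_left (volume : Measure (Eu d)) x0).ae hl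
    filter_upwards [q, ae_ne hd (0 : Eu d)] with z hz1 hz2
    have hz : z ≠ 0 := by simpa using hz2
    exact (hz1 (fun i => x i - z) (hx.sub_const z)).smul (uu_tend hδ hz)

end AggPatch

namespace AggPatch
open MeasureTheory Metric Set Filter Topology
open scoped RealInnerProductSpace
variable {d : ℕ}

lemma pow_bd {a x : ℝ} {k m : ℕ} (hm : 0 < m) (hk : k ≤ m) (ha : 0 ≤ a) (hx : |x| ≤ a / m) (hs : a / m ≤ 1 / 2) :
    Real.exp (-(2 * a)) ≤ (1 + x) ^ k ∧ (1 + x) ^ k ≤ Real.exp a := by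
  have hm' : (0:ℝ) < m := by exact_mod_cast hm
  have hk' : (k:ℝ) ≤ m := by exact_mod_cast hk
  obtain ⟨x1, x2⟩ := abs_le.1 hx
  set b := a / m with hb
  have hb0 : 0 ≤ b := by positivity
  have hkb : k * b ≤ a := by
    calc k * b ≤ m * b := by gcongr
      _ = a := by rw [hb]; field_simp
  constructor
  · have h1 : Real.exp (-(2 * b)) ≤ 1 + x := by
      rw [Real.exp_neg]
      have e := Real.add_one_le_exp (2 * b)
      refine (inv_anti₀ (by linarith) e).trans ?_
      rw [inv_le_iff_one_le_mul₀ (by linarith)]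
      nlinarith
    calc Real.exp (-(2 * a)) ≤ Real.exp (k * (-(2 * b))) := Real.exp_le_exp.2 (by linarith)
      _ = Real.exp (-(2 * b)) ^ k := by rw [Real.exp_nat_mul]
      _ ≤ (1 + x) ^ k := by gcongr
  · calc (1 + x) ^ k ≤ (Real.exp b) ^ k := by
          have e := Real.add_one_le_exp b
          exact pow_le_pow_left₀ (by linarith) (by linarith) k
      _ = Real.exp (k * b) := by rw [Real.exp_nat_mul]
      _ ≤ Real.exp a := Real.exp_le_exp.2 hkb

lemma int_q {q : ℝ → ℝ} (hq : Continuous q) {p1 p2 : ℝ} (h1 : ∀ s, p1 ≤ q s) (h2 : ∀ s, q s ≤ p2) (s : ℝ) :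
    ∃ r ∈ Icc p1 p2, ∫ u in (0:ℝ)..s, q u = r * s := by
  have hh : ∀ s : ℝ, ∫ u in (0:ℝ)..s, q u = (∫ v in (0:ℝ)..1, q (v * s)) * s := by
    intro s
    have := intervalIntegral.smul_integral_comp_mul_right (a := 0) (b := 1) q s
    simp only [zero_mul, one_mul, smul_eq_mul] at this
    rw [← this, mul_comm]
  have hc : Continuous fun v => q (v * s) := hq.comp (continuous_id.mul continuous_const)
  refine ⟨_, ⟨?_, ?_⟩, hh s⟩
  · have := intervalIntegral.integral_mono_on (μ := volume) (a := 0) (b := 1) zero_le_one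
      (intervalIntegrable_const (c := p1)) (hc.intervalIntegrable 0 1) (fun x _ => h1 _)
    simpa using this
  · have := intervalIntegral.integral_mono_on (μ := volume) (a := 0) (b := 1) zero_le_one
      (hc.intervalIntegrable 0 1) (intervalIntegrable_const (c := p2)) (fun x _ => h2 _)
    simpa using this

lemma psi_ex {H : ℝ → ℝ} {γ κ c lam R e ε L : ℝ} {k m : ℕ} {Φ J : Eu d → ℝ} (h0 : 0 < γ) (hm : 0 < m) (hk : k ≤ m)
    (hs : |κ| * mass d / m ≤ 1 / 2) (hH : Cut ε L H) (s : St H γ κ (1 / m) c lam R e k Φ J) :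
    ∃ r : Eu d → ℝ, (∀ x, r x ∈ Icc (Real.exp (-(2 * (|κ| * mass d)))) (Real.exp (|κ| * mass d))) ∧
      ∀ x y, |r y * Φ y - r x * Φ x - ⟪Yf J Φ x, y - x⟫| ≤ (e * Real.exp (2 * lam) + Real.exp lam * ‖y - x‖ ^ γ) * ‖y - x‖ := by
  have hmm := mass_nonneg d
  set q : ℝ → ℝ := fun u => (1 + 1 / (m:ℝ) * (κ * (mass d * H u))) ^ k with hq
  have hqc : Continuous q := by
    have := hH.smooth.continuous
    rw [hq]; fun_prop
  have hb : ∀ u, Real.exp (-(2 * (|κ| * mass d))) ≤ q u ∧ q u ≤ Real.exp (|κ| * mass d) := by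
    intro u
    refine pow_bd hm hk (by positivity) ?_ hs
    have h1 := hH.nonneg u
    have h2 := hH.le_one u
    rw [abs_mul, abs_mul, abs_mul, abs_of_nonneg h1, abs_of_nonneg hmm, abs_of_nonneg (by positivity : (0:ℝ) ≤ 1 / m)]
    calc 1 / (m:ℝ) * (|κ| * (mass d * H u)) ≤ 1 / (m:ℝ) * (|κ| * (mass d * 1)) := by gcongr
      _ = _ := by ring
  choose r hr1 hr2 using int_q hqc (fun u => (hb u).1) (fun u => (hb u).2)
  refine ⟨fun x => r (Φ x), fun x => hr1 _, fun x y => ?_⟩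
  simp only [← hr2]
  have hder : ∀ z, HasFDerivAt (fun z => ∫ u in (0:ℝ)..Φ z, q u) (q (Φ z) • fderiv ℝ Φ z) z := by
    intro z
    have a : HasDerivAt (fun w => ∫ u in (0:ℝ)..w, q u) (q (Φ z)) (Φ z) :=
      intervalIntegral.integral_hasDerivAt_right (hqc.intervalIntegrable _ _)
        (hqc.stronglyMeasurableAtFilter _ _) hqc.continuousAt
    exact a.comp_hasFDerivAt z (s.smΦ.differentiable two_ne_zero z).hasFDerivAt
  have he : 0 ≤ e := (abs_nonneg _).trans (s.Jerr 0)
  have key := Convex.norm_image_sub_le_of_norm_hasFDerivWithin_le' (s := segment ℝ x y)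
    (f := fun z => ∫ u in (0:ℝ)..Φ z, q u) (f' := fun z => q (Φ z) • fderiv ℝ Φ z) (φ := innerSL ℝ (Yf J Φ x))
    (C := e * Real.exp (2 * lam) + Real.exp lam * ‖y - x‖ ^ γ) (fun z _ => (hder z).hasFDerivWithinAt)
    (fun z hz => ?_) (convex_segment x y) (left_mem_segment ℝ x y) (right_mem_segment ℝ x y)
  · simpa only [Real.norm_eq_abs, innerSL_apply_apply] using key
  · refine ContinuousLinearMap.opNorm_le_bound _ (by positivity) fun u => ?_
    simp only [_root_.sub_apply, _root_.smul_apply, innerSL_apply_apply, smul_eq_mul]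
    have hzx : ‖z - x‖ ≤ ‖y - x‖ := by
      have := norm_sub_le_of_mem_segment hz
      rw [norm_sub_rev]; simpa [norm_sub_rev] using this
    have e1 : q (Φ z) * fderiv ℝ Φ z u - ⟪Yf J Φ x, u⟫
        = -(J z - q (Φ z)) * fderiv ℝ Φ z u + ⟪Yf J Φ z - Yf J Φ x, u⟫ := by
      rw [inner_sub_left, Yf.eq_1 J Φ z, real_inner_smul_left, inner_grad]; ring
    rw [e1, Real.norm_eq_abs]
    have b1 : |(-(J z - q (Φ z))) * fderiv ℝ Φ z u| ≤ e * (Real.exp (2 * lam) * ‖u‖) := by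
      rw [abs_mul, abs_neg]
      refine mul_le_mul (s.Jerr z) ?_ (abs_nonneg _) he
      exact ((fderiv ℝ Φ z).le_opNorm u).trans (mul_le_mul_of_nonneg_right (s.grad z) (norm_nonneg _))
    have b2 : |⟪Yf J Φ z - Yf J Φ x, u⟫| ≤ Real.exp lam * ‖y - x‖ ^ γ * ‖u‖ := by
      refine (abs_real_inner_le_norm _ _).trans (mul_le_mul_of_nonneg_right ((s.Yhol z x).trans ?_) (norm_nonneg _))
      gcongr
    have := abs_add_le ((-(J z - q (Φ z))) * fderiv ℝ Φ z u) ⟪Yf J Φ z - Yf J Φ x, u⟫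
    calc _ ≤ _ := this
      _ ≤ _ := by rw [add_mul]; linarith

end AggPatch

namespace AggPatch
open MeasureTheory Metric Set Filter Topology
open scoped RealInnerProductSpace
variable {d : ℕ}
variable {γ κ c lam R : ℝ} {φ : Eu d → ℝ} {η ε L δ : ℕ → ℝ} {H : ℕ → ℝ → ℝ} {M : ℕ → ℕ}
    {Φ J : ℕ → ℕ → Eu d → ℝ} {X : ℕ → ℕ → Eu d → Eu d} {Y : Eu d → ℝ → Eu d} {t : ℝ}

lemma ultra_lim {ι E : Type*} [TopologicalSpace E] (U : Ultrafilter ι) {s : Set E} (hs : IsCompact s) {F : ι → E}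
    (hF : ∀ᶠ i in (U : Filter ι), F i ∈ s) : ∃ a ∈ s, Tendsto F U (𝓝 a) := by
  obtain ⟨a, ha, h⟩ := hs.ultrafilter_le_nhds (U.map F) (by
    rw [Ultrafilter.coe_map, le_principal_iff]; exact hF)
  exact ⟨a, ha, h⟩

lemma c1_of_taylor {Ψ : Eu d → ℝ} {V : Eu d → Eu d} {C γ : ℝ} (h0 : 0 < γ) (hC : 0 ≤ C)
    (hT : ∀ x y, |Ψ y - Ψ x - ⟪V x, y - x⟫| ≤ C * ‖y - x‖ ^ γ * ‖y - x‖)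
    (hV : ∀ x y, ‖V x - V y‖ ≤ C * ‖x - y‖ ^ γ) : ContDiff ℝ 1 Ψ ∧ ∀ x, gradient Ψ x = V x := by
  have hlim : ∀ x : Eu d, Tendsto (fun y => C * ‖y - x‖ ^ γ) (𝓝 x) (𝓝 0) := by
    intro x
    have a : Tendsto (fun y : Eu d => ‖y - x‖) (𝓝 x) (𝓝 0) := by
      have : ContinuousAt (fun y : Eu d => ‖y - x‖) x := by fun_prop
      simpa [ContinuousAt] using this
    have b := (a.rpow_const (p := γ) (Or.inr h0.le)).const_mul C
    simpa [Real.zero_rpow h0.ne'] using b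
  have hg : ∀ x, HasGradientAt Ψ (V x) x := by
    intro x
    rw [hasGradientAt_iff_hasFDerivAt, hasFDerivAt_iff_isLittleO, Asymptotics.isLittleO_iff]
    intro e he
    filter_upwards [(hlim x).eventually (Iio_mem_nhds he)] with y hy
    have h1 : (InnerProductSpace.toDual ℝ (Eu d)) (V x) (y - x) = ⟪V x, y - x⟫ := rfl
    rw [h1, Real.norm_eq_abs]
    exact (hT x y).trans (mul_le_mul_of_nonneg_right (le_of_lt hy) (norm_nonneg _))
  refine ⟨?_, fun x => (hg x).gradient⟩
  rw [contDiff_one_iff_fderiv]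
  refine ⟨fun x => (hg x).differentiableAt, ?_⟩
  have e : fderiv ℝ Ψ = fun x => InnerProductSpace.toDual ℝ (Eu d) (V x) := by
    funext x
    exact (hasGradientAt_iff_hasFDerivAt.1 (hg x)).fderiv
  rw [e]
  refine (LinearIsometryEquiv.continuous _).comp ?_
  rw [continuous_iff_continuousAt]
  intro x
  rw [ContinuousAt, tendsto_iff_norm_sub_tendsto_zero]
  exact squeeze_zero (fun _ => norm_nonneg _) (fun y => hV y x) (hlim x)

lemma LimY.dom (g : LimY M X Y) (f : Fam γ κ c lam R φ η ε L δ H M Φ J X) (hd : 1 ≤ d) (hR : 1 ≤ R) (h0 : 0 < γ)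
    (hc : 0 < c) {D : Set (Eu d)} (hDo : IsOpen D) (hDb : Bornology.IsBounded D) (hneg : D = {x | φ x < 0})
    (hfr : frontier D = {x | φ x = 0}) (ht : t ∈ Icc (0:ℝ) 1) :
    IsC1Domain d γ ((fun α => Y α t) '' D) := by
  obtain ⟨h, hh⟩ := g.homeo f hd hR ht
  have hfun : (fun α => Y α t) = h := funext fun α => (hh α).symm
  have hsymm : ∀ y, Y (h.symm y) t = y := fun y => by rw [← hh, h.apply_symm_apply]
  rw [hfun]
  have hNB := f.neBot ht
  set U := Ultrafilter.of (Ft M t) with hU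
  have hUle : (U : Filter (ℕ × ℕ)) ≤ Ft M t := Ultrafilter.of_le _
  have hE := Real.exp_pos lam
  have hmm := mass_nonneg d
  have hsm : ∀ᶠ p in Ft M t, |κ| * mass d / M p.1 ≤ 1 / 2 := by
    have a := (f.M0.comp (Ft_fst M t)).const_mul (|κ| * mass d)
    rw [mul_zero] at a
    filter_upwards [a.eventually (Iio_mem_nhds (by norm_num : (0:ℝ) < 1 / 2))] with p hp
    have hp2 : |κ| * mass d * (1 / (M p.1 : ℝ)) < 1 / 2 := hp
    rw [mul_one_div] at hp2
    exact hp2.le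
  have hex : ∀ p : ℕ × ℕ, ∃ r : Eu d → ℝ, (p.2 ≤ M p.1 ∧ |κ| * mass d / M p.1 ≤ 1 / 2) →
      (∀ x, r x ∈ Icc (Real.exp (-(2 * (|κ| * mass d)))) (Real.exp (|κ| * mass d))) ∧
      ∀ x y, |r y * Φ p.1 p.2 y - r x * Φ p.1 p.2 x - ⟪Yf (J p.1 p.2) (Φ p.1 p.2) x, y - x⟫|
        ≤ (η p.1 * Real.exp (2 * lam) + Real.exp lam * ‖y - x‖ ^ γ) * ‖y - x‖ := by
    intro p
    by_cases hp : p.2 ≤ M p.1 ∧ |κ| * mass d / M p.1 ≤ 1 / 2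
    · obtain ⟨r, hr⟩ := psi_ex h0 (f.apx p.1).hM hp.1 hp.2 (f.cut p.1) ((f.apx p.1).st _ hp.1)
      exact ⟨r, fun _ => hr⟩
    · exact ⟨0, fun h => absurd h hp⟩
  choose r hr using hex
  have hgood : ∀ᶠ p in (U : Filter (ℕ × ℕ)), p.2 ≤ M p.1 ∧ |κ| * mass d / M p.1 ≤ 1 / 2 :=
    hUle ((Ft_le M t).and hsm)
  choose q hq1 hq2 using fun x : Eu d => ultra_lim U (isCompact_Icc (a := Real.exp (-(2 * (|κ| * mass d)))) (b := Real.exp (|κ| * mass d)))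
    (F := fun p => r p x) (hgood.mono fun p hp => (hr p hp).1 x)
  choose V hV1 hV2 using fun x : Eu d => ultra_lim U (isCompact_closedBall (0 : Eu d) (Real.exp lam))
    (F := fun p => Yf (J p.1 p.2) (Φ p.1 p.2) x) (hgood.mono fun p hp => by
      rw [mem_closedBall_zero_iff]; exact ((f.apx p.1).st _ hp.1).Yhi x)
  have hΦ : ∀ x, Tendsto (fun p : ℕ × ℕ => Φ p.1 p.2 x) U (𝓝 (φ (h.symm x))) := by
    intro x
    refine (g.phi f ht (α := h.symm x) (y := fun _ => x) ?_).mono_left hUle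
    rw [hsymm]; exact tendsto_const_nhds
  have hη : Tendsto (fun p : ℕ × ℕ => η p.1) U (𝓝 0) := (f.η0.comp (Ft_fst M t)).mono_left hUle
  have hqp : ∀ x, 0 < q x := fun x => lt_of_lt_of_le (Real.exp_pos _) (hq1 x).1
  set Ψ : Eu d → ℝ := fun x => q x * φ (h.symm x) with hΨ
  have hT : ∀ x y, |Ψ y - Ψ x - ⟪V x, y - x⟫| ≤ Real.exp lam * ‖y - x‖ ^ γ * ‖y - x‖ := by
    intro x y
    have a := ((((hq2 y).mul (hΦ y)).sub ((hq2 x).mul (hΦ x))).sub ((hV2 x).inner (tendsto_const_nhds (x := y - x)))).abs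
    have b := ((hη.mul_const (Real.exp (2 * lam))).add_const (Real.exp lam * ‖y - x‖ ^ γ)).mul_const ‖y - x‖
    rw [zero_mul, zero_add] at b
    exact le_of_tendsto_of_tendsto a b (hgood.mono fun p hp => (hr p hp).2 x y)
  have hV : ∀ x y, ‖V x - V y‖ ≤ Real.exp lam * ‖x - y‖ ^ γ := by
    intro x y
    exact le_of_tendsto ((hV2 x).sub (hV2 y)).norm (hgood.mono fun p hp => ((f.apx p.1).st _ hp.1).Yhol x y)
  obtain ⟨s1, s2⟩ := c1_of_taylor h0 hE.le hT hV
  have hmem : ∀ x, x ∈ h '' D ↔ φ (h.symm x) < 0 := by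
    intro x
    rw [h.image_eq_preimage_symm, mem_preimage, hneg]; rfl
  have hfr2 : frontier (h '' D) = {x | Ψ x = 0} := by
    rw [← h.image_frontier, hfr]
    ext x
    rw [h.image_eq_preimage_symm, mem_preimage]
    show φ (h.symm x) = 0 ↔ q x * φ (h.symm x) = 0
    rw [mul_eq_zero, or_iff_right (hqp x).ne']
  refine ⟨h.isOpenMap D hDo, ?_, Ψ, s1, ⟨Real.exp lam, fun x y => by rw [s2, s2]; exact hV x y⟩, ?_, hfr2, ?_⟩
  · have : IsCompact (closure D) := hDb.isCompact_closure
    exact (this.image h.continuous).isBounded.subset (image_mono subset_closure)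
  · ext x
    rw [hmem]
    show _ ↔ q x * φ (h.symm x) < 0
    rw [mul_neg_iff]
    constructor
    · intro h; exact Or.inl ⟨hqp x, h⟩
    · rintro (h | h)
      · exact h.2
      · exact absurd h.1 (hqp x).not_gt
  · intro x hx
    rw [hfr2] at hx
    have hx0 : φ (h.symm x) = 0 := by
      have : q x * φ (h.symm x) = 0 := hx
      exact (mul_eq_zero.1 this).resolve_left (hqp x).ne'
    rw [s2]
    have hl : Real.exp (-lam) ≤ ‖V x‖ := by
      have a := hΦ x
      rw [hx0] at a
      have b := a.abs
      rw [abs_zero] at b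
      refine ge_of_tendsto (hV2 x).norm ?_
      filter_upwards [hgood, b.eventually (Iio_mem_nhds hc)] with p hp hp2
      exact ((f.apx p.1).st _ hp.1).Ylo x (le_of_lt hp2)
    exact norm_pos_iff.1 (lt_of_lt_of_le (Real.exp_pos _) hl)

lemma null_frontier {D : Set (Eu d)} (hD : IsC1Domain d γ D) : volume (frontier D) = 0 := by
  obtain ⟨-, -, Φ, h1, -, -, h3, h4⟩ := hD
  exact null_zero h1 (fun x hx => by rw [h3] at hx; exact hx) h4

end AggPatch

namespace AggPatch
open MeasureTheory Metric Set Filter Topology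
open scoped RealInnerProductSpace
variable {d : ℕ}
variable {γ κ c lam R : ℝ} {φ : Eu d → ℝ} {η ε L δ : ℕ → ℝ} {H : ℕ → ℝ → ℝ} {M : ℕ → ℕ}
    {Φ J : ℕ → ℕ → Eu d → ℝ} {X : ℕ → ℕ → Eu d → Eu d} {Y : Eu d → ℝ → Eu d} {t : ℝ}

lemma LimY.vlim (g : LimY M X Y) (f : Fam γ κ c lam R φ η ε L δ H M Φ J X) (hd : 1 ≤ d) (hR : 1 ≤ R) (h0 : 0 < γ)
    (hc : 0 < c) {D : Set (Eu d)} (hDo : IsOpen D) (hDb : Bornology.IsBounded D) (hneg : D = {x | φ x < 0})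
    (hfr : frontier D = {x | φ x = 0}) (ht : t ∈ Icc (0:ℝ) 1) (α : Eu d) :
    Tendsto (fun p : ℕ × ℕ => κ • vel (δ p.1) (H p.1 ∘ Φ p.1 p.2) (X p.1 p.2 α)) (Ft M t)
      (𝓝 (κ • ∫ y in (fun α => Y α t) '' D, kk d 0 (Y α t - y))) := by
  have hdom := g.dom f hd hR h0 hc hDo hDb hneg hfr ht
  have hnull := null_frontier hdom
  obtain ⟨h, hh⟩ := g.homeo f hd hR ht
  have hfun : (fun α => Y α t) = h := funext fun α => (hh α).symm
  have hsymm : ∀ y, Y (h.symm y) t = y := fun y => by rw [← hh, h.apply_symm_apply]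
  rw [hfun] at hdom hnull ⊢
  have hδ : Tendsto (fun p : ℕ × ℕ => δ p.1) (Ft M t) (𝓝 0) :=
    squeeze_zero (fun p => (f.apx p.1).hδ.le) (fun p => (f.apx p.1).hδη) (f.η0.comp (Ft_fst M t))
  have key := vel_tend (R := R) hd (by linarith) hδ (g α t ht)
    (ρ := fun p : ℕ × ℕ => H p.1 ∘ Φ p.1 p.2) (χ := (h '' D).indicator 1) ?_ ?_
  · refine Tendsto.const_smul ?_ κ
    convert key using 2
    rw [← integral_indicator hdom.1.measurableSet]
    congr 1
    funext y
    by_cases hy : y ∈ h '' D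
    · rw [indicator_of_mem hy, indicator_of_mem hy, Pi.one_apply, one_smul]
    · rw [indicator_of_notMem hy, indicator_of_notMem hy, zero_smul]
  · filter_upwards [Ft_le M t] with p hp
    exact ⟨((f.apx p.1).st _ hp).dens, (f.apx p.1).hδ⟩
  · have hae : ∀ᵐ y : Eu d, y ∉ frontier (h '' D) := by
      rw [ae_iff]; simpa using hnull
    filter_upwards [hae] with y hy y' hy'
    rw [← h.image_frontier, hfr, h.image_eq_preimage_symm, mem_preimage] at hy
    have hne : φ (h.symm y) ≠ 0 := hy
    have a := g.rho f ht hne (y := y') (by rw [hsymm]; exact hy')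
    have hm : y ∈ h '' D ↔ φ (h.symm y) < 0 := by
      rw [h.image_eq_preimage_symm, mem_preimage, hneg]; rfl
    have ea : (h '' D).indicator (1 : Eu d → ℝ) y = if φ (h.symm y) < 0 then 1 else 0 := by
      by_cases hD : φ (h.symm y) < 0
      · rw [if_pos hD, indicator_of_mem (hm.2 hD), Pi.one_apply]
      · rw [if_neg hD, indicator_of_notMem (fun h => hD (hm.1 h))]
    rw [ea]; exact a

lemma Ft_ev {P : ℕ × ℕ → Prop} (h : ∀ᶠ p in Ft M t, P p) :
    ∃ N : ℕ, ∃ τ > 0, ∀ n k : ℕ, N ≤ n → k ≤ M n → |(k:ℝ) / M n - t| < τ → P (n, k) := by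
  unfold Ft at h
  rw [eventually_inf_principal] at h
  have b := (atTop_basis.comap (Prod.fst : ℕ × ℕ → ℕ)).inf (Metric.nhds_basis_ball (x := t).comap (fun p : ℕ × ℕ => (p.2 : ℝ) / M p.1))
  obtain ⟨⟨N, τ⟩, ⟨-, hτ⟩, hs⟩ := b.eventually_iff.1 h
  refine ⟨N, τ, hτ, fun n k hn hk hkt => ?_⟩
  exact hs (x := (n, k)) ⟨hn, hkt⟩ hk

lemma LimY.incr_le (g : LimY M X Y) (f : Fam γ κ c lam R φ η ε L δ H M Φ J X) {α v : Eu d} {e τ : ℝ} {N : ℕ}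
    (hP : ∀ n k : ℕ, N ≤ n → k ≤ M n → |(k:ℝ) / M n - t| < τ → ‖κ • vel (δ n) (H n ∘ Φ n k) (X n k α) - v‖ ≤ e)
    {s s' : ℝ} (hs : s ∈ Icc (0:ℝ) 1) (hs' : s' ∈ Icc (0:ℝ) 1) (hss : s ≤ s') (h1 : |s - t| < τ / 2) (h2 : |s' - t| < τ / 2) :
    ‖Y α s' - Y α s - (s' - s) • v‖ ≤ e * (s' - s) := by
  have hτ : 0 < τ := by have := abs_nonneg (s - t); linarith
  have t1 := (Ft_time M s).comp (f.floor hs)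
  have t2 := (Ft_time M s').comp (f.floor hs')
  have a := (((g.seq f hs' α).sub (g.seq f hs α)).sub ((t2.sub t1).smul_const v)).norm
  have b := (t2.sub t1).const_mul e
  refine le_of_tendsto_of_tendsto a b ?_
  filter_upwards [eventually_ge_atTop N, f.M0.eventually (Iio_mem_nhds (by linarith : (0:ℝ) < τ / 2))] with n hn hn2
  have hn3 : (1:ℝ) / M n < τ / 2 := hn2
  have hM0 := (f.apx n).hM
  have hM : (0:ℝ) < M n := by exact_mod_cast hM0
  have hkj : ⌊s * M n⌋₊ ≤ ⌊s' * M n⌋₊ := Nat.floor_le_floor (mul_le_mul_of_nonneg_right hss hM.le)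
  obtain ⟨l, hl⟩ := Nat.exists_eq_add_of_le hkj
  have hjM : ⌊s' * M n⌋₊ ≤ M n := floor_le_M hs'
  have e1 := floor_near hM0 hs
  have e2 := floor_near hM0 hs'
  have q := f.dist_le (n := n) (α := α) (v := v) (e := e) (k := ⌊s * M n⌋₊) l (by omega) (fun i hi1 hi2 => by
    refine hP n i hn (by omega) ?_
    have i1 : (⌊s * M n⌋₊ : ℝ) / M n ≤ i / M n := by gcongr
    have i2 : (i:ℝ) / M n ≤ (⌊s' * M n⌋₊ : ℝ) / M n := by
      have : i ≤ ⌊s' * M n⌋₊ := by omega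
      gcongr
    rw [abs_le] at e1 e2
    rw [abs_lt] at h1 h2 ⊢
    constructor <;> linarith)
  have e3 : (⌊s' * M n⌋₊ : ℝ) / M n - (⌊s * M n⌋₊ : ℝ) / M n = l / M n := by
    rw [hl]; push_cast; ring
  simp only [Function.comp_def]
  rw [e3, hl]
  exact q

lemma LimY.deriv (g : LimY M X Y) (f : Fam γ κ c lam R φ η ε L δ H M Φ J X) {α v : Eu d}
    (hv : Tendsto (fun p : ℕ × ℕ => κ • vel (δ p.1) (H p.1 ∘ Φ p.1 p.2) (X p.1 p.2 α)) (Ft M t) (𝓝 v))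
    (ht : t ∈ Icc (0:ℝ) 1) : HasDerivWithinAt (fun s => Y α s) v (Icc 0 1) t := by
  rw [hasDerivWithinAt_iff_isLittleO, Asymptotics.isLittleO_iff]
  intro e he
  have hev := (tendsto_iff_norm_sub_tendsto_zero.1 hv).eventually (Iio_mem_nhds he)
  obtain ⟨N, τ, hτ, hP⟩ := Ft_ev hev
  have hP2 : ∀ n k : ℕ, N ≤ n → k ≤ M n → |(k:ℝ) / M n - t| < τ → ‖κ • vel (δ n) (H n ∘ Φ n k) (X n k α) - v‖ ≤ e :=
    fun n k a b c => le_of_lt (hP n k a b c)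
  rw [eventually_nhdsWithin_iff]
  filter_upwards [Metric.ball_mem_nhds t (by linarith : 0 < τ / 2)] with s hs hs1
  have hs2 : |s - t| < τ / 2 := hs
  have ht2 : |t - t| < τ / 2 := by rw [sub_self, abs_zero]; linarith
  rw [Real.norm_eq_abs]
  rcases le_total t s with h | h
  · have := g.incr_le f hP2 ht hs1 h ht2 hs2
    rw [abs_of_nonneg (by linarith)]; exact this
  · have := g.incr_le f hP2 hs1 ht h hs2 ht2
    rw [abs_of_nonpos (by linarith), neg_sub]
    have e2 : Y α s - Y α t - (s - t) • v = -(Y α t - Y α s - (t - s) • v) := by module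
    rw [e2, norm_neg]; exact this

/-- local in time theorem -/
theorem local_flow (hd : 1 ≤ d) {γ : ℝ} (h0 : 0 < γ) (h1 : γ < 1) (κ : ℝ) {D : Set (Eu d)} (hD : IsC1Domain d γ D) :
    ∃ Y : Eu d → ℝ → Eu d, (∀ α, Y α 0 = α) ∧
      (∀ t ∈ Icc (0:ℝ) 1, (∃ h : Eu d ≃ₜ Eu d, ∀ α, h α = Y α t) ∧ IsC1Domain d γ ((fun α => Y α t) '' D)) ∧
      ∀ α, ∀ t ∈ Icc (0:ℝ) 1, HasDerivWithinAt (fun s => Y α s)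
        (κ • ∫ y in (fun α => Y α t) '' D, kk d 0 (Y α t - y)) (Icc 0 1) t := by
  obtain ⟨c, lam0, R0, φ, hc, hc1, hl0, hR0, hI⟩ := ini_ex h0 h1 hD
  obtain ⟨lam, R, η, ε, L, δ, H, M, Φ, J, X, -, hR, f0⟩ := fam_ex hd h0 h1 κ hc hc1 hl0 hR0 hI
  obtain ⟨σ, hσ, Y, g⟩ := f0.conv hd hR
  have f := f0.sub hσ
  have g : LimY (M ∘ σ) (X ∘ σ) Y := g
  refine ⟨Y, g.zero f, fun t ht => ⟨g.homeo f hd hR ht, g.dom f hd hR h0 hc hD.1 hD.2.1 hI.neg hI.fr ht⟩, fun α t ht => ?_⟩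
  exact g.deriv f (g.vlim f hd hR h0 hc hD.1 hD.2.1 hI.neg hI.fr ht α) ht

end AggPatch

namespace AggPatch
open MeasureTheory Metric Set Filter Topology
open scoped RealInnerProductSpace
variable {d : ℕ}

/-- velocity of the flow map at time t -/
noncomputable def vf (κ : ℝ) (X : Eu d → ℝ → Eu d) (D : Set (Eu d)) (α : Eu d) (t : ℝ) : Eu d :=
  κ • ∫ y in (fun α => X α t) '' D, kk d 0 (X α t - y)

theorem forward_flow (hd : 1 ≤ d) {γ : ℝ} (h0 : 0 < γ) (h1 : γ < 1) (κ : ℝ) {D : Set (Eu d)} (hD : IsC1Domain d γ D) :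
    ∃ X : Eu d → ℝ → Eu d, (∀ α, X α 0 = α) ∧
      (∀ t : ℝ, 0 ≤ t → (∃ h : Eu d ≃ₜ Eu d, ∀ α, h α = X α t) ∧ IsC1Domain d γ ((fun α => X α t) '' D)) ∧
      ∀ α, ∀ t : ℝ, 0 ≤ t → HasDerivWithinAt (fun s => X α s) (vf κ X D α t) (Ici 0) t := by
  choose Z z1 z2 z3 using fun E : {E : Set (Eu d) // IsC1Domain d γ E} => local_flow hd h0 h1 κ E.2
  let step : {E : Set (Eu d) // IsC1Domain d γ E} × (Eu d → Eu d) → {E : Set (Eu d) // IsC1Domain d γ E} × (Eu d → Eu d) :=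
    fun q => (⟨(fun α => Z q.1 α 1) '' q.1.1, (z2 q.1 1 (by simp)).2⟩, fun α => Z q.1 (q.2 α) 1)
  let S : ℕ → {E : Set (Eu d) // IsC1Domain d γ E} × (Eu d → Eu d) := fun n => step^[n] (⟨D, hD⟩, id)
  have hS0 : S 0 = (⟨D, hD⟩, id) := rfl
  have hS1 : ∀ n, S (n + 1) = step (S n) := fun n => Function.iterate_succ_apply' step n _
  have hP1 : ∀ n α, (S (n + 1)).2 α = Z (S n).1 ((S n).2 α) 1 := fun n α => by rw [hS1]
  have hD1 : ∀ n, ((S (n + 1)).1 : Set (Eu d)) = (fun α => Z (S n).1 α 1) '' (S n).1.1 := fun n => by rw [hS1]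
  have hom : ∀ n, ∃ h : Eu d ≃ₜ Eu d, ∀ α, h α = (S n).2 α := by
    intro n
    induction n with
    | zero => exact ⟨Homeomorph.refl _, fun α => by rw [hS0]; rfl⟩
    | succ n ih =>
      obtain ⟨h, hh⟩ := ih
      obtain ⟨k, hk⟩ := (z2 (S n).1 1 (by simp)).1
      refine ⟨h.trans k, fun α => ?_⟩
      rw [hP1, Homeomorph.trans_apply, hk, hh]
  have him : ∀ n, (S n).2 '' D = (S n).1.1 := by
    intro n
    induction n with
    | zero => rw [hS0]; exact image_id _
    | succ n ih =>
      rw [hD1, ← ih, image_image]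
      exact image_congr fun α _ => hP1 n α
  let X : Eu d → ℝ → Eu d := fun α t => Z (S ⌊t⌋₊).1 ((S ⌊t⌋₊).2 α) (t - ⌊t⌋₊)
  have hX : ∀ (n : ℕ) (t : ℝ), t ∈ Icc (n:ℝ) (n + 1) → ∀ α, X α t = Z (S n).1 ((S n).2 α) (t - n) := by
    intro n t ht α
    rcases eq_or_lt_of_le ht.2 with h | h
    · have e : ⌊t⌋₊ = n + 1 := by
        rw [h]; exact_mod_cast Nat.floor_natCast (n + 1)
      show Z (S ⌊t⌋₊).1 ((S ⌊t⌋₊).2 α) (t - ⌊t⌋₊) = _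
      rw [e, h]
      push_cast
      rw [sub_self, z1, hP1, add_sub_cancel_left]
    · have e : ⌊t⌋₊ = n := (Nat.floor_eq_iff ((Nat.cast_nonneg n).trans ht.1)).2 ⟨ht.1, h⟩
      show Z (S ⌊t⌋₊).1 ((S ⌊t⌋₊).2 α) (t - ⌊t⌋₊) = _
      rw [e]
  have hmem : ∀ (n : ℕ) (t : ℝ), t ∈ Icc (n:ℝ) (n + 1) → t - n ∈ Icc (0:ℝ) 1 := fun n t ht =>
    ⟨by linarith [ht.1], by linarith [ht.2]⟩
  have hXD : ∀ (n : ℕ) (t : ℝ), t ∈ Icc (n:ℝ) (n + 1) → (fun α => X α t) '' D = (fun α => Z (S n).1 α (t - n)) '' (S n).1.1 := by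
    intro n t ht
    rw [← him, image_image]
    exact image_congr fun α _ => hX n t ht α
  have hder : ∀ (n : ℕ) (t : ℝ), t ∈ Icc (n:ℝ) (n + 1) → ∀ α,
      HasDerivWithinAt (fun s => X α s) (vf κ X D α t) (Icc (n:ℝ) (n + 1)) t := by
    intro n t ht α
    unfold vf
    rw [hXD n t ht, hX n t ht]
    have a := z3 (S n).1 ((S n).2 α) (t - n) (hmem n t ht)
    have b : HasDerivWithinAt (fun s : ℝ => s - n) 1 (Icc (n:ℝ) (n + 1)) t := (hasDerivWithinAt_id t _).sub_const _
    have c := a.scomp t b (fun s hs => hmem n s hs)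
    rw [one_smul] at c
    exact c.congr (fun s hs => hX n s hs α) (hX n t ht α)
  refine ⟨X, fun α => ?_, fun t ht => ?_, fun α t ht => ?_⟩
  · have e := hX 0 0 (by simp) α
    rw [Nat.cast_zero, sub_zero, z1, hS0] at e
    exact e
  · have hf : t ∈ Icc ((⌊t⌋₊ : ℕ) : ℝ) (⌊t⌋₊ + 1) := ⟨Nat.floor_le ht, (Nat.lt_floor_add_one t).le⟩
    obtain ⟨⟨k, hk⟩, hdom⟩ := z2 (S ⌊t⌋₊).1 _ (hmem _ t hf)
    obtain ⟨h, hh⟩ := hom ⌊t⌋₊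
    refine ⟨⟨h.trans k, fun α => ?_⟩, ?_⟩
    · rw [hX _ t hf, Homeomorph.trans_apply, hk, hh]
    · rw [hXD _ t hf]; exact hdom
  · have hf1 : ((⌊t⌋₊ : ℕ) : ℝ) ≤ t := Nat.floor_le ht
    have hf2 := Nat.lt_floor_add_one t
    have a := hder ⌊t⌋₊ t ⟨hf1, hf2.le⟩ α
    rcases eq_or_lt_of_le hf1 with he | hlt
    · generalize ⌊t⌋₊ = n at *
      subst he
      rcases n with _ | m
      · refine a.mono_of_mem_nhdsWithin ?_
        simp only [Nat.cast_zero, zero_add]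
        exact Icc_mem_nhdsGE one_pos
      · have b := hder m ((m + 1 : ℕ) : ℝ) (by push_cast; constructor <;> linarith) α
        have u := b.union a
        refine (u.hasDerivAt ?_).hasDerivWithinAt
        push_cast
        rw [Icc_union_Icc_eq_Icc (by linarith) (by linarith)]
        exact Icc_mem_nhds (by linarith) (by linarith)
    · exact (a.hasDerivAt (Icc_mem_nhds hlt hf2)).hasDerivWithinAt

theorem global_flow (hd : 1 ≤ d) {γ : ℝ} (h0 : 0 < γ) (h1 : γ < 1) (κ : ℝ) {D : Set (Eu d)} (hD : IsC1Domain d γ D) :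
    ∃ X : Eu d → ℝ → Eu d, (∀ α, X α 0 = α) ∧
      (∀ t : ℝ, (∃ h : Eu d ≃ₜ Eu d, ∀ α, h α = X α t) ∧ IsC1Domain d γ ((fun α => X α t) '' D)) ∧
      ∀ α, ∀ t : ℝ, HasDerivAt (fun s => X α s) (vf κ X D α t) t := by
  obtain ⟨A, a1, a2, a3⟩ := forward_flow hd h0 h1 κ hD
  obtain ⟨B, b1, b2, b3⟩ := forward_flow hd h0 h1 (-κ) hD
  let X : Eu d → ℝ → Eu d := fun α t => if 0 ≤ t then A α t else B α (-t)
  have hA : ∀ t, 0 ≤ t → ∀ α, X α t = A α t := fun t ht α => if_pos ht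
  have hB : ∀ t, t ≤ 0 → ∀ α, X α t = B α (-t) := by
    intro t ht α
    rcases eq_or_lt_of_le ht with h | h
    · rw [hA t h.ge, h, neg_zero, a1, b1]
    · exact if_neg (not_le.2 h)
  have dA : ∀ t, 0 ≤ t → ∀ α, HasDerivWithinAt (fun s => X α s) (vf κ X D α t) (Ici 0) t := by
    intro t ht α
    have e : vf κ X D α t = vf κ A D α t := by unfold vf; simp only [hA t ht]
    rw [e]
    exact (a3 α t ht).congr (fun s hs => hA s hs α) (hA t ht α)
  have dB : ∀ t, t ≤ 0 → ∀ α, HasDerivWithinAt (fun s => X α s) (vf κ X D α t) (Iic 0) t := by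
    intro t ht α
    have e : vf κ X D α t = (-1 : ℝ) • vf (-κ) B D α (-t) := by
      unfold vf; simp only [hB t ht, neg_smul, one_smul, neg_neg]
    rw [e]
    have n : HasDerivWithinAt (fun s : ℝ => -s) (-1) (Iic 0) t := (hasDerivWithinAt_id t _).neg
    have c := (b3 α (-t) (by linarith)).scomp t n (fun s hs => by
      have : s ≤ 0 := hs
      show (0:ℝ) ≤ -s
      linarith)
    exact c.congr (fun s hs => hB s hs α) (hB t ht α)
  refine ⟨X, fun α => by rw [hA 0 le_rfl, a1], fun t => ?_, fun α t => ?_⟩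
  · rcases le_total 0 t with ht | ht
    · simp only [hA t ht]; exact a2 t ht
    · simp only [hB t ht]; exact b2 (-t) (by linarith)
  · rcases lt_trichotomy t 0 with ht | ht | ht
    · exact (dB t ht.le α).hasDerivAt (Iic_mem_nhds ht)
    · subst ht
      have u := (dB 0 le_rfl α).union (dA 0 le_rfl α)
      rw [Iic_union_Ici] at u
      exact u.hasDerivAt univ_mem
    · exact (dA t ht.le α).hasDerivAt (Ici_mem_nhds ht)

lemma gradN_eq (y : Eu d) : gradN d y = (sphereVol d)⁻¹ • kk d 0 y := by
  unfold gradN kk uu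
  rw [smul_smul, mul_inv, zero_pow two_ne_zero, add_zero, Real.sqrt_sq (norm_nonneg _), inv_pow]

end AggPatch

/-- Theorem 1.2: global-in-time boundary regularity for the rescaled transport problem. -/
theorem aggregation_patch_boundary_regularity_rescaled
    (d : ℕ) (hd : 2 ≤ d) (γ : ℝ) (hγ0 : 0 < γ) (hγ1 : γ < 1)
    (D₀ : Set (EuclideanSpace ℝ (Fin d))) (hD₀ : IsC1Domain d γ D₀) :
    ∃ X : EuclideanSpace ℝ (Fin d) → ℝ → EuclideanSpace ℝ (Fin d),
      (∀ α, X α 0 = α) ∧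
      (∀ t : ℝ,
        (∃ h : EuclideanSpace ℝ (Fin d) ≃ₜ EuclideanSpace ℝ (Fin d),
            ∀ α, h α = X α t) ∧
        IsC1Domain d γ ((fun α => X α t) '' D₀)) ∧
      (∀ α : EuclideanSpace ℝ (Fin d), ∀ t : ℝ,
        HasDerivAt (fun s => X α s)
          (-(∫ y in (fun α => X α t) '' D₀, gradN d (X α t - y))) t) := by
  obtain ⟨X, h1, h2, h3⟩ := AggPatch.global_flow (by omega) hγ0 hγ1 (-(sphereVol d)⁻¹) hD₀
  refine ⟨X, h1, h2, fun α t => ?_⟩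
  have e : -(∫ y in (fun α => X α t) '' D₀, gradN d (X α t - y)) = AggPatch.vf (-(sphereVol d)⁻¹) X D₀ α t := by
    unfold AggPatch.vf
    simp only [AggPatch.gradN_eq]
    rw [integral_smul, neg_smul]
  rw [e]
  exact h3 α t
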